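/- Let k₀ ≥ 2 be an integer, ε>0, and let D be a bounded domain in ℝⁿ (n>2) with boundary of class C^{k₀,ε}. Then for every multi-index γ with |γ| ≤ k₀ and every multi-index β there is a constant C such that: (i) |∂^{|γ|}U(x,z)/∂z^γ| ≤ C·δ(x)^{2−n−|γ|} for all x,z ∈ D, and (ii) |∂^{|γ|+|β|}G(x,z)/∂x^β∂z^γ| ≤ C·(|x−z|^{2−n−|γ|−|β|} + δ(x)^{2−n−|γ|−|β|}) for all x,z ∈ D, x≠z. -/

import Mathlib

noncomputable section

open MeasureTheory Metric Set Real
open scoped ENNReal NNReal RealInnerProductSpace FourierTransform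

/-- Euclidean space ℝⁿ. -/
abbrev Eu (n : ℕ) := EuclideanSpace ℝ (Fin n)

variable {n : ℕ}

/-- δ(x) = dist(x, ℝⁿ ∖ D). -/
def bdist (D : Set (Eu n)) (x : Eu n) : ℝ := Metric.infDist x Dᶜ

/-- First-order partial derivative ∂u/∂xᵢ. -/
def pd (i : Fin n) (u : Eu n → ℝ) (x : Eu n) : ℝ :=
  fderiv ℝ u x (EuclideanSpace.single i 1)

/-- Second-order partial derivative ∂²u/∂xᵢ∂xⱼ. -/
def pd2 (i j : Fin n) (u : Eu n → ℝ) : Eu n → ℝ :=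
  fun x => pd i (fun z => pd j u z) x

/-- Iterated partial derivatives along a list of coordinate directions. -/
def pdMulti : List (Fin n) → (Eu n → ℝ) → Eu n → ℝ
  | [], u => u
  | i :: L, u => pd i (pdMulti L u)

/-- The Laplacian Δu = Σᵢ ∂²u/∂xᵢ². -/
def lapl (u : Eu n → ℝ) (x : Eu n) : ℝ := ∑ i, pd2 i i u x

/-- A list of coordinate directions realizing the multi-index α. -/
def multiList (α : Fin n → ℕ) : List (Fin n) :=
  (List.finRange n).flatMap fun i => List.replicate (α i) i

/-- The derivative ∂^α u corresponding to a multi-index α. -/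
def pdAlpha (α : Fin n → ℕ) (u : Eu n → ℝ) : Eu n → ℝ := pdMulti (multiList α) u

/-- The monomial y^α. -/
def monom (α : Fin n → ℕ) (y : Eu n) : ℝ := ∏ i, y i ^ α i

/-- α! = ∏ᵢ (αᵢ)!. -/
def multiFact (α : Fin n → ℕ) : ℕ := ∏ i, Nat.factorial (α i)

/-- |α| = Σᵢ αᵢ. -/
def multiDeg (α : Fin n → ℕ) : ℕ := ∑ i, α i

/-- The finite set of multi-indices of degree at most k. -/
def multiIdxLE (n k : ℕ) : Finset (Fin n → ℕ) :=
  (Fintype.piFinset fun _ : Fin n => Finset.range (k + 1)).filter fun α => multiDeg α ≤ k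

/-- A bounded domain: open, connected, bounded. -/
def IsBddDomain (D : Set (Eu n)) : Prop :=
  IsOpen D ∧ IsConnected D ∧ Bornology.IsBounded D

/-- `v` is an outward unit normal vector to `D` at the boundary point `y`. -/
def IsOutwardNormalAt (D : Set (Eu n)) (y v : Eu n) : Prop :=
  ‖v‖ = 1 ∧ ∃ ε > 0, (∀ t : ℝ, 0 < t → t < ε → y + t • v ∉ closure D) ∧
    ∀ t : ℝ, 0 < t → t < ε → y - t • v ∈ D

/-- Hölder class C^s regularity of a globally defined function: it is C^⌊s⌋ and,
if s is not an integer, its ⌊s⌋-th derivative is Hölder continuous of exponent s - ⌊s⌋. -/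
def HolderSmooth (s : ℝ) (g : Eu n → ℝ) : Prop :=
  ContDiff ℝ (⌊s⌋₊ : ℕ) g ∧
    (s ≠ (⌊s⌋₊ : ℕ) → ∃ C : ℝ≥0,
      HolderWith C (s - (⌊s⌋₊ : ℕ)).toNNReal (iteratedFDeriv ℝ ⌊s⌋₊ g))

/-- C^{k,ε} regularity: C^k with ε-Hölder k-th derivatives. -/
def CkHolder (k : ℕ) (ε : ℝ) (g : Eu n → ℝ) : Prop :=
  ContDiff ℝ (k : ℕ) g ∧ ∃ C : ℝ≥0, HolderWith C ε.toNNReal (iteratedFDeriv ℝ k g)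

/-- `D` has boundary which is locally the graph of a function enjoying the regularity
property `R`: near each boundary point, after choosing a unit direction `v`, the domain
is the subgraph `{x | ⟪x,v⟫ < g x}` of a function `g` depending only on the component
orthogonal to `v`. -/
def HasGraphBoundary (D : Set (Eu n)) (R : (Eu n → ℝ) → Prop) : Prop :=
  ∀ y ∈ frontier D, ∃ v : Eu n, ‖v‖ = 1 ∧ ∃ V : Set (Eu n), IsOpen V ∧ y ∈ V ∧
    ∃ g : Eu n → ℝ, R g ∧ (∀ x : Eu n, g x = g (x - ⟪x, v⟫ • v)) ∧
      D ∩ V = {x ∈ V | ⟪x, v⟫ < g x} ∧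
      frontier D ∩ V = {x ∈ V | ⟪x, v⟫ = g x}

/-- The surface area ωₙ of the unit sphere in ℝⁿ. -/
def sphereArea (n : ℕ) : ℝ := n * (volume (Metric.ball (0 : Eu n) 1)).toReal

/-- The fundamental solution Γ of the Laplacian on ℝⁿ, n > 2. -/
def fundSol (n : ℕ) (x : Eu n) : ℝ :=
  -(((n : ℝ) - 2)⁻¹ * (sphereArea n)⁻¹ * ‖x‖ ^ (2 - (n : ℝ)))

/-- `u` is harmonic on `D`. -/
def IsHarmonicOn (u : Eu n → ℝ) (D : Set (Eu n)) : Prop :=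
  ContDiffOn ℝ 2 u D ∧ ∀ x ∈ D, lapl u x = 0

/-- `U` is the harmonic correction for the Green's function of `D`: for each `y ∈ D`,
`U(·,y)` is harmonic in `D`, continuous on `D̄`, with boundary values `Γ(y−·)`. -/
def IsGreenCorrection (D : Set (Eu n)) (U : Eu n → Eu n → ℝ) : Prop :=
  ∀ y ∈ D, IsHarmonicOn (fun x => U x y) D ∧
    ContinuousOn (fun x => U x y) (closure D) ∧
    ∀ x ∈ frontier D, U x y = fundSol n (y - x)

/-- The Green's function G(x,y) = Γ(x−y) − U(x,y). -/
def greenFn (U : Eu n → Eu n → ℝ) : Eu n → Eu n → ℝ :=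
  fun x y => fundSol n (x - y) - U x y

/-- `V` is the correction for the Neumann kernel of `D`: for each `y ∈ D`, `V(·,y)` solves
`ΔV(·,y) = Vol(D)⁻¹` in `D` with normal derivative `∂Γ(y−·)/∂ν` on `∂D`. -/
def IsNeumannCorrection (D : Set (Eu n)) (V : Eu n → Eu n → ℝ) : Prop :=
  ∀ y ∈ D, (ContDiffOn ℝ 2 (fun x => V x y) D ∧
      ∀ x ∈ D, lapl (fun x' => V x' y) x = ((volume D).toReal)⁻¹) ∧
    ∀ z ∈ frontier D, ∀ v : Eu n, IsOutwardNormalAt D z v →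
      fderiv ℝ (fun x => V x y) z v = fderiv ℝ (fun x => fundSol n (y - x)) z v

/-- `u` solves the Dirichlet problem Δu = f in D, u = 0 on ∂D. -/
def IsDirichletSol (D : Set (Eu n)) (f u : Eu n → ℝ) : Prop :=
  ContDiffOn ℝ 2 u D ∧ (∀ x ∈ D, lapl u x = f x) ∧
    ContinuousOn u (closure D) ∧ ∀ x ∈ frontier D, u x = 0

/-- `u` solves the Neumann problem Δu = f in D, ∂u/∂ν = 0 on ∂D. -/
def IsNeumannSol (D : Set (Eu n)) (f u : Eu n → ℝ) : Prop :=
  ContDiffOn ℝ 2 u D ∧ (∀ x ∈ D, lapl u x = f x) ∧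
    ∀ y ∈ frontier D, ∀ v : Eu n, IsOutwardNormalAt D y v → fderiv ℝ u y v = 0

/-- A fixed nonnegative smooth bump function supported in the unit ball with integral one. -/
structure IsBump (n : ℕ) (φ : Eu n → ℝ) : Prop where
  smooth : ContDiff ℝ (⊤ : ℕ∞) φ
  supp : ∀ x : Eu n, 1 ≤ ‖x‖ → φ x = 0
  nonneg : ∀ x, 0 ≤ φ x
  integral_one : ∫ x, φ x = 1

/-- φ_t(x) = t⁻ⁿ φ(x/t). -/
def dil (φ : Eu n → ℝ) (t : ℝ) (x : Eu n) : ℝ := t⁻¹ ^ n * φ (t⁻¹ • x)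

/-- The radial maximal function f⁺(x) = sup_{0<t<δ(x)} |∫_D φ_t(x−y) f(y) dy|. -/
def radMax (D : Set (Eu n)) (φ f : Eu n → ℝ) (x : Eu n) : ℝ :=
  ⨆ t : {t : ℝ // 0 < t ∧ t < bdist D x}, |∫ y in D, dil φ (t : ℝ) (x - y) * f y|

/-- The h^p_r(D) (quasi-)norm: the L^p(D) norm of the radial maximal function. -/
def hrNorm (D : Set (Eu n)) (φ : Eu n → ℝ) (p : ℝ) (f : Eu n → ℝ) : ℝ≥0∞ :=
  eLpNorm (radMax D φ f) (ENNReal.ofReal p) (volume.restrict D)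

/-- The local (Goldberg) maximal function sup_{0<t<1} |φ_t * g(x)|. -/
def locMax (φ g : Eu n → ℝ) (x : Eu n) : ℝ :=
  ⨆ t : {t : ℝ // 0 < t ∧ t < 1}, |∫ y, dil φ (t : ℝ) (x - y) * g y|

/-- Membership in the local Hardy space h^p(ℝⁿ). -/
def MemHp (φ : Eu n → ℝ) (p : ℝ) (g : Eu n → ℝ) : Prop :=
  Measurable g ∧ eLpNorm (locMax φ g) (ENNReal.ofReal p) volume < ⊤

/-- `g` is an extension of `f` to ℝⁿ vanishing off `D̄`. -/
def IsHpzExtension (D : Set (Eu n)) (f g : Eu n → ℝ) : Prop :=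
  (∀ x ∈ D, g x = f x) ∧ ∀ x ∉ closure D, g x = 0

/-- Membership in h^p_z(D): f has an extension in h^p(ℝⁿ) vanishing off D̄. -/
def MemHpz (D : Set (Eu n)) (φ : Eu n → ℝ) (p : ℝ) (f : Eu n → ℝ) : Prop :=
  ∃ g, IsHpzExtension D f g ∧ MemHp φ p g

/-- The h^p_z(D) (quasi-)norm: infimum of h^p(ℝⁿ) norms over all admissible extensions. -/
def hzNorm (D : Set (Eu n)) (φ : Eu n → ℝ) (p : ℝ) (f : Eu n → ℝ) : ℝ≥0∞ :=
  ⨅ g ∈ {g | IsHpzExtension D f g},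
    eLpNorm (locMax φ g) (ENNReal.ofReal p) volume

/-- An axis-parallel cube in ℝⁿ, given by its center and half side length. -/
structure Cube (n : ℕ) where
  center : Eu n
  half : ℝ
  half_pos : 0 < half

/-- The cube concentric with Q whose side length is c times that of Q. -/
def Cube.scaled (Q : Cube n) (c : ℝ) : Set (Eu n) :=
  {x | ∀ i, |x i - Q.center i| ≤ c * Q.half}

/-- The cube Q as a subset of ℝⁿ. -/
def Cube.carrier (Q : Cube n) : Set (Eu n) := Q.scaled 1

/-- |Q|, the volume of Q. -/
def Cube.vol (Q : Cube n) : ℝ := (2 * Q.half) ^ n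

/-- The side length of Q. -/
def Cube.side (Q : Cube n) : ℝ := 2 * Q.half

/-- [n(1/p−1)]. -/
def npIndex (n : ℕ) (p : ℝ) : ℕ := ⌊(n : ℝ) * (1 / p - 1)⌋₊

/-- An h^p(ℝⁿ) atom (p-atom) supported in the cube Q. -/
def IsPAtom (n : ℕ) (p : ℝ) (Q : Cube n) (a : Eu n → ℝ) : Prop :=
  Measurable a ∧ (∃ M : ℝ, ∀ x, |a x| ≤ M) ∧ (∀ x ∉ Q.carrier, a x = 0) ∧
    (∫ x, a x ^ 2) ≤ Q.vol ^ (1 - 2 / p) ∧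
    (Q.vol ≤ 1 → ∀ α : Fin n → ℕ, multiDeg α ≤ npIndex n p →
      ∫ x, monom α x * a x = 0)

/-- `g` is the weak partial derivative ∂f/∂xᵢ on `D`. -/
def IsWeakPd (D : Set (Eu n)) (i : Fin n) (f g : Eu n → ℝ) : Prop :=
  ∀ ψ : Eu n → ℝ, ContDiff ℝ (⊤ : ℕ∞) ψ → HasCompactSupport ψ → tsupport ψ ⊆ D →
    ∫ x in D, f x * pd i ψ x = -∫ x in D, g x * ψ x

/-- `g` is an iterated weak derivative of `f` on `D` along the list of directions `L`. -/
def IsWeakDerivSeq (D : Set (Eu n)) : List (Fin n) → (Eu n → ℝ) → (Eu n → ℝ) → Prop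
  | [], f, g => ∀ x ∈ D, f x = g x
  | i :: L, f, g => ∃ h, IsWeakDerivSeq D L f h ∧ IsWeakPd D i h g

/-- Membership in the Hardy–Sobolev space h^{k,p}_z(D): all weak derivatives of order ≤ k
lie in h^p_z(D). -/
def MemHkz (D : Set (Eu n)) (φ : Eu n → ℝ) (p : ℝ) (k : ℕ) (f : Eu n → ℝ) : Prop :=
  ∀ L : List (Fin n), L.length ≤ k → ∃ g, IsWeakDerivSeq D L f g ∧ MemHpz D φ p g

/-- The h^{k,p}_z(D) (quasi-)norm. -/
def hkzNorm (D : Set (Eu n)) (φ : Eu n → ℝ) (p : ℝ) (k : ℕ) (f : Eu n → ℝ) : ℝ≥0∞ :=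
  ⨆ L : {L : List (Fin n) // L.length ≤ k},
    ⨅ g ∈ {g | IsWeakDerivSeq D (L : List (Fin n)) f g}, hzNorm D φ p g

/-- The h^{k,p}_r(D) (quasi-)norm. -/
def hkrNorm (D : Set (Eu n)) (φ : Eu n → ℝ) (p : ℝ) (k : ℕ) (f : Eu n → ℝ) : ℝ≥0∞ :=
  ⨆ L : {L : List (Fin n) // L.length ≤ k},
    ⨅ g ∈ {g | IsWeakDerivSeq D (L : List (Fin n)) f g}, hrNorm D φ p g

open Filter Topology

open Filter Topology

/-- The `i`-th standard basis vector. -/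
abbrev eb (i : Fin n) : Eu n := EuclideanSpace.single i 1

/-- The discrete Laplacian with step `h`. -/
def discLap (u : Eu n → ℝ) (z : Eu n) (h : ℝ) : ℝ :=
  ∑ i, (u (z + h • eb i) + u (z - h • eb i) - 2 * u z)

/-- Continuous functions whose normalized discrete Laplacian tends to zero. -/
def Harm (u : Eu n → ℝ) (O : Set (Eu n)) : Prop :=
  ContinuousOn u O ∧ ∀ z ∈ O, Tendsto (fun h => discLap u z h / h ^ 2) (𝓝[>] 0) (𝓝 0)

theorem Harm.mono {u : Eu n → ℝ} {O O' : Set (Eu n)} (hu : Harm u O) (h : O' ⊆ O) : Harm u O' :=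
  ⟨hu.1.mono h, fun z hz => hu.2 z (h hz)⟩

theorem discLap_linear (a b : ℝ) (u v : Eu n → ℝ) (z : Eu n) (h : ℝ) :
    discLap (fun x => a * u x + b * v x) z h = a * discLap u z h + b * discLap v z h := by
  simp only [discLap, Finset.mul_sum, ← Finset.sum_add_distrib]
  exact Finset.sum_congr rfl fun i _ => by ring

theorem Harm.linear {u v : Eu n → ℝ} {O : Set (Eu n)} (a b : ℝ) (hu : Harm u O) (hv : Harm v O) :
    Harm (fun x => a * u x + b * v x) O := by
  refine ⟨(continuousOn_const.mul hu.1).add (continuousOn_const.mul hv.1), fun z hz => ?_⟩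
  have := ((hu.2 z hz).const_mul a).add ((hv.2 z hz).const_mul b)
  simp only [mul_zero, add_zero] at this
  refine this.congr fun h => ?_
  rw [discLap_linear]; ring

theorem Harm.sub {u v : Eu n → ℝ} {O : Set (Eu n)} (hu : Harm u O) (hv : Harm v O) :
    Harm (fun x => u x - v x) O := by
  simpa [sub_eq_add_neg] using hu.linear 1 (-1) hv

theorem Harm.add {u v : Eu n → ℝ} {O : Set (Eu n)} (hu : Harm u O) (hv : Harm v O) :
    Harm (fun x => u x + v x) O := by
  simpa [sub_eq_add_neg] using hu.linear 1 1 hv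

theorem Harm.const_mul {u : Eu n → ℝ} {O : Set (Eu n)} (hu : Harm u O) (a : ℝ) :
    Harm (fun x => a * u x) O := by
  simpa [sub_eq_add_neg] using hu.linear a 0 hu

theorem Harm.neg {u : Eu n → ℝ} {O : Set (Eu n)} (hu : Harm u O) :
    Harm (fun x => - u x) O := by
  simpa using hu.const_mul (-1)

theorem harm_const (c : ℝ) (O : Set (Eu n)) : Harm (fun _ => c) O := by
  refine ⟨continuousOn_const, fun z _ => ?_⟩
  have : ∀ h, discLap (fun _ : Eu n => c) z h = 0 := fun h => by
    unfold discLap; exact Finset.sum_eq_zero fun i _ => by ring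
  simp [this]

theorem Harm.congr {u v : Eu n → ℝ} {O : Set (Eu n)} (hO : IsOpen O) (hu : Harm u O)
    (h : ∀ x ∈ O, v x = u x) : Harm v O := by
  refine ⟨hu.1.congr h, fun z hz => (hu.2 z hz).congr' ?_⟩
  have h1 : ∀ i : Fin n, ∀ᶠ t : ℝ in 𝓝[>] 0, z + t • eb i ∈ O ∧ z - t • eb i ∈ O := by
    intro i
    refine Filter.Eventually.filter_mono nhdsWithin_le_nhds ?_
    have c1 : Tendsto (fun t : ℝ => z + t • eb i) (𝓝 0) (𝓝 z) := by
      have : Continuous (fun t : ℝ => z + t • eb i) := by fun_prop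
      simpa using this.tendsto 0
    have c2 : Tendsto (fun t : ℝ => z - t • eb i) (𝓝 0) (𝓝 z) := by
      have : Continuous (fun t : ℝ => z - t • eb i) := by fun_prop
      simpa using this.tendsto 0
    exact (c1.eventually (hO.mem_nhds hz)).and (c2.eventually (hO.mem_nhds hz))
  filter_upwards [eventually_all.2 h1] with t ht
  congr 1
  exact Finset.sum_congr rfl fun i _ => by rw [h _ (ht i).1, h _ (ht i).2, h _ hz]

theorem Harm.comp_affine {u : Eu n → ℝ} {O : Set (Eu n)} (hu : Harm u O) (c : Eu n) {r : ℝ}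
    (hr : 0 < r) : Harm (fun y => u (c + r • y)) {y | c + r • y ∈ O} := by
  refine ⟨hu.1.comp (by fun_prop) fun y hy => hy, fun z hz => ?_⟩
  have h1 : Tendsto (fun h : ℝ => r * h) (𝓝[>] 0) (𝓝[>] 0) := by
    refine tendsto_nhdsWithin_iff.2 ⟨?_, ?_⟩
    · have : Continuous fun h : ℝ => r * h := by fun_prop
      simpa using (this.tendsto 0).mono_left nhdsWithin_le_nhds
    · filter_upwards [self_mem_nhdsWithin] with t ht using mul_pos hr ht
  have h2 := ((hu.2 _ hz).comp h1).const_mul (r ^ 2)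
  rw [mul_zero] at h2
  refine h2.congr fun h => ?_
  have : discLap (fun y => u (c + r • y)) z h = discLap u (c + r • z) (r * h) := by
    unfold discLap
    refine Finset.sum_congr rfl fun i _ => ?_
    simp only [smul_add, smul_sub, smul_smul, add_assoc, add_sub_assoc]
  rw [this]
  simp only [Function.comp]
  field_simp

theorem discLap_sq (c z : Eu n) (h : ℝ) :
    discLap (fun x => ‖x - c‖ ^ 2) z h = 2 * n * h ^ 2 := by
  unfold discLap
  have : ∀ i : Fin n, ‖z + h • eb i - c‖ ^ 2 + ‖z - h • eb i - c‖ ^ 2 - 2 * ‖z - c‖ ^ 2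
      = 2 * h ^ 2 := by
    intro i
    have e1 : z + h • eb i - c = (z - c) + h • eb i := by abel
    have e2 : z - h • eb i - c = (z - c) - h • eb i := by abel
    have h3 : ‖h • (eb i : Eu n)‖ = |h| := by simp [norm_smul]
    rw [e1, e2, norm_add_sq_real (z - c), norm_sub_sq_real (z - c) (h • eb i), h3, sq_abs]; ring
  rw [Finset.sum_congr rfl fun i _ => this i]
  simp; ring

/-- Maximum principle. -/
theorem Harm.le_of_frontier [NeZero n] {u : Eu n → ℝ} {O : Set (Eu n)} (hO : IsOpen O)
    (hb : Bornology.IsBounded O) (hu : Harm u O) (hc : ContinuousOn u (closure O)) {m : ℝ}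
    (hm : ∀ x ∈ frontier O, u x ≤ m) : ∀ x ∈ closure O, u x ≤ m := by
  intro x0 hx0
  by_contra! hlt
  obtain ⟨R, hR⟩ := hb.closure.subset_ball (0 : Eu n)
  have hR0 : 0 < R := by
    have := hR hx0
    rw [mem_ball] at this
    exact lt_of_le_of_lt dist_nonneg this
  set τ := (u x0 - m) / (2 * R ^ 2) with hτ
  have hτ0 : 0 < τ := div_pos (by linarith) (by positivity)
  have hcw : ContinuousOn (fun x => u x + τ * ‖x - 0‖ ^ 2) (closure O) :=
    hc.add (by fun_prop)
  obtain ⟨z, hz, hzmax⟩ := hb.isCompact_closure.exists_isMaxOn ⟨x0, hx0⟩ hcw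
  have hwz : u x0 ≤ u z + τ * ‖z - 0‖ ^ 2 := by
    have := hzmax hx0
    simp only [mem_ofPred_eq] at this
    nlinarith [sq_nonneg ‖x0 - 0‖]
  have hzR : ‖z - 0‖ ^ 2 ≤ R ^ 2 := by
    have := hR hz
    rw [mem_ball, dist_eq_norm] at this
    gcongr
  have hzO : z ∈ O := by
    by_contra hzO
    have hzf : z ∈ frontier O := ⟨hz, by rwa [hO.interior_eq]⟩
    have h1 := hm z hzf
    have h2 : τ * ‖z - 0‖ ^ 2 ≤ τ * R ^ 2 := by gcongr
    have h3 : τ * R ^ 2 = (u x0 - m) / 2 := by rw [hτ]; field_simp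
    linarith
  have hev : ∀ᶠ h : ℝ in 𝓝[>] 0, discLap u z h / h ^ 2 ≤ - (2 * n * τ) := by
    have h1 : ∀ i : Fin n, ∀ᶠ t : ℝ in 𝓝[>] 0, z + t • eb i ∈ O ∧ z - t • eb i ∈ O := by
      intro i
      refine Filter.Eventually.filter_mono nhdsWithin_le_nhds ?_
      have c1 : Tendsto (fun t : ℝ => z + t • eb i) (𝓝 0) (𝓝 z) := by
        have : Continuous (fun t : ℝ => z + t • eb i) := by fun_prop
        simpa using this.tendsto 0
      have c2 : Tendsto (fun t : ℝ => z - t • eb i) (𝓝 0) (𝓝 z) := by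
        have : Continuous (fun t : ℝ => z - t • eb i) := by fun_prop
        simpa using this.tendsto 0
      exact (c1.eventually (hO.mem_nhds hzO)).and (c2.eventually (hO.mem_nhds hzO))
    filter_upwards [eventually_all.2 h1, self_mem_nhdsWithin] with t ht ht0
    have hd : discLap (fun x => 1 * u x + τ * ‖x - 0‖ ^ 2) z t ≤ 0 := by
      refine Finset.sum_nonpos fun i _ => ?_
      have a1 := hzmax (subset_closure (ht i).1)
      have a2 := hzmax (subset_closure (ht i).2)
      simp only [mem_ofPred_eq] at a1 a2
      linarith
    rw [discLap_linear 1 τ u (fun x => ‖x - 0‖ ^ 2), discLap_sq] at hd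
    rw [div_le_iff₀ (pow_pos ht0 2)]
    linarith
  have := le_of_tendsto (hu.2 z hzO) hev
  have hn : (0 : ℝ) < n := by exact_mod_cast Nat.pos_of_ne_zero (NeZero.ne n)
  have : 0 < 2 * n * τ := by positivity
  linarith

theorem Harm.abs_le_of_frontier [NeZero n] {u : Eu n → ℝ} {O : Set (Eu n)} (hO : IsOpen O)
    (hb : Bornology.IsBounded O) (hu : Harm u O) (hc : ContinuousOn u (closure O)) {m : ℝ}
    (hm : ∀ x ∈ frontier O, |u x| ≤ m) : ∀ x ∈ closure O, |u x| ≤ m := by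
  intro x hx
  refine abs_le.2 ⟨?_, Harm.le_of_frontier hO hb hu hc (fun x hx => (abs_le.1 (hm x hx)).2) x hx⟩
  have := Harm.le_of_frontier hO hb hu.neg hc.neg (m := m)
    (fun x hx => by linarith [(abs_le.1 (hm x hx)).1]) x hx
  linarith

theorem Harm.le_of_frontier_le [NeZero n] {u v : Eu n → ℝ} {O : Set (Eu n)} (hO : IsOpen O)
    (hb : Bornology.IsBounded O) (hu : Harm u O) (hc : ContinuousOn u (closure O))
    (hv : Harm v O) (hcv : ContinuousOn v (closure O))
    (hm : ∀ x ∈ frontier O, u x ≤ v x) : ∀ x ∈ closure O, u x ≤ v x := by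
  intro x hx
  have := Harm.le_of_frontier hO hb (hu.sub hv) (hc.sub hcv) (m := 0)
    (fun x hx => by linarith [hm x hx]) x hx
  linarith

theorem tendsto_second_difference {u : Eu n → ℝ} {z : Eu n} (hu : ContDiffAt ℝ 2 u z) (i : Fin n) :
    Tendsto (fun h : ℝ => (u (z + h • eb i) + u (z - h • eb i) - 2 * u z) / h ^ 2) (𝓝[>] 0)
      (𝓝 (pd2 i i u z)) := by
  have hline : ∀ t : ℝ, HasDerivAt (fun t : ℝ => z + t • eb i) (eb i : Eu n) t := fun t => by
    simpa using ((hasDerivAt_id t).smul_const (eb i : Eu n)).const_add z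
  have hline' : ∀ t : ℝ, HasDerivAt (fun t : ℝ => z - t • eb i) (-(eb i) : Eu n) t := fun t => by
    simpa using ((hasDerivAt_id t).smul_const (eb i : Eu n)).const_sub z
  have c1 : Tendsto (fun t : ℝ => z + t • eb i) (𝓝 0) (𝓝 z) := by
    have : Continuous (fun t : ℝ => z + t • eb i) := by fun_prop
    simpa using this.tendsto 0
  have c2 : Tendsto (fun t : ℝ => z - t • eb i) (𝓝 0) (𝓝 z) := by
    have : Continuous (fun t : ℝ => z - t • eb i) := by fun_prop
    simpa using this.tendsto 0
  have hd : ∀ᶠ y in 𝓝 z, DifferentiableAt ℝ u y := by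
    filter_upwards [hu.eventually (by simp)] with y hy using hy.differentiableAt (by simp)
  have hpd : DifferentiableAt ℝ (fun y => pd i u y) z := by
    have : DifferentiableAt ℝ (fderiv ℝ u) z :=
      (hu.fderiv_right (m := 1) (by norm_num)).differentiableAt (by simp)
    exact this.clm_apply (differentiableAt_const _)
  have hG : HasDerivAt (fun t : ℝ => pd i u (z + t • eb i) - pd i u (z - t • eb i))
      (2 * pd2 i i u z) 0 := by
    have h0 : HasFDerivAt (fun y => pd i u y) (fderiv ℝ (fun y => pd i u y) z) (z + (0:ℝ) • eb i) := by
      simpa using hpd.hasFDerivAt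
    have h0' : HasFDerivAt (fun y => pd i u y) (fderiv ℝ (fun y => pd i u y) z) (z - (0:ℝ) • eb i) := by
      simpa using hpd.hasFDerivAt
    have := (h0.comp_hasDerivAt (0:ℝ) (hline 0)).sub (h0'.comp_hasDerivAt (0:ℝ) (hline' 0))
    refine this.congr_deriv ?_
    rw [map_neg]; simp only [pd2, pd]; ring
  refine HasDerivAt.lhopital_zero_nhdsGT
    (f' := fun t => pd i u (z + t • eb i) - pd i u (z - t • eb i)) (g' := fun t => 2 * t) ?_ ?_ ?_ ?_ ?_ ?_
  · refine Filter.Eventually.filter_mono nhdsWithin_le_nhds ?_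
    filter_upwards [c1.eventually hd, c2.eventually hd] with t h1 h2
    have := ((h1.hasFDerivAt.comp_hasDerivAt t (hline t)).add
      (h2.hasFDerivAt.comp_hasDerivAt t (hline' t))).sub_const (2 * u z)
    refine this.congr_deriv ?_
    rw [map_neg]; simp only [pd]; ring
  · exact Eventually.of_forall fun t => by simpa using hasDerivAt_pow 2 t
  · filter_upwards [self_mem_nhdsWithin] with t ht
    have : (0:ℝ) < t := ht
    positivity
  · have h1 : Tendsto (fun h : ℝ => u (z + h • eb i) + u (z - h • eb i) - 2 * u z) (𝓝 0)
        (𝓝 (u z + u z - 2 * u z)) :=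
      (((hu.continuousAt.tendsto.comp c1).add (hu.continuousAt.tendsto.comp c2)).sub_const _)
    rw [show u z + u z - 2 * u z = 0 by ring] at h1
    exact h1.mono_left nhdsWithin_le_nhds
  · have : Continuous fun t : ℝ => t ^ 2 := by fun_prop
    simpa using (this.tendsto 0).mono_left (nhdsWithin_le_nhds (s := Ioi 0))
  · have h1 := hG.tendsto_slope_zero_right
    simp only [zero_add, zero_smul, add_zero, sub_zero, sub_self, smul_eq_mul] at h1
    have h2 := h1.const_mul (1 / 2)
    rw [show 1 / 2 * (2 * pd2 i i u z) = pd2 i i u z by ring] at h2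
    refine h2.congr' ?_
    filter_upwards [self_mem_nhdsWithin] with t ht
    have : (0:ℝ) < t := ht
    field_simp

theorem tendsto_discLap {u : Eu n → ℝ} {z : Eu n} (hu : ContDiffAt ℝ 2 u z) :
    Tendsto (fun h : ℝ => discLap u z h / h ^ 2) (𝓝[>] 0) (𝓝 (lapl u z)) := by
  have := tendsto_finsetSum Finset.univ fun i _ => tendsto_second_difference hu i
  refine this.congr fun h => ?_
  rw [discLap, Finset.sum_div]

theorem IsHarmonicOn.harm {u : Eu n → ℝ} {D : Set (Eu n)} (hD : IsOpen D) (hu : IsHarmonicOn u D) :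
    Harm u D := by
  refine ⟨hu.1.continuousOn, fun z hz => ?_⟩
  have := tendsto_discLap (hu.1.contDiffAt (hD.mem_nhds hz))
  rwa [hu.2 z hz] at this

theorem discLap_coord (c z : Eu n) (i : Fin n) (h : ℝ) :
    discLap (fun y => y i - c i) z h = 0 :=
  Finset.sum_eq_zero fun j _ => by simp; ring

theorem discLap_coord_sq (c z : Eu n) (i : Fin n) (h : ℝ) :
    discLap (fun y => (y i - c i) ^ 2) z h = 2 * h ^ 2 := by
  rw [discLap, Finset.sum_eq_single i]
  · simp; ring
  · intro j _ hj
    simp [Ne.symm hj]; ring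
  · simp

theorem harm_coord (c : Eu n) (i : Fin n) (O : Set (Eu n)) : Harm (fun y => y i - c i) O :=
  ⟨by fun_prop, fun z _ => by simp [discLap_coord]⟩

theorem harm_quadratic (c : Eu n) (i : Fin n) (O : Set (Eu n)) :
    Harm (fun y => ‖y - c‖ ^ 2 - n * (y i - c i) ^ 2) O := by
  refine ⟨by fun_prop, fun z _ => ?_⟩
  have : ∀ h, discLap (fun y => 1 * ‖y - c‖ ^ 2 + (-n) * (y i - c i) ^ 2) z h = 0 := fun h => by
    rw [discLap_linear 1 (-(n:ℝ)) (fun y => ‖y - c‖ ^ 2) (fun y => (y i - c i) ^ 2), discLap_sq,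
      discLap_coord_sq]; ring
  simp only [one_mul, neg_mul, ← sub_eq_add_neg] at this
  simp [this]

/-- Barrier of the form `(‖y-c‖² + n (s r - s²)) / r²` with `s = yᵢ - cᵢ`. -/
def barrier (c : Eu n) (i : Fin n) (r : ℝ) (y : Eu n) : ℝ :=
  (‖y - c‖ ^ 2 + n * ((y i - c i) * r - (y i - c i) ^ 2)) / r ^ 2

theorem harm_barrier (c : Eu n) (i : Fin n) (r : ℝ) (O : Set (Eu n)) : Harm (barrier c i r) O := by
  have := ((harm_quadratic c i O).add ((harm_coord c i O).const_mul (n * r))).const_mul (1 / r ^ 2)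
  convert this using 2
  simp only [barrier]; ring

theorem barrier_nonneg (c : Eu n) (i : Fin n) {r : ℝ} (y : Eu n) (h0 : 0 ≤ y i - c i)
    (h1 : y i - c i ≤ r) : 0 ≤ barrier c i r y := by
  unfold barrier
  have : 0 ≤ (y i - c i) * r - (y i - c i) ^ 2 := by nlinarith
  positivity

theorem one_le_barrier (c : Eu n) (i : Fin n) {r : ℝ} (hr : 0 < r) (y : Eu n) (h0 : 0 ≤ y i - c i)
    (h1 : y i - c i ≤ r) (hy : ‖y - c‖ = r) : 1 ≤ barrier c i r y := by
  unfold barrier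
  have : 0 ≤ (n:ℝ) * ((y i - c i) * r - (y i - c i) ^ 2) := mul_nonneg (by positivity) (by nlinarith)
  rw [le_div_iff₀ (by positivity), hy]; linarith

theorem barrier_add_smul_le (c : Eu n) (i : Fin n) {r t : ℝ} (hr : 0 < r) (ht : 0 ≤ t) (htr : t ≤ r) :
    barrier c i r (c + t • eb i) ≤ (n + 1) * t / r := by
  have h1 : (c + t • eb i : Eu n) - c = t • eb i := by abel
  have h2 : (c + t • eb i : Eu n) i - c i = t := by simp
  unfold barrier
  rw [h1, h2, norm_smul]
  simp only [norm_eq_abs, PiLp.norm_single, abs_one, mul_one, sq_abs]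
  rw [div_le_div_iff₀ (by positivity) hr]
  have hn : (0:ℝ) ≤ n := by positivity
  have : t ^ 2 + n * (t * r - t ^ 2) ≤ (n + 1) * t * r := by nlinarith [mul_nonneg hn (sq_nonneg t), mul_nonneg ht (sub_nonneg.2 htr)]
  calc _ ≤ ((n + 1) * t * r) * r := by gcongr
    _ = _ := by ring

theorem abs_coord_le (y c : Eu n) (i : Fin n) : |y i - c i| ≤ ‖y - c‖ := by
  have := PiLp.norm_apply_le (y - c) i
  simpa using this

/-- Reflection in the hyperplane through `c` orthogonal to the `i`-th axis. -/
def hflip (c : Eu n) (i : Fin n) (y : Eu n) : Eu n := y - (2 * (y i - c i)) • eb i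

theorem hflip_add_self (c : Eu n) (i j : Fin n) (y : Eu n) (h : ℝ) :
    hflip c i (y + h • eb j) = if j = i then hflip c i y - h • eb j else hflip c i y + h • eb j := by
  split_ifs with hj
  · subst hj; simp [hflip]; module
  · have : i ≠ j := Ne.symm hj
    simp [hflip, this]; module

theorem norm_hflip_sub (c : Eu n) (i : Fin n) (y : Eu n) : ‖hflip c i y - c‖ = ‖y - c‖ := by
  rw [← sq_eq_sq₀ (norm_nonneg _) (norm_nonneg _)]
  have : hflip c i y - c = (y - c) - (2 * (y i - c i)) • eb i := by unfold hflip; abel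
  rw [this, norm_sub_sq_real, norm_smul, inner_smul_right, EuclideanSpace.inner_single_right]
  simp [mul_pow]; ring

theorem continuous_hflip (c : Eu n) (i : Fin n) : Continuous (hflip c i) := by
  unfold hflip; fun_prop

theorem Harm.comp_hflip {u : Eu n → ℝ} {O : Set (Eu n)} (hu : Harm u O) (c : Eu n) (i : Fin n) :
    Harm (fun y => u (hflip c i y)) {y | hflip c i y ∈ O} := by
  refine ⟨hu.1.comp (continuous_hflip c i).continuousOn fun y hy => hy, fun z hz => ?_⟩
  refine (hu.2 _ hz).congr fun h => ?_
  congr 1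
  refine Finset.sum_congr rfl fun j _ => ?_
  have h2 : z - h • (eb j : Eu n) = z + (-h) • eb j := by module
  simp only [h2]
  rw [hflip_add_self, hflip_add_self]
  split_ifs
  · simp [sub_eq_add_neg]; ring
  · simp [sub_eq_add_neg]

theorem Harm.sub_le_mul [NeZero n] {u : Eu n → ℝ} {c : Eu n} {r M : ℝ} (hr : 0 < r)
    (hu : Harm u (ball c r)) (hc : ContinuousOn u (closedBall c r))
    (hM : ∀ y ∈ closedBall c r, |u y| ≤ M) (i : Fin n) {t : ℝ} (ht : 0 ≤ t) (htr : t ≤ r) :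
    u (c + t • eb i) - u (c - t • eb i) ≤ 2 * (n + 1) * M * t / r := by
  set O : Set (Eu n) := ball c r ∩ {y | 0 < y i - c i} with hOdef
  have hO : IsOpen O := isOpen_ball.inter (isOpen_lt continuous_const (by fun_prop))
  have hcl : closure O ⊆ closedBall c r ∩ {y | 0 ≤ y i - c i} := by
    refine closure_minimal ?_ (isClosed_closedBall.inter (isClosed_le continuous_const (by fun_prop)))
    exact inter_subset_inter ball_subset_closedBall fun y hy => le_of_lt (show 0 < y i - c i from hy)
  have hM0 : 0 ≤ M := (abs_nonneg _).trans (hM c (mem_closedBall_self hr.le))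
  have hrefl : ∀ y, hflip c i y ∈ ball c r ↔ y ∈ ball c r := fun y => by
    rw [mem_ball, mem_ball, dist_eq_norm, dist_eq_norm, norm_hflip_sub]
  have hrefl' : ∀ y, hflip c i y ∈ closedBall c r ↔ y ∈ closedBall c r := fun y => by
    rw [mem_closedBall, mem_closedBall, dist_eq_norm, dist_eq_norm, norm_hflip_sub]
  have hw : Harm (fun y => u y - u (hflip c i y)) O :=
    (hu.mono inter_subset_left).sub ((hu.comp_hflip c i).mono fun y hy => (hrefl y).2 hy.1)
  have hwc : ContinuousOn (fun y => u y - u (hflip c i y)) (closure O) :=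
    (hc.mono fun y hy => (hcl hy).1).sub
      (hc.comp (continuous_hflip c i).continuousOn fun y hy => (hrefl' y).2 (hcl hy).1)
  have hbc : Continuous fun y => 2 * M * barrier c i r y := by unfold barrier; fun_prop
  have key := Harm.le_of_frontier_le hO (isBounded_ball.subset inter_subset_left) hw hwc
    ((harm_barrier c i r O).const_mul (2 * M)) hbc.continuousOn ?_
  · have hmem : c + t • eb i ∈ closure O := by
      rcases ht.eq_or_lt with rfl | ht0
      · have h1 : Tendsto (fun s : ℝ => c + s • eb i) (𝓝[>] 0) (𝓝 (c + (0:ℝ) • eb i)) := by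
          have : Continuous (fun t : ℝ => c + t • eb i) := by fun_prop
          exact (this.tendsto 0).mono_left nhdsWithin_le_nhds
        refine mem_closure_of_tendsto h1 ?_
        filter_upwards [Ioo_mem_nhdsGT hr] with s hs
        refine ⟨?_, ?_⟩
        · simp [norm_smul, abs_of_pos hs.1, hs.2]
        · simpa using hs.1
      · have h1 : Tendsto (fun s : ℝ => c + (s * t) • eb i) (𝓝[<] 1) (𝓝 (c + ((1:ℝ) * t) • eb i)) := by
          have : Continuous (fun s : ℝ => c + (s * t) • eb i) := by fun_prop
          exact (this.tendsto 1).mono_left nhdsWithin_le_nhds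
        rw [one_mul] at h1
        refine mem_closure_of_tendsto h1 ?_
        filter_upwards [Ioo_mem_nhdsLT (zero_lt_one' ℝ)] with s hs
        have h3 : s * t < r := by nlinarith [hs.1, hs.2]
        have h4 : 0 < s * t := mul_pos hs.1 ht0
        refine ⟨?_, ?_⟩
        · simp only [mem_ball, dist_self_add_left, norm_smul, PiLp.norm_single, norm_eq_abs, abs_one, mul_one, abs_of_pos h4, h3]
        · simpa using h4
    have h1 := key _ hmem
    have h2 := barrier_add_smul_le c i hr ht htr
    have h3 : hflip c i (c + t • eb i) = c - t • eb i := by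
      simp [hflip]; module
    simp only [h3] at h1
    calc _ ≤ _ := h1
      _ ≤ 2 * M * ((n + 1) * t / r) := by gcongr
      _ = _ := by ring
  · intro y hy
    have hy1 := hcl hy.1
    have hs : y i - c i ≤ r := (le_abs_self _).trans ((abs_coord_le y c i).trans (by
      simpa [dist_eq_norm] using hy1.1))
    have hb0 := barrier_nonneg c i y hy1.2 hs
    by_cases h0 : y i - c i = 0
    · have : hflip c i y = y := by simp [hflip, h0]
      simp only [this, sub_self]; positivity
    · have hyr : ‖y - c‖ = r := by
        by_contra hne
        have h5 : ‖y - c‖ ≤ r := by simpa [dist_eq_norm] using hy1.1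
        refine hy.2 ?_
        rw [hO.interior_eq]
        exact ⟨by simpa [dist_eq_norm] using lt_of_le_of_ne h5 hne, lt_of_le_of_ne hy1.2 (Ne.symm h0)⟩
      have hb1 := one_le_barrier c i hr y hy1.2 hs hyr
      have a1 := abs_le.1 (hM y hy1.1)
      have a2 := abs_le.1 (hM _ ((hrefl' y).2 hy1.1))
      nlinarith

theorem Harm.abs_sub_le_mul [NeZero n] {u : Eu n → ℝ} {c : Eu n} {r M : ℝ} (hr : 0 < r)
    (hu : Harm u (ball c r)) (hc : ContinuousOn u (closedBall c r))
    (hM : ∀ y ∈ closedBall c r, |u y| ≤ M) (i : Fin n) {t : ℝ} (ht : 0 ≤ t) (htr : t ≤ r) :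
    |u (c + t • eb i) - u (c - t • eb i)| ≤ 2 * (n + 1) * M * t / r := by
  refine abs_le.2 ⟨?_, hu.sub_le_mul hr hc hM i ht htr⟩
  have := hu.neg.sub_le_mul hr hc.neg (M := M) (by simpa using hM) i ht htr
  linarith

theorem Harm.abs_pd_le [NeZero n] {u : Eu n → ℝ} {c : Eu n} {r M : ℝ} (hr : 0 < r)
    (hu : Harm u (ball c r)) (hc : ContinuousOn u (closedBall c r))
    (hM : ∀ y ∈ closedBall c r, |u y| ≤ M) (hd : DifferentiableAt ℝ u c) (i : Fin n) :
    |pd i u c| ≤ (n + 1) * M / r := by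
  have hline : HasDerivAt (fun t : ℝ => c + t • eb i) (eb i : Eu n) 0 := by
    simpa using ((hasDerivAt_id (0:ℝ)).smul_const (eb i : Eu n)).const_add c
  have hline' : HasDerivAt (fun t : ℝ => c - t • eb i) (-(eb i) : Eu n) 0 := by
    simpa using ((hasDerivAt_id (0:ℝ)).smul_const (eb i : Eu n)).const_sub c
  have hG : HasDerivAt (fun t : ℝ => u (c + t • eb i) - u (c - t • eb i)) (2 * pd i u c) 0 := by
    have h0 : HasFDerivAt u (fderiv ℝ u c) (c + (0:ℝ) • eb i) := by simpa using hd.hasFDerivAt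
    have h0' : HasFDerivAt u (fderiv ℝ u c) (c - (0:ℝ) • eb i) := by simpa using hd.hasFDerivAt
    have := (h0.comp_hasDerivAt (0:ℝ) hline).sub (h0'.comp_hasDerivAt (0:ℝ) hline')
    refine this.congr_deriv ?_
    rw [map_neg]; simp only [pd]; ring
  have h1 := hG.tendsto_slope_zero_right.abs
  simp only [zero_add, zero_smul, add_zero, sub_zero, sub_self, smul_eq_mul] at h1
  have h2 : |2 * pd i u c| ≤ 2 * (n + 1) * M / r := by
    refine le_of_tendsto h1 ?_
    filter_upwards [Ioo_mem_nhdsGT hr] with t ht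
    rw [abs_mul, abs_inv, abs_of_pos ht.1, inv_mul_le_iff₀ ht.1]
    calc _ ≤ _ := hu.abs_sub_le_mul hr hc hM i ht.1.le ht.2.le
      _ = _ := by ring
  rw [abs_mul, abs_two] at h2
  calc |pd i u c| ≤ (2 * (n + 1) * M / r) / 2 := by linarith
    _ = _ := by ring

/-- A polynomial as a function on Euclidean space. -/
def evp (p : MvPolynomial (Fin n) ℝ) (y : Eu n) : ℝ := MvPolynomial.eval (fun i => y i) p

@[simp] theorem evp_C (a : ℝ) (y : Eu n) : evp (MvPolynomial.C a) y = a := by simp [evp]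

@[simp] theorem evp_X (i : Fin n) (y : Eu n) : evp (MvPolynomial.X i) y = y i := by simp [evp]
@[simp] theorem evp_zero (y : Eu n) : evp 0 y = 0 := by simp [evp]
@[simp] theorem evp_one (y : Eu n) : evp 1 y = 1 := by simp [evp]
@[simp] theorem evp_add (p q : MvPolynomial (Fin n) ℝ) (y : Eu n) : evp (p + q) y = evp p y + evp q y := by
  simp [evp]
@[simp] theorem evp_sub (p q : MvPolynomial (Fin n) ℝ) (y : Eu n) : evp (p - q) y = evp p y - evp q y := by
  simp [evp]
@[simp] theorem evp_mul (p q : MvPolynomial (Fin n) ℝ) (y : Eu n) : evp (p * q) y = evp p y * evp q y := by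
  simp [evp]
@[simp] theorem evp_smul (a : ℝ) (q : MvPolynomial (Fin n) ℝ) (y : Eu n) : evp (a • q) y = a * evp q y := by
  simp [evp]
@[simp] theorem evp_neg (q : MvPolynomial (Fin n) ℝ) (y : Eu n) : evp (-q) y = - evp q y := by
  simp [evp]
@[simp] theorem evp_pow (p : MvPolynomial (Fin n) ℝ) (k : ℕ) (y : Eu n) : evp (p ^ k) y = evp p y ^ k := by
  simp [evp]
theorem evp_sum {ι : Type*} (s : Finset ι) (p : ι → MvPolynomial (Fin n) ℝ) (y : Eu n) :
    evp (∑ i ∈ s, p i) y = ∑ i ∈ s, evp (p i) y := by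
  simp [evp]

theorem contDiff_evp (p : MvPolynomial (Fin n) ℝ) (m : WithTop ℕ∞) : ContDiff ℝ m (evp p) := by
  induction p using MvPolynomial.induction_on with
  | C a => simpa [funext fun y => evp_C a y] using contDiff_const
  | add p q hp hq => exact (funext fun y => evp_add p q y) ▸ hp.add hq
  | mul_X p i hp =>
    have : evp (p * MvPolynomial.X i) = fun y => evp p y * y i := funext fun y => by simp
    rw [this]
    exact hp.mul (EuclideanSpace.proj (𝕜 := ℝ) i).contDiff

theorem continuous_evp (p : MvPolynomial (Fin n) ℝ) : Continuous (evp p) := (contDiff_evp p 0).continuous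

theorem differentiable_evp (p : MvPolynomial (Fin n) ℝ) : Differentiable ℝ (evp p) :=
  (contDiff_evp p 1).differentiable (by simp)

theorem pd_coord (i j : Fin n) (y : Eu n) : pd i (fun y : Eu n => y j) y = if j = i then 1 else 0 := by
  unfold pd
  have : fderiv ℝ (fun y : Eu n => y j) y = EuclideanSpace.proj (𝕜 := ℝ) j :=
    (EuclideanSpace.proj (𝕜 := ℝ) j).hasFDerivAt.fderiv
  rw [this]; simp

theorem pd_evp (i : Fin n) (p : MvPolynomial (Fin n) ℝ) (y : Eu n) :
    pd i (evp p) y = evp (MvPolynomial.pderiv i p) y := by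
  induction p using MvPolynomial.induction_on with
  | C a =>
    have : evp (MvPolynomial.C a) = fun _ : Eu n => a := funext fun y => evp_C a y
    simp [pd, this]
  | add p q hp hq =>
    have : evp (p + q) = fun y => evp p y + evp q y := funext fun y => evp_add p q y
    rw [map_add, evp_add, ← hp, ← hq, this]
    unfold pd
    rw [fderiv_fun_add (differentiable_evp p y) (differentiable_evp q y)]; rfl
  | mul_X p j hp =>
    have : evp (p * MvPolynomial.X j) = fun y => evp p y * y j := funext fun y => by simp
    have hj : DifferentiableAt ℝ (fun y : Eu n => y j) y :=
      (EuclideanSpace.proj (𝕜 := ℝ) j).differentiableAt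
    have h3 := pd_coord i j y
    rw [this]
    unfold pd at *
    rw [fderiv_fun_mul (differentiable_evp p y) hj]
    simp only [add_apply, smul_apply, smul_eq_mul, h3, hp,
      MvPolynomial.pderiv_mul, MvPolynomial.pderiv_X, evp_add, evp_mul, evp_X, Pi.single_apply]
    by_cases h : j = i
    · simp [h]; ring
    · simp [h]; ring

theorem pd_evp_eq (i : Fin n) (p : MvPolynomial (Fin n) ℝ) :
    pd i (evp p) = evp (MvPolynomial.pderiv i p) := funext fun y => pd_evp i p y

/-- The Laplacian on polynomials. -/
def lapP : MvPolynomial (Fin n) ℝ →ₗ[ℝ] MvPolynomial (Fin n) ℝ :=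
  ∑ i, (MvPolynomial.pderiv i).toLinearMap ∘ₗ (MvPolynomial.pderiv i).toLinearMap

theorem lapP_apply (p : MvPolynomial (Fin n) ℝ) :
    lapP p = ∑ i, MvPolynomial.pderiv i (MvPolynomial.pderiv i p) := by
  simp [lapP]

theorem lapl_evp (p : MvPolynomial (Fin n) ℝ) (y : Eu n) : lapl (evp p) y = evp (lapP p) y := by
  simp only [lapl, pd2, lapP_apply, evp_sum]
  refine Finset.sum_congr rfl fun i _ => ?_
  rw [← pd_evp, ← pd_evp_eq]

theorem harm_evp {p : MvPolynomial (Fin n) ℝ} (hp : lapP p = 0) (O : Set (Eu n)) : Harm (evp p) O := by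
  refine ⟨(continuous_evp p).continuousOn, fun z _ => ?_⟩
  have := tendsto_discLap (contDiff_evp p 2).contDiffAt (z := z)
  rwa [lapl_evp, hp, evp_zero] at this

theorem eq_zero_of_evp_eq_zero {p : MvPolynomial (Fin n) ℝ} {O : Set (Eu n)} (hO : IsOpen O)
    (hne : O.Nonempty) (h : ∀ y ∈ O, evp p y = 0) : p = 0 := by
  obtain ⟨c, hc⟩ := hne
  have hcont : Continuous (fun v : Fin n → ℝ => (WithLp.toLp 2 v : Eu n)) :=
    PiLp.continuous_toLp 2 _
  have h1 : (fun v : Fin n → ℝ => (WithLp.toLp 2 v : Eu n)) ⁻¹' O ∈ 𝓝 (fun i => c i) :=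
    (hO.preimage hcont).mem_nhds (by simpa using hc)
  obtain ⟨r, hr, hb⟩ := Metric.mem_nhds_iff.1 h1
  refine MvPolynomial.funext_set (fun i => ball (c i) r) (fun i => ?_) fun x hx => ?_
  · rw [Real.ball_eq_Ioo]; exact Ioo_infinite (by linarith)
  · have := h (WithLp.toLp 2 x) (hb (by rw [ball_pi _ hr]; exact hx))
    simpa [evp] using this

theorem lapP_eq_zero_of_harm {p : MvPolynomial (Fin n) ℝ} {O : Set (Eu n)} (hO : IsOpen O)
    (hne : O.Nonempty) (h : Harm (evp p) O) : lapP p = 0 :=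
  eq_zero_of_evp_eq_zero hO hne fun y hy => by
    rw [← lapl_evp]
    exact tendsto_nhds_unique (tendsto_discLap (contDiff_evp p 2).contDiffAt) (h.2 y hy)

theorem pderiv_comm (i j : Fin n) (p : MvPolynomial (Fin n) ℝ) :
    MvPolynomial.pderiv i (MvPolynomial.pderiv j p) = MvPolynomial.pderiv j (MvPolynomial.pderiv i p) := by
  ext d
  simp only [MvPolynomial.coeff_pderiv]
  by_cases h : i = j
  · subst h; rfl
  · rw [add_right_comm d]
    simp [h, Ne.symm h]; ring

theorem lapP_pderiv {p : MvPolynomial (Fin n) ℝ} (hp : lapP p = 0) (i : Fin n) :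
    lapP (MvPolynomial.pderiv i p) = 0 := by
  have : lapP (MvPolynomial.pderiv i p) = MvPolynomial.pderiv i (lapP p) := by
    simp only [lapP_apply, map_sum]
    exact Finset.sum_congr rfl fun j _ => by rw [pderiv_comm j i, pderiv_comm j i]
  rw [this, hp, map_zero]

theorem mem_restrictTotalDegree_iff {p : MvPolynomial (Fin n) ℝ} {m : ℕ} :
    p ∈ MvPolynomial.restrictTotalDegree (Fin n) ℝ m ↔ ∀ d : Fin n →₀ ℕ, m < d.degree → p.coeff d = 0 := by
  rw [MvPolynomial.mem_restrictTotalDegree, MvPolynomial.totalDegree, Finset.sup_le_iff]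
  constructor
  · intro h d hd
    by_contra hne
    exact absurd (h d (MvPolynomial.mem_support_iff.2 hne)) (not_le.2 hd)
  · intro h d hd
    by_contra! hlt
    exact MvPolynomial.mem_support_iff.1 hd (h d hlt)

theorem pderiv_mem {p : MvPolynomial (Fin n) ℝ} {m : ℕ} (i : Fin n)
    (hp : p ∈ MvPolynomial.restrictTotalDegree (Fin n) ℝ (m + 1)) :
    MvPolynomial.pderiv i p ∈ MvPolynomial.restrictTotalDegree (Fin n) ℝ m := by
  rw [mem_restrictTotalDegree_iff] at *
  intro d hd
  rw [MvPolynomial.coeff_pderiv, hp, zero_mul]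
  simpa using hd

theorem lapP_mem {p : MvPolynomial (Fin n) ℝ} {m : ℕ}
    (hp : p ∈ MvPolynomial.restrictTotalDegree (Fin n) ℝ (m + 2)) :
    lapP p ∈ MvPolynomial.restrictTotalDegree (Fin n) ℝ m := by
  rw [lapP_apply]
  exact Submodule.sum_mem _ fun i _ => pderiv_mem i (pderiv_mem i hp)

/-- The polynomial `1 - ‖y‖²`. -/
def radP (n : ℕ) : MvPolynomial (Fin n) ℝ := 1 - ∑ i, MvPolynomial.X i ^ 2

theorem evp_radP (y : Eu n) : evp (radP n) y = 1 - ‖y‖ ^ 2 := by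
  simp [radP, evp_sum, EuclideanSpace.norm_sq_eq]

theorem totalDegree_radP_le : (radP n).totalDegree ≤ 2 := by
  refine (MvPolynomial.totalDegree_sub _ _).trans (max_le (by simp) ?_)
  refine (MvPolynomial.totalDegree_finsetSum _ _).trans (Finset.sup_le fun i _ => ?_)
  simp [MvPolynomial.totalDegree_X_pow]

/-- The linear map `g ↦ Δ((1 - ‖y‖²) g)` on polynomials of degree at most `m`. -/
def radLap (n m : ℕ) : MvPolynomial.restrictTotalDegree (Fin n) ℝ m →ₗ[ℝ]
    MvPolynomial.restrictTotalDegree (Fin n) ℝ m :=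
  LinearMap.restrict (lapP ∘ₗ LinearMap.mulLeft ℝ (radP n)) fun g hg => by
    refine lapP_mem ?_
    rw [MvPolynomial.mem_restrictTotalDegree] at *
    refine (MvPolynomial.totalDegree_mul _ _).trans ?_
    have := totalDegree_radP_le (n := n)
    omega

theorem radLap_apply (m : ℕ) (g : MvPolynomial.restrictTotalDegree (Fin n) ℝ m) :
    (radLap n m g : MvPolynomial (Fin n) ℝ) = lapP (radP n * (g : MvPolynomial (Fin n) ℝ)) := rfl

theorem radLap_injective [NeZero n] (m : ℕ) : Function.Injective (radLap n m) := by
  rw [← LinearMap.ker_eq_bot, LinearMap.ker_eq_bot']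
  intro g hg
  have h0 : lapP (radP n * (g : MvPolynomial (Fin n) ℝ)) = 0 := by rw [← radLap_apply, hg]; rfl
  have hs : ∀ x ∈ frontier (ball (0 : Eu n) 1), |evp (radP n * (g : MvPolynomial (Fin n) ℝ)) x| ≤ 0 := by
    intro x hx
    have : ‖x‖ = 1 := by simpa using frontier_ball_subset_sphere hx
    rw [evp_mul, evp_radP, this]; simp
  have h1 := Harm.abs_le_of_frontier isOpen_ball isBounded_ball
    (harm_evp h0 _) (continuous_evp _).continuousOn hs
  refine Subtype.ext (eq_zero_of_evp_eq_zero isOpen_ball ⟨0, mem_ball_self one_pos⟩ fun y hy => ?_)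
  have h2 := h1 y (subset_closure hy)
  rw [abs_nonpos_iff, evp_mul, evp_radP, mul_eq_zero] at h2
  refine h2.resolve_left (ne_of_gt ?_)
  have : ‖y‖ < 1 := by simpa using hy
  nlinarith [norm_nonneg y]

theorem exists_harmonic_poly_eq_on_sphere [NeZero n] (f : MvPolynomial (Fin n) ℝ) :
    ∃ p : MvPolynomial (Fin n) ℝ, lapP p = 0 ∧ ∀ y : Eu n, ‖y‖ = 1 → evp p y = evp f y := by
  have hf : lapP f ∈ MvPolynomial.restrictTotalDegree (Fin n) ℝ f.totalDegree :=
    lapP_mem ((MvPolynomial.mem_restrictTotalDegree _ _ _).2 (by omega))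
  obtain ⟨g, hg⟩ := (LinearMap.injective_iff_surjective.1 (radLap_injective f.totalDegree)) ⟨_, hf⟩
  have hg' : lapP (radP n * (g : MvPolynomial (Fin n) ℝ)) = lapP f := by rw [← radLap_apply, hg]
  refine ⟨f - radP n * (g : MvPolynomial (Fin n) ℝ), by rw [map_sub, hg', sub_self], fun y hy => ?_⟩
  simp [evp_radP, hy]

theorem exists_poly_near {K : Set (Eu n)} (hK : IsCompact K) {f : Eu n → ℝ} (hf : ContinuousOn f K)
    {ε : ℝ} (hε : 0 < ε) : ∃ p : MvPolynomial (Fin n) ℝ, ∀ y ∈ K, |evp p y - f y| < ε := by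
  have := isCompact_iff_compactSpace.1 hK
  let φ : MvPolynomial (Fin n) ℝ →ₐ[ℝ] C(K, ℝ) :=
    MvPolynomial.aeval fun i => ⟨fun y : K => (y : Eu n) i, by fun_prop⟩
  have hφ : ∀ p (y : K), φ p y = evp p y := by
    intro p y
    induction p using MvPolynomial.induction_on with
    | C a => simp [φ]
    | add p q hp hq => simp [hp, hq]
    | mul_X p i hp => rw [map_mul, ContinuousMap.mul_apply, hp]; simp [φ]
  obtain ⟨⟨g, p, hp⟩, hg⟩ := ContinuousMap.exists_mem_subalgebra_near_continuous_of_separatesPoints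
    φ.range (fun x y hxy => by
      have : ∃ i, (x : Eu n) i ≠ (y : Eu n) i := by
        by_contra! h
        exact hxy (Subtype.ext (PiLp.ext h))
      obtain ⟨i, hi⟩ := this
      exact ⟨φ (MvPolynomial.X i), ⟨_, ⟨MvPolynomial.X i, rfl⟩, rfl⟩, by simpa [hφ] using hi⟩)
    (fun y : K => f y) (continuousOn_iff_continuous_domRestrict.1 hf) ε hε
  refine ⟨p, fun y hy => ?_⟩
  have := hg ⟨y, hy⟩
  have h2 : φ p = g := hp
  simpa [← h2, hφ] using this

theorem exists_harmonic_poly_near_sphere [NeZero n] {f : Eu n → ℝ} (hf : ContinuousOn f (sphere 0 1))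
    {ε : ℝ} (hε : 0 < ε) : ∃ p : MvPolynomial (Fin n) ℝ, lapP p = 0 ∧
      ∀ y : Eu n, ‖y‖ = 1 → |evp p y - f y| < ε := by
  obtain ⟨q, hq⟩ := exists_poly_near (isCompact_sphere _ _) hf hε
  obtain ⟨p, hp, hpq⟩ := exists_harmonic_poly_eq_on_sphere q
  exact ⟨p, hp, fun y hy => by rw [hpq y hy]; exact hq y (by simpa using hy)⟩

theorem Harm.exists_harmonic_poly_near [NeZero n] {u : Eu n → ℝ} (hu : Harm u (ball 0 1))
    (hc : ContinuousOn u (closedBall 0 1)) {ε : ℝ} (hε : 0 < ε) :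
    ∃ p : MvPolynomial (Fin n) ℝ, lapP p = 0 ∧ ∀ y ∈ closedBall (0 : Eu n) 1, |evp p y - u y| ≤ ε := by
  obtain ⟨p, hp, h⟩ := exists_harmonic_poly_near_sphere (hc.mono sphere_subset_closedBall) hε
  refine ⟨p, hp, fun y hy => ?_⟩
  have hcl : closure (ball (0 : Eu n) 1) = closedBall 0 1 := closure_ball _ one_ne_zero
  refine Harm.abs_le_of_frontier isOpen_ball isBounded_ball ((harm_evp hp _).sub hu)
    (hcl ▸ ((continuous_evp p).continuousOn.sub hc)) (fun x hx => (h x ?_).le) y (hcl ▸ hy)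
  simpa using frontier_ball_subset_sphere hx

theorem clm_eq_sum (f : Eu n →L[ℝ] ℝ) :
    f = ∑ i, f (eb i) • (EuclideanSpace.proj i : Eu n →L[ℝ] ℝ) := by
  ext y
  have h : y = ∑ i, y i • (eb i : Eu n) := by
    ext j
    simp [Finset.sum_apply, Pi.single_apply]
  conv_lhs => rw [h]
  simp [mul_comm]

theorem fderiv_eq_sum (u : Eu n → ℝ) (y : Eu n) :
    fderiv ℝ u y = ∑ i, pd i u y • (EuclideanSpace.proj i : Eu n →L[ℝ] ℝ) :=
  clm_eq_sum _

theorem tendstoUniformlyOn_sum {ι α E : Type*} [NormedAddCommGroup E] (s : Finset ι)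
    {F : ι → ℕ → α → E} {f : ι → α → E} {A : Set α}
    (h : ∀ i ∈ s, TendstoUniformlyOn (F i) (f i) atTop A) :
    TendstoUniformlyOn (fun k x => ∑ i ∈ s, F i k x) (fun x => ∑ i ∈ s, f i x) atTop A := by
  classical
  induction s using Finset.induction_on with
  | empty =>
    rw [Metric.tendstoUniformlyOn_iff]
    intro ε hε; simp [hε]
  | insert a s ha ih =>
    simp only [Finset.sum_insert ha]
    exact (h a (Finset.mem_insert_self a s)).add (ih fun i hi => h i (Finset.mem_insert_of_mem hi))

theorem abs_evp_pderiv_le [NeZero n] {p : MvPolynomial (Fin n) ℝ} (hp : lapP p = 0) {c : Eu n} {r M : ℝ}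
    (hr : 0 < r) (hM : ∀ y ∈ closedBall c r, |evp p y| ≤ M) (i : Fin n) :
    |evp (MvPolynomial.pderiv i p) c| ≤ (n + 1) * M / r := by
  rw [← pd_evp]
  exact (harm_evp hp _).abs_pd_le hr (continuous_evp p).continuousOn hM (differentiable_evp p c) i

/-- Uniform limits of harmonic polynomials on a closed ball. -/
def HLim (u : Eu n → ℝ) (s : ℝ) : Prop :=
  ∀ ε > 0, ∃ p : MvPolynomial (Fin n) ℝ, lapP p = 0 ∧ ∀ y ∈ closedBall (0 : Eu n) s, |evp p y - u y| ≤ ε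

theorem closedBall_subset_of_le {y : Eu n} {s s' : ℝ} (hy : y ∈ closedBall (0 : Eu n) s') :
    closedBall y (s - s') ⊆ closedBall 0 s :=
  closedBall_subset_closedBall' (by have := mem_closedBall.1 hy; linarith)

theorem HLim.exists_seq [NeZero n] {u : Eu n → ℝ} {s s' : ℝ} (hu : HLim u s) (hs : s' < s) :
    ∃ p : ℕ → MvPolynomial (Fin n) ℝ, (∀ k, lapP (p k) = 0) ∧
      (∀ k, ∀ y ∈ closedBall (0 : Eu n) s, |evp (p k) y - u y| ≤ 1 / ((k : ℝ) + 1)) ∧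
      ∃ g : Fin n → Eu n → ℝ, ∀ i,
        TendstoUniformlyOn (fun k => evp (MvPolynomial.pderiv i (p k))) (g i) atTop (closedBall 0 s') := by
  choose p hp hpu using fun k : ℕ => hu (1 / ((k : ℝ) + 1)) (by positivity)
  refine ⟨p, hp, hpu, ?_⟩
  have hC : ∀ i, UniformCauchySeqOn (fun k => evp (MvPolynomial.pderiv i (p k))) atTop
      (closedBall (0 : Eu n) s') := by
    intro i
    rw [Metric.uniformCauchySeqOn_iff]
    intro ε hε
    have ht : Tendsto (fun k : ℕ => (n + 1) * (2 * (1 / ((k : ℝ) + 1))) / (s - s')) atTop (𝓝 0) := by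
      have := ((tendsto_one_div_add_atTop_nhds_zero_nat (𝕜 := ℝ)).const_mul (2:ℝ)).const_mul ((n:ℝ) + 1)
      simpa using this.div_const (s - s')
    obtain ⟨N, hN⟩ := (ht.eventually (gt_mem_nhds hε)).exists
    refine ⟨N, fun k hk l hl y hy => ?_⟩
    rw [Real.dist_eq, ← evp_sub, ← map_sub]
    refine (abs_evp_pderiv_le (by rw [map_sub, hp, hp, sub_zero]) (sub_pos.2 hs) ?_ i).trans_lt hN
    intro z hz
    have hz' := closedBall_subset_of_le hy hz
    have hmono : ∀ k ≥ N, 1 / ((k:ℝ) + 1) ≤ 1 / ((N:ℝ) + 1) := fun k hk => by gcongr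
    have h1 := (hpu k z hz').trans (hmono k hk)
    have h2 := (hpu l z hz').trans (hmono l hl)
    rw [evp_sub]
    rw [abs_le] at *
    constructor <;> linarith [h1.1, h1.2, h2.1, h2.2]
  have hlim : ∀ i, ∃ g : Eu n → ℝ, ∀ y ∈ closedBall (0 : Eu n) s',
      Tendsto (fun k => evp (MvPolynomial.pderiv i (p k)) y) atTop (𝓝 (g y)) := by
    intro i
    refine ⟨fun y => limUnder atTop fun k => evp (MvPolynomial.pderiv i (p k)) y, fun y hy => ?_⟩
    exact CauchySeq.tendsto_limUnder ((hC i).cauchySeq hy)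
  choose g hg using hlim
  exact ⟨g, fun i => (hC i).tendstoUniformlyOn_of_tendsto (hg i)⟩

theorem HLim.differentiableAt [NeZero n] {u : Eu n → ℝ} {s : ℝ} (hu : HLim u s) {y : Eu n}
    (hy : y ∈ ball 0 s) : DifferentiableAt ℝ u y ∧ ∀ i, ∀ p : MvPolynomial (Fin n) ℝ, lapP p = 0 →
      ∀ ε, (∀ z ∈ closedBall (0 : Eu n) s, |evp p z - u z| ≤ ε) →
        |evp (MvPolynomial.pderiv i p) y - pd i u y| ≤ (n + 1) * ε / (s - ‖y‖) := by
  have hy' : ‖y‖ < s := by simpa using hy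
  obtain ⟨s', hys, hss⟩ := exists_between hy'
  obtain ⟨p, hp, hpu, g, hg⟩ := hu.exists_seq hss
  have hd : HasFDerivAt u (∑ i, g i y • (EuclideanSpace.proj i : Eu n →L[ℝ] ℝ)) y := by
    refine hasFDerivAt_of_tendstoUniformlyOn (l := atTop) (f := fun k => evp (p k))
      (f' := fun k z => ∑ i, evp (MvPolynomial.pderiv i (p k)) z • (EuclideanSpace.proj i : Eu n →L[ℝ] ℝ))
      (g' := fun z => ∑ i, g i z • (EuclideanSpace.proj i : Eu n →L[ℝ] ℝ))
      (isOpen_ball (x := (0 : Eu n)) (ε := s')) ?_ ?_ ?_ (by simpa using hys)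
    · refine tendstoUniformlyOn_sum _ fun i _ => ?_
      have : UniformContinuous fun a : ℝ => a • (EuclideanSpace.proj i : Eu n →L[ℝ] ℝ) :=
        ((ContinuousLinearMap.id ℝ ℝ).smulRight (EuclideanSpace.proj i : Eu n →L[ℝ] ℝ)).uniformContinuous
      exact (this.comp_tendstoUniformlyOn (hg i)).mono ball_subset_closedBall
    · intro k z _
      have := (differentiable_evp (p k) z).hasFDerivAt
      rw [fderiv_eq_sum] at this
      simpa only [pd_evp] using this
    · intro z hz
      have hz' : z ∈ closedBall (0 : Eu n) s := closedBall_subset_closedBall hss.le (ball_subset_closedBall hz)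
      rw [tendsto_iff_dist_tendsto_zero]
      exact squeeze_zero (fun _ => dist_nonneg) (fun k => hpu k z hz')
        tendsto_one_div_add_atTop_nhds_zero_nat
  refine ⟨hd.differentiableAt, fun i q hq ε hε => ?_⟩
  have hpd : pd i u y = g i y := by
    unfold pd
    rw [hd.fderiv]
    simp
  have ht : Tendsto (fun k => |evp (MvPolynomial.pderiv i q) y - evp (MvPolynomial.pderiv i (p k)) y|) atTop
      (𝓝 |evp (MvPolynomial.pderiv i q) y - pd i u y|) := by
    rw [hpd]
    exact (((hg i).tendsto_at (by simpa using hys.le)).const_sub _).abs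
  have ht2 : Tendsto (fun k : ℕ => (n + 1) * (ε + 1 / ((k : ℝ) + 1)) / (s - ‖y‖)) atTop
      (𝓝 ((n + 1) * (ε + 0) / (s - ‖y‖))) :=
    ((tendsto_one_div_add_atTop_nhds_zero_nat.const_add ε).const_mul _).div_const _
  rw [add_zero] at ht2
  refine le_of_tendsto_of_tendsto' ht ht2 fun k => ?_
  rw [← evp_sub, ← map_sub]
  refine abs_evp_pderiv_le (by rw [map_sub, hq, hp, sub_zero]) (sub_pos.2 hy') (fun z hz => ?_) i
  have hz' := closedBall_subset_of_le (s := s) (s' := ‖y‖) (by simp) hz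
  have h1 := hε z hz'
  have h2 := hpu k z hz'
  rw [evp_sub]
  rw [abs_le] at *
  constructor <;> linarith [h1.1, h1.2, h2.1, h2.2]

theorem HLim.pd [NeZero n] {u : Eu n → ℝ} {s s' : ℝ} (hu : HLim u s) (hs : s' < s) (i : Fin n) :
    HLim (pd i u) s' := by
  intro ε hε
  have hn : (0:ℝ) < n + 1 := by positivity
  obtain ⟨p, hp, h⟩ := hu (ε * (s - s') / (n + 1)) (by have := sub_pos.2 hs; positivity)
  refine ⟨MvPolynomial.pderiv i p, lapP_pderiv hp i, fun y hy => ?_⟩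
  have hy' : ‖y‖ ≤ s' := by simpa using hy
  refine ((hu.differentiableAt (by simpa using hy'.trans_lt hs)).2 i p hp _ h).trans ?_
  have : 0 < s - ‖y‖ := by linarith
  rw [div_le_iff₀ this]
  calc _ = ε * (s - s') := by field_simp
    _ ≤ _ := by gcongr

theorem HLim.contDiffOn [NeZero n] (m : ℕ) : ∀ {u : Eu n → ℝ} {s : ℝ}, HLim u s →
    ContDiffOn ℝ m u (ball 0 s) := by
  induction m with
  | zero =>
    intro u s hu
    simp only [Nat.cast_zero, contDiffOn_zero]
    exact fun y hy => (hu.differentiableAt hy).1.continuousAt.continuousWithinAt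
  | succ m ih =>
    intro u s hu
    push_cast
    rw [contDiffOn_succ_iff_fderiv_of_isOpen isOpen_ball]
    refine ⟨fun y hy => (hu.differentiableAt hy).1.differentiableWithinAt, by simp, ?_⟩
    have : fderiv ℝ u = fun y => ∑ i, _root_.pd i u y • (EuclideanSpace.proj i : Eu n →L[ℝ] ℝ) :=
      funext fun y => fderiv_eq_sum u y
    rw [this]
    refine ContDiffOn.sum fun i _ => ?_
    suffices h : ContDiffOn ℝ m (_root_.pd i u) (ball 0 s) from h.smul contDiffOn_const
    intro y hy
    have hy' : ‖y‖ < s := by simpa using hy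
    obtain ⟨s', hys, hss⟩ := exists_between hy'
    exact ((ih (hu.pd hss i)).contDiffAt (isOpen_ball.mem_nhds (by simpa using hys))).contDiffWithinAt

theorem HLim.isHarmonicOn [NeZero n] {u : Eu n → ℝ} {s : ℝ} (hu : HLim u s) :
    IsHarmonicOn u (ball 0 s) := by
  refine ⟨hu.contDiffOn 2, fun y hy => ?_⟩
  have hy' : ‖y‖ < s := by simpa using hy
  obtain ⟨s', hys, hss⟩ := exists_between hy'
  have hn : (0:ℝ) < n + 1 := by positivity
  have h0 : ∀ ε > 0, |lapl u y| ≤ ∑ _i : Fin n, (n + 1) * ((n + 1) * ε / (s - s')) / (s' - ‖y‖) := by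
    intro ε hε
    obtain ⟨p, hp, h⟩ := hu ε hε
    have h1 : ∀ i, ∀ z ∈ closedBall (0 : Eu n) s',
        |evp (MvPolynomial.pderiv i p) z - _root_.pd i u z| ≤ (n + 1) * ε / (s - s') := by
      intro i z hz
      have hz' : ‖z‖ ≤ s' := by simpa using hz
      refine ((hu.differentiableAt (by simpa using hz'.trans_lt hss)).2 i p hp _ h).trans ?_
      have : 0 < s - s' := by linarith
      gcongr
    have h2 : lapl u y = ∑ i, (pd2 i i u y - evp (MvPolynomial.pderiv i (MvPolynomial.pderiv i p)) y) := by
      rw [Finset.sum_sub_distrib, ← evp_sum, ← lapP_apply, hp, evp_zero, sub_zero]; rfl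
    rw [h2]
    refine (Finset.abs_sum_le_sum_abs _ _).trans (Finset.sum_le_sum fun i _ => ?_)
    rw [abs_sub_comm]
    exact ((hu.pd hss i).differentiableAt (by simpa using hys)).2 i _ (lapP_pderiv hp i) _ (h1 i)
  have ht : Tendsto (fun ε : ℝ => ∑ _i : Fin n, (n + 1) * ((n + 1) * ε / (s - s')) / (s' - ‖y‖))
      (𝓝[>] 0) (𝓝 0) := by
    have : Continuous (fun ε : ℝ => ∑ _i : Fin n, ((n:ℝ) + 1) * ((n + 1) * ε / (s - s')) / (s' - ‖y‖)) := by
      fun_prop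
    simpa using (this.tendsto 0).mono_left nhdsWithin_le_nhds
  rw [← abs_nonpos_iff]
  exact ge_of_tendsto ht (by filter_upwards [self_mem_nhdsWithin] with ε hε using h0 ε hε)

theorem pd_comp_affine (u : Eu n → ℝ) (c : Eu n) (r : ℝ) (i : Fin n) (y : Eu n) :
    pd i (fun y => u (c + r • y)) y = r * pd i u (c + r • y) := by
  unfold pd
  have h := fderiv_comp_smul (𝕜 := ℝ) (f := fun w => u (c + w)) r (x := y)
  have h2 := fderiv_comp_add_left (𝕜 := ℝ) (f := u) c (x := r • y)
  rw [h2] at h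
  rw [h]; simp

theorem harm_of_forall {u : Eu n → ℝ} {O : Set (Eu n)}
    (h : ∀ z ∈ O, ∃ V, IsOpen V ∧ z ∈ V ∧ Harm u V) : Harm u O := by
  refine ⟨fun z hz => ?_, fun z hz => ?_⟩
  · obtain ⟨V, hV, hzV, hu⟩ := h z hz
    exact (hu.1.continuousAt (hV.mem_nhds hzV)).continuousWithinAt
  · obtain ⟨V, hV, hzV, hu⟩ := h z hz
    exact hu.2 z hzV

theorem affine_inv (c y : Eu n) {r : ℝ} (hr : 0 < r) : c + r • (r⁻¹ • (y - c)) = y := by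
  rw [smul_inv_smul₀ hr.ne']; abel

theorem affine_mem_closedBall {c y : Eu n} {r : ℝ} (hr : 0 < r) :
    c + r • y ∈ closedBall c r ↔ y ∈ closedBall (0 : Eu n) 1 := by
  simp [norm_smul, abs_of_pos hr, hr]

theorem affine_mem_ball {c y : Eu n} {r s : ℝ} (hr : 0 < r) :
    c + r • y ∈ ball c (r * s) ↔ y ∈ ball (0 : Eu n) s := by
  simp [norm_smul, abs_of_pos hr, hr]

theorem Harm.hLim [NeZero n] {u : Eu n → ℝ} {c : Eu n} {r : ℝ} (hr : 0 < r)
    (hu : Harm u (ball c r)) (hc : ContinuousOn u (closedBall c r)) :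
    HLim (fun y => u (c + r • y)) 1 := by
  intro ε hε
  have h1 : Harm (fun y => u (c + r • y)) (ball 0 1) := by
    refine (hu.comp_affine c hr).mono fun y hy => ?_
    have := (affine_mem_ball (c := c) hr).2 hy
    rwa [mul_one] at this
  have h2 : ContinuousOn (fun y => u (c + r • y)) (closedBall 0 1) := by
    have hcont : Continuous fun y : Eu n => c + r • y := by fun_prop
    exact hc.comp hcont.continuousOn fun y hy => (affine_mem_closedBall hr).2 hy
  exact h1.exists_harmonic_poly_near h2 hε

theorem contDiffOn_of_comp_affine {u : Eu n → ℝ} {c : Eu n} {r : ℝ} (hr : 0 < r) {m : WithTop ℕ∞}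
    (h : ContDiffOn ℝ m (fun y => u (c + r • y)) (ball 0 1)) : ContDiffOn ℝ m u (ball c r) := by
  have h2 : ContDiff ℝ m (fun y : Eu n => r⁻¹ • (y - c)) := by fun_prop
  have := h.comp (s := ball c r) h2.contDiffOn fun y hy => by
    have : ‖y - c‖ < r := by simpa [dist_eq_norm] using hy
    simp only [mem_ball_zero_iff, norm_smul, norm_inv, norm_eq_abs, abs_of_pos hr]
    rwa [inv_mul_lt_iff₀ hr, mul_one]
  refine this.congr fun y hy => ?_
  simp only [Function.comp_apply, affine_inv c y hr]

theorem harm_of_comp_affine {u : Eu n → ℝ} {c : Eu n} {r s : ℝ} (hr : 0 < r)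
    (h : Harm (fun y => u (c + r • y)) (ball 0 s)) : Harm u (ball c (r * s)) := by
  have h1 := h.comp_affine (-(r⁻¹ • c)) (inv_pos.2 hr)
  have h2 : ∀ y : Eu n, c + r • (-(r⁻¹ • c) + r⁻¹ • y) = y := fun y => by
    rw [← smul_neg, ← smul_add, smul_inv_smul₀ hr.ne']; abel
  simp only [h2] at h1
  refine h1.mono fun y hy => ?_
  rw [mem_ofPred_eq, ← affine_mem_ball (c := c) hr, h2]
  exact hy

theorem Harm.exists_closedBall {u : Eu n → ℝ} {O : Set (Eu n)} (hO : IsOpen O) (hu : Harm u O) {z : Eu n}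
    (hz : z ∈ O) : ∃ r > 0, closedBall z r ⊆ O ∧ Harm u (ball z r) ∧ ContinuousOn u (closedBall z r) := by
  obtain ⟨r, hr, h⟩ := Metric.nhds_basis_closedBall.mem_iff.1 (hO.mem_nhds hz)
  exact ⟨r, hr, h, hu.mono (ball_subset_closedBall.trans h), hu.1.mono h⟩

theorem Harm.contDiffOn [NeZero n] {u : Eu n → ℝ} {O : Set (Eu n)} (hO : IsOpen O) (hu : Harm u O)
    (m : ℕ) : ContDiffOn ℝ m u O := by
  intro z hz
  obtain ⟨r, hr, h, h1, h2⟩ := hu.exists_closedBall hO hz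
  exact ((contDiffOn_of_comp_affine hr ((h1.hLim hr h2).contDiffOn m)).contDiffAt
    (isOpen_ball.mem_nhds (mem_ball_self hr))).contDiffWithinAt

theorem Harm.differentiableAt [NeZero n] {u : Eu n → ℝ} {O : Set (Eu n)} (hO : IsOpen O) (hu : Harm u O)
    {z : Eu n} (hz : z ∈ O) : DifferentiableAt ℝ u z :=
  ((hu.contDiffOn hO 1).contDiffAt (hO.mem_nhds hz)).differentiableAt (by simp)

theorem Harm.isHarmonicOn [NeZero n] {u : Eu n → ℝ} {O : Set (Eu n)} (hO : IsOpen O) (hu : Harm u O) :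
    IsHarmonicOn u O :=
  ⟨hu.contDiffOn hO 2, fun z hz => tendsto_nhds_unique
    (tendsto_discLap ((hu.contDiffOn hO 2).contDiffAt (hO.mem_nhds hz))) (hu.2 z hz)⟩

theorem Harm.pd [NeZero n] {u : Eu n → ℝ} {O : Set (Eu n)} (hO : IsOpen O) (hu : Harm u O) (i : Fin n) :
    Harm (pd i u) O := by
  refine harm_of_forall fun z hz => ?_
  obtain ⟨r, hr, h, h1, h2⟩ := hu.exists_closedBall hO hz
  have h3 := ((h1.hLim hr h2).pd (s' := 1 / 2) (by norm_num) i).isHarmonicOn.harm isOpen_ball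
  rw [show _root_.pd i (fun y => u (z + r • y)) = fun y => r * _root_.pd i u (z + r • y) from
    funext fun y => pd_comp_affine u z r i y] at h3
  have h4 := h3.const_mul r⁻¹
  simp only [inv_mul_cancel_left₀ hr.ne'] at h4
  exact ⟨_, isOpen_ball, mem_ball_self (by positivity), harm_of_comp_affine hr h4⟩

theorem Harm.pdMulti [NeZero n] {u : Eu n → ℝ} {O : Set (Eu n)} (hO : IsOpen O) (hu : Harm u O)
    (L : List (Fin n)) : Harm (pdMulti L u) O := by
  induction L with
  | nil => exact hu
  | cons i L ih => exact ih.pd hO i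

theorem harm_of_approx [NeZero n] {u : Eu n → ℝ} {O : Set (Eu n)} (hO : IsOpen O)
    (h : ∀ ε > 0, ∃ v, Harm v O ∧ ∀ y ∈ O, |v y - u y| ≤ ε) : Harm u O := by
  refine harm_of_forall fun z hz => ?_
  obtain ⟨r, hr, hrO⟩ := Metric.nhds_basis_closedBall.mem_iff.1 (hO.mem_nhds hz)
  refine ⟨ball z r, isOpen_ball, mem_ball_self hr, ?_⟩
  have : HLim (fun y => u (z + r • y)) 1 := by
    intro ε hε
    obtain ⟨v, hv, hvu⟩ := h (ε / 2) (half_pos hε)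
    obtain ⟨p, hp, hpv⟩ := (hv.mono (ball_subset_closedBall.trans hrO)).hLim hr (hv.1.mono hrO)
      (ε / 2) (half_pos hε)
    refine ⟨p, hp, fun y hy => ?_⟩
    have h1 := hpv y hy
    have h2 := hvu _ (hrO ((affine_mem_closedBall hr).2 hy))
    rw [abs_le] at *
    constructor <;> linarith [h1.1, h1.2, h2.1, h2.2]
  have h5 := harm_of_comp_affine hr (this.isHarmonicOn.harm isOpen_ball)
  rwa [mul_one] at h5

theorem Harm.abs_pd_le' [NeZero n] {u : Eu n → ℝ} {c : Eu n} {r M : ℝ} (hr : 0 < r)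
    (hu : Harm u (ball c r)) (hM : ∀ y ∈ ball c r, |u y| ≤ M) (i : Fin n) :
    |_root_.pd i u c| ≤ 2 * (n + 1) * M / r := by
  have hsub : closedBall c (r / 2) ⊆ ball c r := closedBall_subset_ball (by linarith)
  have := (hu.mono (ball_subset_closedBall.trans hsub)).abs_pd_le (half_pos hr) (hu.1.mono hsub)
    (fun y hy => hM y (hsub hy)) (hu.differentiableAt isOpen_ball (mem_ball_self hr)) i
  calc _ ≤ _ := this
    _ = _ := by field_simp

theorem exists_pdMulti_bound [NeZero n] (L : List (Fin n)) : ∃ C : ℝ, 0 ≤ C ∧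
    ∀ (u : Eu n → ℝ) (c : Eu n) (r M : ℝ), 0 < r → Harm u (ball c r) → (∀ y ∈ ball c r, |u y| ≤ M) →
      |pdMulti L u c| ≤ C * M / r ^ L.length := by
  induction L with
  | nil => exact ⟨1, zero_le_one, fun u c r M hr _ hM => by simpa [pdMulti] using hM c (mem_ball_self hr)⟩
  | cons i L ih =>
    obtain ⟨C, hC, h⟩ := ih
    refine ⟨2 * (n + 1) * (C * 2 ^ L.length) * 2, by positivity, fun u c r M hr hu hM => ?_⟩
    have h1 : ∀ y ∈ ball c (r / 2), |pdMulti L u y| ≤ C * M / (r / 2) ^ L.length := by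
      intro y hy
      have hsub : ball y (r / 2) ⊆ ball c r := ball_subset_ball' (by
        have := mem_ball.1 hy; linarith)
      exact h u y (r / 2) M (half_pos hr) (hu.mono hsub) fun z hz => hM z (hsub hz)
    have h2 := ((hu.pdMulti isOpen_ball L).mono (ball_subset_ball (half_le_self hr.le))).abs_pd_le'
      (half_pos hr) h1 i
    refine h2.trans (le_of_eq ?_)
    rw [List.length_cons, pow_succ, div_pow]
    field_simp

/-- The sum of the absolute values of the coefficients. -/
def norm1 (p : MvPolynomial (Fin n) ℝ) : ℝ := ∑ d ∈ p.support, |p.coeff d|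

theorem norm1_eq_sum {p : MvPolynomial (Fin n) ℝ} {s : Finset (Fin n →₀ ℕ)} (h : p.support ⊆ s) :
    norm1 p = ∑ d ∈ s, |p.coeff d| :=
  Finset.sum_subset h fun d _ hd => by rw [MvPolynomial.notMem_support_iff.1 hd, abs_zero]

theorem norm1_nonneg (p : MvPolynomial (Fin n) ℝ) : 0 ≤ norm1 p :=
  Finset.sum_nonneg fun _ _ => abs_nonneg _

theorem abs_coeff_le_norm1 (p : MvPolynomial (Fin n) ℝ) (d : Fin n →₀ ℕ) : |p.coeff d| ≤ norm1 p := by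
  classical
  rw [norm1_eq_sum (Finset.subset_insert d p.support)]
  exact Finset.single_le_sum (f := fun d => |p.coeff d|) (fun _ _ => abs_nonneg _)
    (Finset.mem_insert_self _ _)

theorem norm1_add_le (p q : MvPolynomial (Fin n) ℝ) : norm1 (p + q) ≤ norm1 p + norm1 q := by
  classical
  rw [norm1_eq_sum (MvPolynomial.support_add (p := p) (q := q)),
    norm1_eq_sum (Finset.subset_union_left (s₁ := p.support) (s₂ := q.support)),
    norm1_eq_sum (Finset.subset_union_right (s₁ := p.support) (s₂ := q.support)), ← Finset.sum_add_distrib]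
  exact Finset.sum_le_sum fun d _ => by rw [MvPolynomial.coeff_add]; exact abs_add_le _ _

theorem norm1_smul (a : ℝ) (p : MvPolynomial (Fin n) ℝ) : norm1 (a • p) = |a| * norm1 p := by
  rw [norm1_eq_sum (MvPolynomial.support_smul (a := a) (f := p)), norm1, Finset.mul_sum]
  exact Finset.sum_congr rfl fun d _ => by rw [MvPolynomial.coeff_smul, smul_eq_mul, abs_mul]

@[simp] theorem norm1_zero : norm1 (0 : MvPolynomial (Fin n) ℝ) = 0 := by simp [norm1]

theorem norm1_neg (p : MvPolynomial (Fin n) ℝ) : norm1 (-p) = norm1 p := by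
  simpa using norm1_smul (-1) p

theorem norm1_sub_le (p q : MvPolynomial (Fin n) ℝ) : norm1 (p - q) ≤ norm1 p + norm1 q := by
  rw [sub_eq_add_neg, ← norm1_neg q]; exact norm1_add_le _ _

theorem norm1_sum_le {ι : Type*} (s : Finset ι) (f : ι → MvPolynomial (Fin n) ℝ) :
    norm1 (∑ i ∈ s, f i) ≤ ∑ i ∈ s, norm1 (f i) :=
  Finset.le_sum_of_subadditive norm1 norm1_zero.le norm1_add_le s f

theorem eq_zero_of_norm1 {p : MvPolynomial (Fin n) ℝ} (h : norm1 p ≤ 0) : p = 0 := by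
  ext d
  have := (abs_coeff_le_norm1 p d).trans h
  simpa using this

theorem norm1_monomial_mul (d : Fin n →₀ ℕ) (a : ℝ) (q : MvPolynomial (Fin n) ℝ) :
    norm1 (MvPolynomial.monomial d a * q) = |a| * norm1 q := by
  classical
  have hs : (MvPolynomial.monomial d a * q).support ⊆ q.support.map (addLeftEmbedding d) := by
    intro e he
    rw [MvPolynomial.mem_support_iff, MvPolynomial.coeff_monomial_mul'] at he
    by_cases hde : d ≤ e
    · rw [if_pos hde] at he
      refine Finset.mem_map.2 ⟨e - d, MvPolynomial.mem_support_iff.2 (right_ne_zero_of_mul he), ?_⟩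
      exact add_tsub_cancel_of_le hde
    · simp [hde] at he
  rw [norm1_eq_sum hs, Finset.sum_map, norm1, Finset.mul_sum]
  refine Finset.sum_congr rfl fun e _ => ?_
  rw [addLeftEmbedding_apply, MvPolynomial.coeff_monomial_mul, abs_mul]

theorem norm1_mul_le (p q : MvPolynomial (Fin n) ℝ) : norm1 (p * q) ≤ norm1 p * norm1 q := by
  conv_lhs => rw [p.as_sum, Finset.sum_mul]
  refine (norm1_sum_le _ _).trans ?_
  rw [norm1, Finset.sum_mul]
  exact Finset.sum_le_sum fun d _ => (norm1_monomial_mul _ _ _).le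

theorem norm1_X_mul (i : Fin n) (q : MvPolynomial (Fin n) ℝ) : norm1 (MvPolynomial.X i * q) = norm1 q := by
  rw [MvPolynomial.X, norm1_monomial_mul]; simp

theorem norm1_X (i : Fin n) : norm1 (MvPolynomial.X i : MvPolynomial (Fin n) ℝ) = 1 := by
  rw [← mul_one (MvPolynomial.X i), norm1_X_mul]
  rw [norm1_eq_sum (s := {0})]
  · simp
  · intro d hd
    rw [Finset.mem_singleton]
    rw [MvPolynomial.mem_support_iff, MvPolynomial.coeff_one] at hd
    by_contra h; exact hd (if_neg (Ne.symm h))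

theorem abs_coord_le_norm (y : Eu n) (i : Fin n) : |y i| ≤ ‖y‖ := by
  simpa using PiLp.norm_apply_le y i

theorem abs_evp_le {p : MvPolynomial (Fin n) ℝ} {y : Eu n} {m : ℕ} (hy : ‖y‖ ≤ 1)
    (hp : ∀ d : Fin n →₀ ℕ, d.degree < m → p.coeff d = 0) : |evp p y| ≤ norm1 p * ‖y‖ ^ m := by
  rw [evp, MvPolynomial.eval_eq', norm1, Finset.sum_mul]
  refine (Finset.abs_sum_le_sum_abs _ _).trans (Finset.sum_le_sum fun d hd => ?_)
  rw [abs_mul]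
  refine mul_le_mul_of_nonneg_left ?_ (abs_nonneg _)
  rw [Finset.abs_prod]
  have h1 : ∏ i, |y i ^ d i| ≤ ∏ i, ‖y‖ ^ d i :=
    Finset.prod_le_prod (fun _ _ => abs_nonneg _) fun i _ => by
      rw [abs_pow]; exact pow_le_pow_left₀ (abs_nonneg _) (abs_coord_le_norm y i) _
  refine h1.trans ?_
  rw [Finset.prod_pow_eq_pow_sum]
  refine pow_le_pow_of_le_one (norm_nonneg _) hy ?_
  by_contra! hlt
  refine MvPolynomial.mem_support_iff.1 hd (hp d ?_)
  rwa [Finsupp.degree_eq_sum]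

theorem abs_evp_le_norm1 {p : MvPolynomial (Fin n) ℝ} {y : Eu n} (hy : ‖y‖ ≤ 1) :
    |evp p y| ≤ norm1 p := by
  simpa using abs_evp_le (m := 0) hy (p := p) (by simp)

/-- The part of degree less than `k` of a polynomial. -/
def tr (k : ℕ) : MvPolynomial (Fin n) ℝ →ₗ[ℝ] MvPolynomial (Fin n) ℝ :=
  ∑ j ∈ Finset.range k, MvPolynomial.homogeneousComponent j

theorem coeff_tr (k : ℕ) (p : MvPolynomial (Fin n) ℝ) (d : Fin n →₀ ℕ) :
    (tr k p).coeff d = if d.degree < k then p.coeff d else 0 := by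
  classical
  simp [tr, MvPolynomial.coeff_sum, MvPolynomial.coeff_homogeneousComponent]

theorem tr_mem (k : ℕ) (p : MvPolynomial (Fin n) ℝ) :
    tr (k + 1) p ∈ MvPolynomial.restrictTotalDegree (Fin n) ℝ k := by
  rw [mem_restrictTotalDegree_iff]
  intro d hd
  rw [coeff_tr, if_neg (by omega)]

theorem tr_eq_self {k : ℕ} {p : MvPolynomial (Fin n) ℝ}
    (hp : p ∈ MvPolynomial.restrictTotalDegree (Fin n) ℝ k) : tr (k + 1) p = p := by
  rw [mem_restrictTotalDegree_iff] at hp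
  ext d
  rw [coeff_tr]
  split_ifs with h
  · rfl
  · exact (hp d (by omega)).symm

theorem norm1_tr_le (k : ℕ) (p : MvPolynomial (Fin n) ℝ) : norm1 (tr k p) ≤ norm1 p := by
  rw [norm1_eq_sum (p := tr k p) (s := p.support), norm1]
  · refine Finset.sum_le_sum fun d _ => ?_
    rw [coeff_tr]; split_ifs <;> simp
  · intro d hd
    rw [MvPolynomial.mem_support_iff, coeff_tr] at *
    exact fun h => hd (by simp [h])

theorem norm1_sub_tr_le (k : ℕ) (p : MvPolynomial (Fin n) ℝ) : norm1 (p - tr k p) ≤ norm1 p := by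
  rw [norm1_eq_sum (p := p - tr k p) (s := p.support), norm1]
  · refine Finset.sum_le_sum fun d _ => ?_
    rw [MvPolynomial.coeff_sub, coeff_tr]; split_ifs <;> simp
  · intro d hd
    rw [MvPolynomial.mem_support_iff, MvPolynomial.coeff_sub, coeff_tr] at *
    exact fun h => hd (by simp [h])

theorem coeff_sub_tr {k : ℕ} (p : MvPolynomial (Fin n) ℝ) {d : Fin n →₀ ℕ} (hd : d.degree < k) :
    (p - tr k p).coeff d = 0 := by
  rw [MvPolynomial.coeff_sub, coeff_tr, if_pos hd, sub_self]

theorem pderiv_tr (k : ℕ) (i : Fin n) (p : MvPolynomial (Fin n) ℝ) :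
    MvPolynomial.pderiv i (tr (k + 1) p) = tr k (MvPolynomial.pderiv i p) := by
  ext d
  rw [coeff_tr, MvPolynomial.coeff_pderiv, MvPolynomial.coeff_pderiv, coeff_tr]
  simp [ite_mul]

theorem lapP_tr (k : ℕ) (p : MvPolynomial (Fin n) ℝ) : lapP (tr (k + 2) p) = tr k (lapP p) := by
  simp only [lapP_apply, map_sum, pderiv_tr]

/-- The dilation of a polynomial. -/
def scl (r : ℝ) : MvPolynomial (Fin n) ℝ →ₐ[ℝ] MvPolynomial (Fin n) ℝ :=
  MvPolynomial.aeval fun i => r • MvPolynomial.X i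

theorem evp_scl (r : ℝ) (p : MvPolynomial (Fin n) ℝ) (y : Eu n) : evp (scl r p) y = evp p (r • y) := by
  induction p using MvPolynomial.induction_on with
  | C a => simp [scl, evp]
  | add p q hp hq => rw [map_add, evp_add, evp_add, hp, hq]
  | mul_X p i hp => rw [map_mul, evp_mul, evp_mul, hp]; simp [scl]

theorem coeff_scl (r : ℝ) (p : MvPolynomial (Fin n) ℝ) (d : Fin n →₀ ℕ) :
    (scl r p).coeff d = r ^ d.degree * p.coeff d := by
  classical
  have h : ∀ (e : Fin n →₀ ℕ) (a : ℝ), scl r (MvPolynomial.monomial e a) = MvPolynomial.monomial e (r ^ e.degree * a) := by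
    intro e a
    rw [scl, MvPolynomial.aeval_monomial]
    simp only [smul_pow]
    rw [Finsupp.prod, Finset.prod_smul, Finset.prod_pow_eq_pow_sum]
    rw [MvPolynomial.monomial_eq, Finsupp.prod, MvPolynomial.algebraMap_eq,
      MvPolynomial.smul_eq_C_mul, Finsupp.degree_apply, map_mul]
    ring
  conv_lhs => rw [p.as_sum, map_sum, MvPolynomial.coeff_sum]
  simp only [h, MvPolynomial.coeff_monomial]
  rw [Finset.sum_ite_eq']
  split_ifs with h
  · rfl
  · rw [MvPolynomial.notMem_support_iff.1 h, mul_zero]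

theorem pderiv_scl (r : ℝ) (p : MvPolynomial (Fin n) ℝ) (i : Fin n) :
    MvPolynomial.pderiv i (scl r p) = r • scl r (MvPolynomial.pderiv i p) := by
  ext d
  simp only [MvPolynomial.coeff_pderiv, coeff_scl, MvPolynomial.coeff_smul, map_add,
    Finsupp.degree_single, smul_eq_mul]
  ring

theorem lapP_scl (r : ℝ) (p : MvPolynomial (Fin n) ℝ) : lapP (scl r p) = r ^ 2 • scl r (lapP p) := by
  simp only [lapP_apply, pderiv_scl, map_sum, Finset.smul_sum]
  refine Finset.sum_congr rfl fun i _ => ?_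
  rw [(MvPolynomial.pderiv i).map_smul, pderiv_scl, smul_smul, pow_two]

theorem norm1_scl_le {r c : ℝ} {p : MvPolynomial (Fin n) ℝ}
    (h : ∀ d : Fin n →₀ ℕ, p.coeff d ≠ 0 → |r| ^ d.degree ≤ c) : norm1 (scl r p) ≤ c * norm1 p := by
  rw [norm1_eq_sum (p := scl r p) (s := p.support), norm1, Finset.mul_sum]
  · refine Finset.sum_le_sum fun d hd => ?_
    rw [coeff_scl, abs_mul, abs_pow]
    exact mul_le_mul_of_nonneg_right (h d (MvPolynomial.mem_support_iff.1 hd)) (abs_nonneg _)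
  · intro d hd
    rw [MvPolynomial.mem_support_iff, coeff_scl] at *
    exact fun h => hd (by simp [h])

theorem tr_scl (k : ℕ) (r : ℝ) (p : MvPolynomial (Fin n) ℝ) : tr k (scl r p) = scl r (tr k p) := by
  ext d
  simp only [coeff_tr, coeff_scl]; split_ifs <;> simp

theorem norm_fderiv_le_sum (u : Eu n → ℝ) (y : Eu n) : ‖fderiv ℝ u y‖ ≤ ∑ i, |pd i u y| := by
  rw [fderiv_eq_sum]
  refine (norm_sum_le _ _).trans (Finset.sum_le_sum fun i _ => ?_)
  rw [norm_smul, Real.norm_eq_abs]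
  refine (mul_le_mul_of_nonneg_left ?_ (abs_nonneg _)).trans_eq (mul_one _)
  exact ContinuousLinearMap.opNorm_le_bound _ zero_le_one fun y => by
    rw [one_mul]; exact abs_coord_le_norm y i

theorem abs_coeff_le_of_harmonic [NeZero n] (m : ℕ) : ∀ d : Fin n →₀ ℕ, d.degree = m → ∃ C : ℝ, 0 ≤ C ∧
    ∀ (h : MvPolynomial (Fin n) ℝ) (r M : ℝ), lapP h = 0 → 0 < r →
      (∀ y ∈ ball (0 : Eu n) r, |evp h y| ≤ M) → |h.coeff d| ≤ C * M / r ^ m := by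
  induction m with
  | zero =>
    intro d hd
    rw [Finsupp.degree_eq_zero_iff] at hd
    refine ⟨1, zero_le_one, fun h r M _ hr hM => ?_⟩
    have := hM 0 (mem_ball_self hr)
    have h0 : evp h 0 = h.coeff 0 := by
      rw [evp, ← MvPolynomial.constantCoeff_eq, ← MvPolynomial.eval_zero']; rfl
    rw [h0] at this
    simpa [hd] using this
  | succ m ih =>
    intro d hd
    obtain ⟨i, hi⟩ : ∃ i, d i ≠ 0 := by
      by_contra! h
      have : d = 0 := Finsupp.ext h
      simp [this] at hd
    set e : Fin n →₀ ℕ := d - Finsupp.single i 1 with he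
    have hde : e + Finsupp.single i 1 = d :=
      tsub_add_cancel_of_le (Finsupp.single_le_iff.2 (Nat.one_le_iff_ne_zero.2 hi))
    have hem : e.degree = m := by
      rw [← hde, map_add, Finsupp.degree_single] at hd; omega
    obtain ⟨C, hC, hb⟩ := ih e hem
    obtain ⟨C', hC', hb'⟩ := exists_pdMulti_bound [i]
    refine ⟨C * C' * 2 ^ (m + 1), by positivity, fun h r M hh hr hM => ?_⟩
    have h1 : ∀ y ∈ ball (0 : Eu n) (r / 2), |evp (MvPolynomial.pderiv i h) y| ≤ C' * M / (r / 2) := by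
      intro y hy
      have := hb' (evp h) y (r / 2) M (by positivity) (harm_evp hh _) fun w hw => hM w ?_
      · simpa [pdMulti, pd_evp] using this
      · rw [mem_ball, dist_zero_right] at *
        rw [dist_eq_norm] at hw
        have := norm_add_le (w - y) y
        rw [sub_add_cancel] at this
        linarith
    have h2 := hb _ (r / 2) _ (lapP_pderiv hh i) (by positivity) h1
    rw [MvPolynomial.coeff_pderiv, hde] at h2
    have h3 : |h.coeff d| ≤ |h.coeff d * ((e i : ℝ) + 1)| := by
      rw [abs_mul]
      refine le_mul_of_one_le_right (abs_nonneg _) ?_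
      rw [abs_of_nonneg (by positivity)]
      have : (0 : ℝ) ≤ e i := by positivity
      linarith
    refine h3.trans (h2.trans_eq ?_)
    rw [div_pow]
    field_simp
    ring

theorem norm1_tr_le_of_harmonic [NeZero n] (k : ℕ) {r : ℝ} (hr : 0 < r) : ∃ C : ℝ, 0 ≤ C ∧
    ∀ (h : MvPolynomial (Fin n) ℝ) (M : ℝ), lapP h = 0 →
      (∀ y ∈ ball (0 : Eu n) r, |evp h y| ≤ M) → norm1 (tr k h) ≤ C * M := by
  choose C hC hb using fun d : Fin n →₀ ℕ => abs_coeff_le_of_harmonic d.degree d rfl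
  have hfin := Finsupp.finite_of_degree_lt (σ := Fin n) k
  refine ⟨∑ d ∈ hfin.toFinset, C d / r ^ d.degree, Finset.sum_nonneg fun d _ => by have := hC d; positivity,
    fun h M hh hM => ?_⟩
  rw [norm1_eq_sum (s := hfin.toFinset), Finset.sum_mul]
  · refine Finset.sum_le_sum fun d hd => ?_
    have hd' : d.degree < k := by simpa using hd
    rw [coeff_tr, if_pos hd']
    refine (hb d h r M hh hr hM).trans_eq (by ring)
  · intro d hd
    rw [MvPolynomial.mem_support_iff, coeff_tr] at hd
    simp only [Finite.mem_toFinset, mem_ofPred_eq]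
    by_contra hlt
    exact hd (if_neg hlt)

theorem exists_taylor_bound [NeZero n] (k : ℕ) : ∃ C : ℝ, 0 ≤ C ∧
    ∀ (h : MvPolynomial (Fin n) ℝ) (r M : ℝ), lapP h = 0 → 0 < r →
      (∀ y ∈ ball (0 : Eu n) r, |evp h y| ≤ M) → ∀ y : Eu n, ‖y‖ < r / 2 ^ k →
        |evp (h - tr k h) y| ≤ C * M * (‖y‖ / r) ^ k := by
  induction k with
  | zero =>
    refine ⟨1, zero_le_one, fun h r M _ hr hM y hy => ?_⟩
    simpa [tr] using hM y (by simpa using hy)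
  | succ k ih =>
    obtain ⟨C, hC, hb⟩ := ih
    choose C' hC' hb' using fun i : Fin n => exists_pdMulti_bound [i]
    refine ⟨∑ i, C * (C' i * 2 * 2 ^ k), Finset.sum_nonneg fun i _ => by have := hC' i; positivity,
      fun h r M hh hr hM y hy => ?_⟩
    have h1 : ∀ i, ∀ y ∈ ball (0 : Eu n) (r / 2),
        |evp (MvPolynomial.pderiv i h) y| ≤ C' i * M / (r / 2) := by
      intro i y hy
      have := hb' i (evp h) y (r / 2) M (by positivity) (harm_evp hh _) fun w hw => hM w ?_
      · simpa [pdMulti, pd_evp] using this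
      · rw [mem_ball, dist_zero_right] at *
        rw [dist_eq_norm] at hw
        have := norm_add_le (w - y) y
        rw [sub_add_cancel] at this
        linarith
    have hM0 : 0 ≤ M := (abs_nonneg _).trans (hM 0 (mem_ball_self hr))
    have h2 : ∀ w ∈ closedBall (0 : Eu n) ‖y‖, ‖fderiv ℝ (evp (h - tr (k + 1) h)) w‖ ≤
        ∑ i, C * (C' i * M / (r / 2)) * (‖y‖ / (r / 2)) ^ k := by
      intro w hw
      rw [mem_closedBall, dist_zero_right] at hw
      refine (norm_fderiv_le_sum _ _).trans (Finset.sum_le_sum fun i _ => ?_)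
      rw [pd_evp, map_sub, pderiv_tr]
      have hw' : ‖w‖ < r / 2 / 2 ^ k := by
        refine (hw.trans_lt hy).trans_eq ?_
        rw [pow_succ]; field_simp
      refine (hb _ (r / 2) _ (lapP_pderiv hh i) (by positivity) (h1 i) w hw').trans ?_
      have := hC' i
      gcongr
    have h3 := (convex_closedBall (0 : Eu n) ‖y‖).norm_image_sub_le_of_norm_fderiv_le
      (fun w _ => differentiable_evp (h - tr (k + 1) h) w) h2
      (mem_closedBall_self (norm_nonneg y)) (by simp : y ∈ closedBall (0 : Eu n) ‖y‖)
    have h0 : evp (h - tr (k + 1) h) 0 = 0 := by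
      have := abs_evp_le (p := h - tr (k + 1) h) (y := 0) (m := 1) (by simp)
        fun d hd => coeff_sub_tr _ (by omega)
      simpa using this
    rw [h0, sub_zero, sub_zero, Real.norm_eq_abs] at h3
    refine h3.trans_eq ?_
    rw [Finset.sum_mul, Finset.sum_mul, Finset.sum_mul]
    refine Finset.sum_congr rfl fun i _ => ?_
    rw [div_pow, div_pow, div_pow]
    field_simp
    ring

/-- Every linear map on polynomials of bounded degree is bounded. -/
theorem exists_norm1_bound (m : ℕ)
    (f : MvPolynomial.restrictTotalDegree (Fin n) ℝ m →ₗ[ℝ] MvPolynomial (Fin n) ℝ) :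
    ∃ K : ℝ, 0 ≤ K ∧ ∀ p, norm1 (f p) ≤ K * norm1 (p : MvPolynomial (Fin n) ℝ) := by
  classical
  have hfin := Finsupp.finite_of_degree_le (σ := Fin n) m
  have hmono : ∀ d : Fin n →₀ ℕ, d.degree ≤ m →
      MvPolynomial.monomial d (1 : ℝ) ∈ MvPolynomial.restrictTotalDegree (Fin n) ℝ m := by
    intro d hd
    rw [mem_restrictTotalDegree_iff]
    intro e he
    rw [MvPolynomial.coeff_monomial, if_neg]
    rintro rfl; omega
  set b : (Fin n →₀ ℕ) → MvPolynomial.restrictTotalDegree (Fin n) ℝ m := fun d =>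
    if h : d.degree ≤ m then ⟨_, hmono d h⟩ else 0 with hb
  have hsup : ∀ p ∈ MvPolynomial.restrictTotalDegree (Fin n) ℝ m, p.support ⊆ hfin.toFinset := by
    intro p hp d hd
    simp only [Finite.mem_toFinset, mem_ofPred_eq]
    by_contra! h
    exact MvPolynomial.mem_support_iff.1 hd (mem_restrictTotalDegree_iff.1 hp d h)
  refine ⟨∑ d ∈ hfin.toFinset, norm1 (f (b d)), Finset.sum_nonneg fun _ _ => norm1_nonneg _,
    fun p => ?_⟩
  have hp : p = ∑ d ∈ hfin.toFinset, (p : MvPolynomial (Fin n) ℝ).coeff d • b d := by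
    apply Subtype.ext
    rw [Submodule.coe_sum]
    conv_lhs => rw [(p : MvPolynomial (Fin n) ℝ).as_sum]
    rw [Finset.sum_subset (hsup _ p.2) fun d _ hd => by rw [MvPolynomial.notMem_support_iff.1 hd, map_zero]]
    refine Finset.sum_congr rfl fun d hd => ?_
    have hd' : d.degree ≤ m := by simpa using hd
    rw [Submodule.coe_smul, hb]
    simp [hd', MvPolynomial.smul_monomial]
  conv_lhs => rw [hp, map_sum]
  refine (norm1_sum_le _ _).trans ?_
  rw [Finset.sum_mul]
  refine Finset.sum_le_sum fun d _ => ?_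
  rw [map_smul, norm1_smul, mul_comm]
  exact mul_le_mul_of_nonneg_left (abs_coeff_le_norm1 _ _) (norm1_nonneg _)

theorem lapP_X_sq_mul_ne_zero (i : Fin n) {t : MvPolynomial (Fin n) ℝ} (ht : t ≠ 0) :
    lapP (MvPolynomial.X i * (MvPolynomial.X i * t)) ≠ 0 := by
  classical
  obtain ⟨d, hd, hmin⟩ := Finset.exists_min_image t.support (fun d => d i)
    (MvPolynomial.support_nonempty.2 ht)
  intro h
  have h1 := congrArg (MvPolynomial.coeff d) h
  rw [lapP_apply, MvPolynomial.coeff_sum, MvPolynomial.coeff_zero, Finset.sum_eq_single i] at h1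
  · simp only [MvPolynomial.coeff_pderiv] at h1
    rw [add_comm, MvPolynomial.coeff_X_mul, add_comm, MvPolynomial.coeff_X_mul] at h1
    have h2 := MvPolynomial.mem_support_iff.1 hd
    have h3 : ((d i : ℝ) + 1) ≠ 0 := by positivity
    have h4 : (((d + Finsupp.single i 1 : Fin n →₀ ℕ) i : ℕ) : ℝ) + 1 ≠ 0 := by positivity
    rw [add_comm (Finsupp.single i 1)] at h1
    exact mul_ne_zero (mul_ne_zero h2 h4) h3 h1
  · intro j _ hj
    simp only [MvPolynomial.coeff_pderiv]
    have hz : (MvPolynomial.X i * (MvPolynomial.X i * t)).coeff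
        (d + Finsupp.single j 1 + Finsupp.single j 1) = 0 := by
      rw [MvPolynomial.coeff_X_mul']
      split_ifs with hs
      · rw [MvPolynomial.coeff_X_mul']
        split_ifs with hs'
        · by_contra hne
          have := hmin _ (MvPolynomial.mem_support_iff.2 hne)
          simp only [Finsupp.mem_support_iff, Finsupp.tsub_apply, Finsupp.add_apply, Finsupp.single_eq_same,
            Finsupp.single_apply, if_neg hj] at this hs hs'
          omega
        · rfl
      · rfl
    rw [hz]; ring
  · simp

theorem tr_X_mul (k : ℕ) (i : Fin n) (q : MvPolynomial (Fin n) ℝ) :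
    tr (k + 1) (MvPolynomial.X i * q) = MvPolynomial.X i * tr k q := by
  classical
  ext d
  rw [coeff_tr, MvPolynomial.coeff_X_mul', MvPolynomial.coeff_X_mul', coeff_tr]
  by_cases hs : i ∈ d.support
  · have hde : (d - Finsupp.single i 1) + Finsupp.single i 1 = d :=
      tsub_add_cancel_of_le (Finsupp.single_le_iff.2
        (Nat.one_le_iff_ne_zero.2 (Finsupp.mem_support_iff.1 hs)))
    have hdeg : d.degree = (d - Finsupp.single i 1).degree + 1 := by
      conv_lhs => rw [← hde]
      rw [map_add, Finsupp.degree_single]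
    simp only [if_pos hs, hdeg, Nat.add_lt_add_iff_right]
  · simp [hs]

theorem X_mul_mem {m : ℕ} (i : Fin n) {q : MvPolynomial (Fin n) ℝ}
    (hq : q ∈ MvPolynomial.restrictTotalDegree (Fin n) ℝ m) :
    MvPolynomial.X i * q ∈ MvPolynomial.restrictTotalDegree (Fin n) ℝ (m + 1) := by
  rw [← tr_eq_self hq, ← tr_X_mul]
  exact tr_mem _ _

/-- For polynomials `p` close to the coordinate function `X i`, the equation
`Δ (p Xᵢ t) = s`, truncated to degree `m`, is solvable. -/
theorem exists_correction (i : Fin n) (m : ℕ) : ∃ η K : ℝ, 0 < η ∧ 0 ≤ K ∧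
    ∀ p : MvPolynomial (Fin n) ℝ, norm1 p ≤ η →
      ∀ s ∈ MvPolynomial.restrictTotalDegree (Fin n) ℝ m,
        ∃ t ∈ MvPolynomial.restrictTotalDegree (Fin n) ℝ m,
          lapP (tr (m + 3) ((MvPolynomial.X i + p) * (MvPolynomial.X i * t))) = s ∧
            norm1 t ≤ K * norm1 s := by
  set V := MvPolynomial.restrictTotalDegree (Fin n) ℝ m with hV
  set T : MvPolynomial (Fin n) ℝ → V →ₗ[ℝ] V := fun p =>
    LinearMap.codRestrict V
      (lapP ∘ₗ tr (m + 3) ∘ₗ LinearMap.mulLeft ℝ ((MvPolynomial.X i + p) * MvPolynomial.X i) ∘ₗ V.subtype)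
      (fun t => lapP_mem (tr_mem _ _)) with hT
  have hTa : ∀ p (t : V), (T p t : MvPolynomial (Fin n) ℝ) =
      lapP (tr (m + 3) ((MvPolynomial.X i + p) * (MvPolynomial.X i * (t : MvPolynomial (Fin n) ℝ)))) := fun p t => by
    simp [hT]
  have htr0 : ∀ t : V, tr (m + 3) (MvPolynomial.X i * (MvPolynomial.X i * (t : MvPolynomial (Fin n) ℝ))) =
      MvPolynomial.X i * (MvPolynomial.X i * (t : MvPolynomial (Fin n) ℝ)) := fun t =>
    tr_eq_self (X_mul_mem i (X_mul_mem i t.2))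
  have hinj0 : Function.Injective (T 0) := by
    rw [← LinearMap.ker_eq_bot, LinearMap.ker_eq_bot']
    intro t ht
    by_contra hne
    have h1 := congrArg Subtype.val ht
    rw [hTa, add_zero, htr0] at h1
    exact lapP_X_sq_mul_ne_zero i (fun h => hne (Subtype.ext h)) h1
  let A : V ≃ₗ[ℝ] V := LinearEquiv.ofInjectiveEndo (T 0) hinj0
  obtain ⟨K, hK, hKb⟩ := exists_norm1_bound m (V.subtype ∘ₗ (A.symm : V →ₗ[ℝ] V))
  obtain ⟨L, hL, hLb⟩ := exists_norm1_bound (m + 2)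
    (lapP ∘ₗ (MvPolynomial.restrictTotalDegree (Fin n) ℝ (m + 2)).subtype)
  have hKb' : ∀ t : V, norm1 (t : MvPolynomial (Fin n) ℝ) ≤ K * norm1 (T 0 t : MvPolynomial (Fin n) ℝ) := by
    intro t
    have h1 : A.symm (T 0 t) = t := A.symm_apply_apply t
    have := hKb (T 0 t)
    rwa [LinearMap.comp_apply, LinearEquiv.coe_coe, h1, Submodule.subtype_apply] at this
  have key : ∀ p : MvPolynomial (Fin n) ℝ, norm1 p ≤ 1 / (2 * (K * L + 1)) → ∀ t : V,
      norm1 (t : MvPolynomial (Fin n) ℝ) ≤ 2 * K * norm1 (T p t : MvPolynomial (Fin n) ℝ) := by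
    intro p hp t
    have h1 : (T 0 t : MvPolynomial (Fin n) ℝ) =
        (T p t : MvPolynomial (Fin n) ℝ) -
        lapP (tr (m + 3) (p * (MvPolynomial.X i * (t : MvPolynomial (Fin n) ℝ)))) := by
      rw [hTa, hTa, add_zero, add_mul, map_add, map_add, add_sub_cancel_right]
    have h2 : norm1 (lapP (tr (m + 3) (p * (MvPolynomial.X i * (t : MvPolynomial (Fin n) ℝ))))) ≤
        L * (norm1 p * norm1 (t : MvPolynomial (Fin n) ℝ)) := by
      refine (hLb ⟨_, tr_mem _ _⟩).trans (mul_le_mul_of_nonneg_left ?_ hL)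
      refine (norm1_tr_le _ _).trans ((norm1_mul_le _ _).trans_eq ?_)
      rw [norm1_X_mul]
    have h3 := hKb' t
    rw [h1] at h3
    have h4 := norm1_sub_le (T p t : MvPolynomial (Fin n) ℝ) (lapP (tr (m + 3) (p * (MvPolynomial.X i * (t : MvPolynomial (Fin n) ℝ)))))
    have h5 := norm1_nonneg (t : MvPolynomial (Fin n) ℝ)
    have h6 : K * (L * (norm1 p * norm1 (t : MvPolynomial (Fin n) ℝ))) ≤
        1 / 2 * norm1 (t : MvPolynomial (Fin n) ℝ) := by
      have : K * L * norm1 p ≤ 1 / 2 := by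
        have hKL : 0 ≤ K * L := by positivity
        calc K * L * norm1 p ≤ K * L * (1 / (2 * (K * L + 1))) := by gcongr
          _ ≤ 1 / 2 := by
            rw [mul_one_div, div_le_div_iff₀ (by positivity) (by positivity)]; linarith
      calc K * (L * (norm1 p * norm1 (t : MvPolynomial (Fin n) ℝ))) = (K * L * norm1 p) * norm1 (t : MvPolynomial (Fin n) ℝ) := by ring
        _ ≤ _ := by gcongr
    have h7 : norm1 (t : MvPolynomial (Fin n) ℝ) ≤ K * (norm1 (T p t : MvPolynomial (Fin n) ℝ) +
        L * (norm1 p * norm1 (t : MvPolynomial (Fin n) ℝ))) :=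
      h3.trans (mul_le_mul_of_nonneg_left (h4.trans (by linarith)) hK)
    rw [mul_add] at h7
    linarith
  refine ⟨1 / (2 * (K * L + 1)), 2 * K, by positivity, by positivity, fun p hp s hs => ?_⟩
  have hinj : Function.Injective (T p) := by
    rw [← LinearMap.ker_eq_bot, LinearMap.ker_eq_bot']
    intro t ht
    have := key p hp t
    rw [ht] at this
    exact Subtype.ext (eq_zero_of_norm1 (by simpa using this))
  obtain ⟨t, ht⟩ := LinearMap.injective_iff_surjective.1 hinj ⟨s, hs⟩
  have hts : (T p t : MvPolynomial (Fin n) ℝ) = s := by rw [ht]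
  exact ⟨t, t.2, by rw [← hTa, hts], by have := key p hp t; rwa [hts] at this⟩

/-- The reflection `Xᵢ ↦ -Xᵢ`. -/
def flipP (i : Fin n) : MvPolynomial (Fin n) ℝ →ₐ[ℝ] MvPolynomial (Fin n) ℝ :=
  MvPolynomial.aeval fun j => if j = i then -MvPolynomial.X j else MvPolynomial.X j

theorem evp_flipP (i : Fin n) (p : MvPolynomial (Fin n) ℝ) (y : Eu n) :
    evp (flipP i p) y = evp p (hflip 0 i y) := by
  induction p using MvPolynomial.induction_on with
  | C a => simp [flipP, evp]
  | add p q hp hq => rw [map_add, evp_add, evp_add, hp, hq]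
  | mul_X p j hp =>
    rw [map_mul, evp_mul, evp_mul, hp]
    congr 1
    by_cases h : j = i
    · subst h; simp [flipP, hflip]; ring
    · simp [flipP, hflip, h]

theorem X_dvd_sub_flipP (i : Fin n) (p : MvPolynomial (Fin n) ℝ) : MvPolynomial.X i ∣ p - flipP i p := by
  induction p using MvPolynomial.induction_on with
  | C a => simp [flipP]
  | add p q hp hq => rw [map_add, add_sub_add_comm]; exact dvd_add hp hq
  | mul_X p j hp =>
    rw [map_mul]
    have h1 : MvPolynomial.X i ∣ (MvPolynomial.X j : MvPolynomial (Fin n) ℝ) - flipP i (MvPolynomial.X j) := by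
      by_cases h : j = i
      · subst h; simp [flipP]
      · simp [flipP, h]
    have : p * MvPolynomial.X j - flipP i p * flipP i (MvPolynomial.X j) =
        (p - flipP i p) * MvPolynomial.X j + flipP i p * (MvPolynomial.X j - flipP i (MvPolynomial.X j)) := by
      ring
    rw [this]
    exact dvd_add (hp.mul_right _) (h1.mul_left _)

theorem lapP_flipP [NeZero n] (i : Fin n) {p : MvPolynomial (Fin n) ℝ} (hp : lapP p = 0) :
    lapP (flipP i p) = 0 := by
  refine lapP_eq_zero_of_harm isOpen_univ univ_nonempty (O := (univ : Set (Eu n))) ?_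
  have := (harm_evp hp univ).comp_hflip 0 i
  simpa [← evp_flipP] using this

theorem isOpen_cap {F : Eu n → ℝ} {c : Eu n} {r : ℝ} (hF : ContinuousOn F (closedBall c r)) :
    IsOpen {y | y ∈ ball c r ∧ 0 < F y} :=
  (hF.mono ball_subset_closedBall).isOpen_inter_preimage isOpen_ball isOpen_Ioi

theorem closure_cap_subset {F : Eu n → ℝ} {c : Eu n} {r : ℝ} (hF : ContinuousOn F (closedBall c r)) :
    closure {y | y ∈ ball c r ∧ 0 < F y} ⊆ {y | y ∈ closedBall c r ∧ 0 ≤ F y} := by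
  have h : IsClosed {y | y ∈ closedBall c r ∧ 0 ≤ F y} :=
    hF.preimage_isClosed_of_isClosed isClosed_closedBall isClosed_Ici
  exact closure_minimal (fun y hy => ⟨ball_subset_closedBall hy.1, hy.2.le⟩) h

theorem mem_frontier_cap {F : Eu n → ℝ} {c : Eu n} {r : ℝ} (hF : ContinuousOn F (closedBall c r))
    {w : Eu n} (hw : w ∈ frontier {y | y ∈ ball c r ∧ 0 < F y}) :
    w ∈ closedBall c r ∧ (F w = 0 ∨ 0 < F w ∧ dist w c = r) := by
  obtain ⟨h1, h2⟩ := closure_cap_subset hF (frontier_subset_closure hw)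
  refine ⟨h1, ?_⟩
  rcases h2.eq_or_lt with h | h
  · exact Or.inl h.symm
  refine Or.inr ⟨h, (mem_closedBall.1 h1).antisymm (not_lt.1 fun hlt => ?_)⟩
  rw [(isOpen_cap hF).frontier_eq] at hw
  exact hw.2 ⟨mem_ball.2 hlt, h⟩

theorem hflip_apply_same (i : Fin n) (y : Eu n) : hflip 0 i y i = - y i := by
  simp [hflip]; ring

theorem hflip_hflip (i : Fin n) (y : Eu n) : hflip 0 i (hflip 0 i y) = y := by
  ext j
  by_cases h : j = i
  · subst h; rw [hflip_apply_same, hflip_apply_same, neg_neg]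
  · simp [hflip, h]

theorem abs_le_near_flat [NeZero n] (i : Fin n) {η : ℝ} (hη : 0 < η) {F v : Eu n → ℝ}
    (hF : ContinuousOn F (closedBall 0 1)) (hFη : ∀ y ∈ closedBall (0 : Eu n) 1, |F y - y i| ≤ η)
    (hvc : ContinuousOn v (closedBall 0 1)) (hv : Harm v {y | y ∈ ball (0 : Eu n) 1 ∧ 0 < F y})
    (hv1 : ∀ y ∈ ball (0 : Eu n) 1, 0 < F y → |v y| ≤ 1)
    (hv0 : ∀ y ∈ ball (0 : Eu n) 1, F y = 0 → |v y| ≤ η)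
    {y : Eu n} (hy : ‖y‖ ≤ 3 / 4) (hFy : 0 < F y) : |v y| ≤ η + 16 * (n + 1) * (y i + η) := by
  have hyb : y ∈ ball (0 : Eu n) 1 := by rw [mem_ball, dist_zero_right]; linarith
  have hn : (0 : ℝ) ≤ n := by positivity
  set t := y i + η with ht
  have ht0 : 0 < t := by
    have := (abs_le.1 (hFη y (ball_subset_closedBall hyb))).2
    linarith
  rcases le_or_gt (1 / 16) t with h16 | h16
  · have := hv1 y hyb hFy
    nlinarith
  set c : Eu n := y - t • eb i with hc
  have hci : c i = -η := by simp [hc, ht]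
  have hcn : ‖c‖ ≤ 3 / 4 + 1 / 16 := by
    refine (norm_sub_le _ _).trans (add_le_add hy ?_)
    rw [norm_smul, norm_eq_abs, abs_of_pos ht0]
    simpa using h16.le
  have hsub : closedBall c (1 / 16) ⊆ ball (0 : Eu n) 1 := by
    intro w hw
    rw [mem_closedBall, dist_eq_norm] at hw
    rw [mem_ball, dist_zero_right]
    have := norm_add_le (w - c) c
    rw [sub_add_cancel] at this
    linarith
  have hFc : ContinuousOn F (closedBall c (1 / 16)) := hF.mono (hsub.trans ball_subset_closedBall)
  set O := {y | y ∈ ball c (1 / 16) ∧ 0 < F y} with hO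
  have hOo : IsOpen O := isOpen_cap hFc
  have hOb : Bornology.IsBounded O := isBounded_ball.subset fun y hy => hy.1
  have hclO : closure O ⊆ closedBall 0 1 := fun w hw =>
    ball_subset_closedBall (hsub (closure_cap_subset hFc hw).1)
  have hvO : Harm v O := hv.mono fun w hw => ⟨hsub (ball_subset_closedBall hw.1), hw.2⟩
  have hvcO : ContinuousOn v (closure O) := hvc.mono hclO
  have hbar : Harm (fun w => η + barrier c i (1 / 16) w) O := (harm_const η O).add (harm_barrier c i _ O)
  have hbarc : ContinuousOn (fun w => η + barrier c i (1 / 16) w) (closure O) :=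
    continuousOn_const.add (harm_barrier c i _ _).1
  have hfr : ∀ w ∈ frontier O, |v w| ≤ η + barrier c i (1 / 16) w := by
    intro w hw
    obtain ⟨hw1, hw2⟩ := mem_frontier_cap hFc hw
    have hwb := hsub hw1
    have h1 := (abs_le.1 (hFη w (ball_subset_closedBall hwb))).2
    have h2 : 0 ≤ F w := by rcases hw2 with h | h <;> linarith
    have h3 : 0 ≤ w i - c i := by rw [hci]; linarith
    have h4 : w i - c i ≤ 1 / 16 := by
      refine (le_abs_self _).trans ((abs_coord_le w c i).trans ?_)
      rwa [← dist_eq_norm]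
    rcases hw2 with h | ⟨h, h'⟩
    · have := barrier_nonneg c i w h3 h4
      linarith [hv0 w hwb h]
    · have := one_le_barrier c i (by norm_num) w h3 h4 (by rwa [← dist_eq_norm])
      linarith [hv1 w hwb h]
  have hyO : y ∈ closure O := by
    refine subset_closure ⟨?_, hFy⟩
    rw [mem_ball, dist_eq_norm, hc, sub_sub_cancel, norm_smul, norm_eq_abs, abs_of_pos ht0]
    simpa using h16
  have h1 := Harm.le_of_frontier_le hOo hOb hvO hvcO hbar hbarc
    (fun w hw => (le_abs_self _).trans (hfr w hw)) y hyO
  have h2 := Harm.le_of_frontier_le hOo hOb hvO.neg hvcO.neg hbar hbarc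
    (fun w hw => (neg_le_abs _).trans (hfr w hw)) y hyO
  have h3 := barrier_add_smul_le c i (by norm_num : (0 : ℝ) < 1 / 16) ht0.le h16.le
  have h4 : c + t • eb i = y := sub_add_cancel _ _
  rw [h4] at h3
  have h5 : ((n : ℝ) + 1) * t / (1 / 16) = 16 * (n + 1) * t := by ring
  rw [h5] at h3
  exact abs_le.2 ⟨by linarith, by linarith⟩

/-- A continuous cut-off, vanishing on `(-∞, η]` and equal to one on `[2η, ∞)`. -/
def ramp (η t : ℝ) : ℝ := min 1 (max 0 ((t - η) / η))

theorem continuous_ramp (η : ℝ) : Continuous (ramp η) := by unfold ramp; fun_prop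

theorem ramp_nonneg (η t : ℝ) : 0 ≤ ramp η t := le_min zero_le_one (le_max_left _ _)

theorem ramp_le_one (η t : ℝ) : ramp η t ≤ 1 := min_le_left _ _

theorem ramp_of_le {η t : ℝ} (hη : 0 < η) (h : t ≤ η) : ramp η t = 0 := by
  have : (t - η) / η ≤ 0 := div_nonpos_of_nonpos_of_nonneg (by linarith) hη.le
  rw [ramp, max_eq_left this]; simp

theorem ramp_of_ge {η t : ℝ} (hη : 0 < η) (h : 2 * η ≤ t) : ramp η t = 1 := by
  have : 1 ≤ (t - η) / η := by rw [le_div_iff₀ hη]; linarith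
  rw [ramp, min_eq_left]
  exact this.trans (le_max_right _ _)

theorem exists_odd_harmonic_near [NeZero n] (i : Fin n) {η : ℝ} (hη : 0 < η) (hη1 : η ≤ 1)
    {F v : Eu n → ℝ}
    (hF : ContinuousOn F (closedBall 0 1)) (hFη : ∀ y ∈ closedBall (0 : Eu n) 1, |F y - y i| ≤ η)
    (hvc : ContinuousOn v (closedBall 0 1)) (hv : Harm v {y | y ∈ ball (0 : Eu n) 1 ∧ 0 < F y})
    (hv1 : ∀ y ∈ ball (0 : Eu n) 1, 0 < F y → |v y| ≤ 1)
    (hv0 : ∀ y ∈ ball (0 : Eu n) 1, F y = 0 → |v y| ≤ η) :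
    ∃ h : MvPolynomial (Fin n) ℝ, lapP h = 0 ∧ MvPolynomial.X i ∣ h ∧
      (∀ y ∈ ball (0 : Eu n) (3 / 4), |evp h y| ≤ 2) ∧
      ∀ y ∈ ball (0 : Eu n) (3 / 4), 0 < F y → |v y - evp h y| ≤ (64 * (n + 1) + 4) * η := by
  have hn : (0 : ℝ) ≤ n := by positivity
  have hdec := fun {y : Eu n} => abs_le_near_flat (y := y) i hη hF hFη hvc hv hv1 hv0
  have hball : ∀ y : Eu n, ‖y‖ ≤ 3 / 4 → y ∈ ball (0 : Eu n) 1 := fun y hy => by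
    rw [mem_ball, dist_zero_right]; linarith
  have hnf : ∀ y : Eu n, ‖hflip 0 i y‖ = ‖y‖ := fun y => by simpa using norm_hflip_sub 0 i y
  set f : Eu n → ℝ := fun y => ramp η (y i) * v y - ramp η (-(y i)) * v (hflip 0 i y) with hf
  have hodd : ∀ y, f (hflip 0 i y) = - f y := fun y => by
    simp only [hf, hflip_apply_same, hflip_hflip, neg_neg]; ring
  have hfc : ContinuousOn f (closedBall 0 1) := by
    have h1 : Continuous fun y : Eu n => ramp η (y i) := (continuous_ramp η).comp (by fun_prop)
    have h2 : Continuous fun y : Eu n => ramp η (-(y i)) := (continuous_ramp η).comp (by fun_prop)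
    refine (h1.continuousOn.mul hvc).sub (h2.continuousOn.mul ?_)
    exact hvc.comp (continuous_hflip 0 i).continuousOn fun y hy => by
      rw [mem_closedBall, dist_zero_right] at *; rwa [hnf]
  have hfpos : ∀ y : Eu n, ‖y‖ ≤ 3 / 4 → 0 ≤ y i →
      |f y| ≤ 1 ∧ |f y| ≤ η + 16 * (n + 1) * (y i + η) := by
    intro y hy hyi
    have h0 : ramp η (-(y i)) = 0 := ramp_of_le hη (by linarith)
    have hfy : f y = ramp η (y i) * v y := by simp [hf, h0]
    rcases le_or_gt (y i) η with hle | hlt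
    · rw [hfy, ramp_of_le hη hle, zero_mul, abs_zero]
      exact ⟨zero_le_one, by positivity⟩
    · have hFy : 0 < F y := by
        have := (abs_le.1 (hFη y (ball_subset_closedBall (hball y hy)))).1
        linarith
      have : |f y| ≤ |v y| := by
        rw [hfy, abs_mul, abs_of_nonneg (ramp_nonneg _ _)]
        exact mul_le_of_le_one_left (abs_nonneg _) (ramp_le_one _ _)
      exact ⟨this.trans (hv1 y (hball y hy) hFy), this.trans (hdec hy hFy)⟩
  have hfall : ∀ y : Eu n, ‖y‖ ≤ 3 / 4 → |f y| ≤ 1 ∧ |f y| ≤ η + 16 * (n + 1) * (|y i| + η) := by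
    intro y hy
    rcases le_total 0 (y i) with h | h
    · rw [abs_of_nonneg h]; exact hfpos y hy h
    · have := hfpos (hflip 0 i y) (by rwa [hnf]) (by rw [hflip_apply_same]; linarith)
      rwa [hodd, abs_neg, hflip_apply_same, ← abs_of_nonpos h] at this
  have hfv : ∀ y : Eu n, ‖y‖ ≤ 3 / 4 → 0 < F y → |v y - f y| ≤ η + 16 * (n + 1) * (3 * η) := by
    intro y hy hFy
    have hyi : -η < y i := by
      have := (abs_le.1 (hFη y (ball_subset_closedBall (hball y hy)))).2
      linarith
    have hfy : f y = ramp η (y i) * v y := by simp [hf, ramp_of_le hη (by linarith : -(y i) ≤ η)]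
    rcases le_or_gt (2 * η) (y i) with h2 | h2
    · rw [hfy, ramp_of_ge hη h2, one_mul, sub_self, abs_zero]; positivity
    · have h3 : v y - f y = (1 - ramp η (y i)) * v y := by rw [hfy]; ring
      rw [h3, abs_mul, abs_of_nonneg (by linarith [ramp_le_one η (y i)])]
      refine (mul_le_of_le_one_left (abs_nonneg _) (by linarith [ramp_nonneg η (y i)])).trans
        ((hdec hy hFy).trans ?_)
      gcongr; linarith
  obtain ⟨p0, hp0, hpf0⟩ := exists_harmonic_poly_near_sphere (f := fun y => f ((3 / 4 : ℝ) • y))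
    (hfc.comp (by fun_prop) fun y hy => by
      rw [mem_sphere, dist_zero_right] at hy
      rw [mem_closedBall, dist_zero_right, norm_smul, hy]; norm_num) hη
  set p := scl (4 / 3) p0 with hp
  have hplap : lapP p = 0 := by rw [hp, lapP_scl, hp0]; simp
  have hpf : ∀ y : Eu n, ‖y‖ = 3 / 4 → |evp p y - f y| < η := by
    intro y hy
    have := hpf0 ((4 / 3 : ℝ) • y) (by rw [norm_smul, hy]; norm_num)
    rw [smul_smul] at this
    norm_num at this
    rw [hp, evp_scl]; exact this
  set h := (1 / 2 : ℝ) • (p - flipP i p) with hh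
  have hhlap : lapP h = 0 := by rw [hh, map_smul, map_sub, hplap, lapP_flipP i hplap]; simp
  have hhX : MvPolynomial.X i ∣ h := by
    rw [hh, MvPolynomial.smul_eq_C_mul]; exact (X_dvd_sub_flipP i p).mul_left _
  have hhe : ∀ y, evp h y = (1 / 2) * (evp p y - evp p (hflip 0 i y)) := fun y => by
    rw [hh, evp_smul, evp_sub, evp_flipP]
  have hhodd : ∀ y, evp h (hflip 0 i y) = - evp h y := fun y => by
    rw [hhe, hhe, hflip_hflip]; ring
  have hhf : ∀ y : Eu n, ‖y‖ = 3 / 4 → |evp h y - f y| ≤ η := by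
    intro y hy
    have h1 := abs_lt.1 (hpf y hy)
    have h2 := abs_lt.1 (hpf (hflip 0 i y) (by rwa [hnf]))
    rw [hodd] at h2
    rw [hhe, abs_le]
    constructor <;> linarith [h1.1, h1.2, h2.1, h2.2]
  have hbb : Bornology.IsBounded (ball (0 : Eu n) (3 / 4)) := isBounded_ball
  have hfrb : ∀ {y : Eu n}, dist y 0 = 3 / 4 → ‖y‖ = 3 / 4 := fun {y} hy => by rwa [← dist_zero_right]
  have hhsph : ∀ y : Eu n, ‖y‖ = 3 / 4 → |evp h y| ≤ 2 ∧ |evp h y| ≤ 2 * η + 16 * (n + 1) * (|y i| + η) := by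
    intro y hy
    have h1 := hfall y hy.le
    have h2 : |evp h y| ≤ |evp h y - f y| + |f y| := by
      have := abs_add_le (evp h y - f y) (f y); rwa [sub_add_cancel] at this
    have h3 := hhf y hy
    constructor <;> linarith [h1.1, h1.2]
  have hcontC : ContinuousOn (fun y : Eu n => y i) (closedBall 0 (3 / 4)) := by fun_prop
  have hhpos : ∀ y ∈ ball (0 : Eu n) (3 / 4), 0 < y i →
      |evp h y| ≤ 16 * (n + 1) * (y i) + (2 * η + 16 * (n + 1) * η) := by
    intro y hy hyi
    set O := {y : Eu n | y ∈ ball (0 : Eu n) (3 / 4) ∧ 0 < y i} with hO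
    have hcmp : Harm (fun y : Eu n => 16 * (n + 1) * (y i - (0 : Eu n) i) + (2 * η + 16 * (n + 1) * η)) O :=
      ((harm_coord 0 i O).const_mul _).add (harm_const _ O)
    have hcmpc : ContinuousOn (fun y : Eu n => 16 * (n + 1) * (y i - (0 : Eu n) i) +
        (2 * η + 16 * (n + 1) * η)) (closure O) := by fun_prop
    have hfr : ∀ w ∈ frontier O, |evp h w| ≤ 16 * (n + 1) * (w i - (0 : Eu n) i) +
        (2 * η + 16 * (n + 1) * η) := by
      intro w hw
      obtain ⟨hw1, hw2 | ⟨hw2, hw3⟩⟩ := mem_frontier_cap hcontC hw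
      · have : hflip 0 i w = w := by simp [hflip, hw2]
        have h1 := hhodd w
        rw [this] at h1
        have h2 : evp h w = 0 := by linarith
        rw [h2, abs_zero, hw2]; simp; positivity
      · refine (hhsph w (hfrb hw3)).2.trans ?_
        rw [abs_of_pos hw2]; simp; linarith
    have hOb : Bornology.IsBounded O := hbb.subset fun y hy => hy.1
    have hyO : y ∈ closure O := subset_closure ⟨hy, hyi⟩
    have hhH := harm_evp hhlap O
    have hhc : ContinuousOn (evp h) (closure O) := (continuous_evp h).continuousOn
    have h1 := Harm.le_of_frontier_le (isOpen_cap hcontC) hOb hhH hhc hcmp hcmpc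
      (fun w hw => (le_abs_self _).trans (hfr w hw)) y hyO
    have h2 := Harm.le_of_frontier_le (isOpen_cap hcontC) hOb hhH.neg hhc.neg hcmp hcmpc
      (fun w hw => (neg_le_abs _).trans (hfr w hw)) y hyO
    have h3 : y i - (0 : Eu n) i = y i := by simp
    rw [h3] at h1 h2
    exact abs_le.2 ⟨by linarith, by linarith⟩
  have hhall : ∀ y : Eu n, ‖y‖ ≤ 3 / 4 →
      |evp h y| ≤ 16 * (n + 1) * |y i| + (2 * η + 16 * (n + 1) * η) := by
    intro y hy
    rcases hy.eq_or_lt with hy | hy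
    · refine (hhsph y hy).2.trans_eq (by ring)
    rcases lt_trichotomy (y i) 0 with h0 | h0 | h0
    · have := hhpos (hflip 0 i y) (by rw [mem_ball, dist_zero_right, hnf]; exact hy)
        (by rw [hflip_apply_same]; linarith)
      rwa [hhodd, abs_neg, hflip_apply_same, ← abs_of_neg h0] at this
    · have : hflip 0 i y = y := by simp [hflip, h0]
      have h1 := hhodd y
      rw [this] at h1
      have h2 : evp h y = 0 := by linarith
      rw [h2, abs_zero]; positivity
    · rw [abs_of_pos h0]
      exact hhpos y (by rw [mem_ball, dist_zero_right]; exact hy) h0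
  refine ⟨h, hhlap, hhX, fun y hy => ?_, fun y hy hFy => ?_⟩
  · refine Harm.abs_le_of_frontier isOpen_ball hbb (harm_evp hhlap _) (continuous_evp h).continuousOn
      (fun w hw => ?_) y (subset_closure hy)
    rw [frontier_ball _ (by norm_num)] at hw
    exact (hhsph w (hfrb hw)).1
  · have hFc : ContinuousOn F (closedBall 0 (3 / 4)) := hF.mono (closedBall_subset_closedBall (by norm_num))
    set O := {y : Eu n | y ∈ ball (0 : Eu n) (3 / 4) ∧ 0 < F y} with hO
    have hvO : Harm v O := hv.mono fun w hw => ⟨ball_subset_ball (by norm_num) hw.1, hw.2⟩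
    have hcl : closure O ⊆ closedBall 0 1 := fun w hw =>
      closedBall_subset_closedBall (by norm_num) (closure_cap_subset hFc hw).1
    refine Harm.abs_le_of_frontier (isOpen_cap hFc) (hbb.subset fun y hy => hy.1)
      (hvO.sub (harm_evp hhlap O)) ((hvc.mono hcl).sub (continuous_evp h).continuousOn)
      (fun w hw => ?_) y (subset_closure ⟨hy, hFy⟩)
    obtain ⟨hw1, hw2⟩ := mem_frontier_cap hFc hw
    rw [mem_closedBall, dist_zero_right] at hw1
    have hwb := hball w hw1
    rcases hw2 with hw2 | ⟨hw2, hw3⟩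
    · have h1 := hFη w (ball_subset_closedBall hwb)
      rw [hw2, zero_sub, abs_neg] at h1
      have h2 := hhall w hw1
      have h3 := hv0 w hwb hw2
      have h4 := abs_sub (v w) (evp h w)
      have h5 : 16 * ((n : ℝ) + 1) * |w i| ≤ 16 * (n + 1) * η := by gcongr
      have h6 : 0 ≤ (n : ℝ) * η := by positivity
      nlinarith
    · have h1 := hfv w hw1 hw2
      have h2 := hhf w (hfrb hw3)
      have h3 := abs_sub_le (v w) (f w) (evp h w)
      rw [abs_sub_comm (f w)] at h3
      have h6 : 0 ≤ (n : ℝ) * η := by positivity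
      nlinarith

theorem exists_corrected_poly [NeZero n] (i : Fin n) (m : ℕ) : ∃ η₀ N C₁ C₄ : ℝ, 0 < η₀ ∧ 0 ≤ N ∧ 0 ≤ C₁ ∧
    0 ≤ C₄ ∧ ∀ (h r : MvPolynomial (Fin n) ℝ) (η : ℝ), lapP h = 0 → MvPolynomial.X i ∣ h →
      (∀ y ∈ ball (0 : Eu n) (3 / 4), |evp h y| ≤ 2) → norm1 r ≤ η → η ≤ η₀ →
      ∃ q ∈ MvPolynomial.restrictTotalDegree (Fin n) ℝ (m + 1),
        lapP (tr (m + 3) ((MvPolynomial.X i + r) * q)) = 0 ∧ norm1 q ≤ N ∧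
        ∀ y : Eu n, ‖y‖ < 3 / 4 / 2 ^ (m + 3) →
          |evp h y - evp (tr (m + 3) ((MvPolynomial.X i + r) * q)) y| ≤ C₁ * ‖y‖ ^ (m + 3) + C₄ * η := by
  obtain ⟨η₀, K, hη₀, hK, hcorr⟩ := exists_correction i m
  obtain ⟨L, hL, hLb⟩ := exists_norm1_bound (m + 2)
    (lapP ∘ₗ (MvPolynomial.restrictTotalDegree (Fin n) ℝ (m + 2)).subtype)
  obtain ⟨Ch, hCh, hCb⟩ := norm1_tr_le_of_harmonic (n := n) (m + 3) (r := 3 / 4) (by norm_num)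
  obtain ⟨Ct, hCt, htay⟩ := exists_taylor_bound (n := n) (m + 3)
  set N := Ch * 2 with hN
  have hN0 : 0 ≤ N := by positivity
  refine ⟨min η₀ 1, N + K * (L * N), Ct * 2 * (4 / 3) ^ (m + 3), K * (L * N) + (N + K * (L * N)),
    lt_min hη₀ one_pos, by positivity, by positivity, by positivity,
    fun h r η hh hX hh2 hr hη => ?_⟩
  have hη0 : 0 ≤ η := (norm1_nonneg r).trans hr
  have hη1 : η ≤ 1 := hη.trans (min_le_right _ _)
  obtain ⟨qh, rfl⟩ := hX
  set q₀ := tr (m + 2) qh with hq₀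
  have hQ : tr (m + 3) (MvPolynomial.X i * qh) = MvPolynomial.X i * q₀ := tr_X_mul _ _ _
  have hq₀N : norm1 q₀ ≤ N := by
    rw [← norm1_X_mul i, ← hQ]; exact hCb _ 2 hh hh2
  have hq₀m : q₀ ∈ MvPolynomial.restrictTotalDegree (Fin n) ℝ (m + 1) := tr_mem _ _
  have htrQ : tr (m + 3) (MvPolynomial.X i * q₀) = MvPolynomial.X i * q₀ := tr_eq_self (X_mul_mem i hq₀m)
  have hlapQ : lapP (MvPolynomial.X i * q₀) = 0 := by rw [← hQ, lapP_tr, hh, map_zero]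
  have hs : lapP (tr (m + 3) ((MvPolynomial.X i + r) * q₀)) = lapP (tr (m + 3) (r * q₀)) := by
    rw [add_mul, map_add, map_add, htrQ, hlapQ, zero_add]
  have hsn : norm1 (lapP (tr (m + 3) ((MvPolynomial.X i + r) * q₀))) ≤ L * (η * N) := by
    rw [hs]
    refine (hLb ⟨_, tr_mem _ _⟩).trans (mul_le_mul_of_nonneg_left ?_ hL)
    refine (norm1_tr_le _ _).trans ((norm1_mul_le _ _).trans ?_)
    have := norm1_nonneg q₀
    gcongr
  obtain ⟨t, htm, ht, htn⟩ := hcorr r (hr.trans (hη.trans (min_le_left _ _)))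
    (lapP (tr (m + 3) ((MvPolynomial.X i + r) * q₀))) (lapP_mem (tr_mem _ _))
  have htn' : norm1 t ≤ K * (L * N) * η := by
    refine (htn.trans (mul_le_mul_of_nonneg_left hsn hK)).trans_eq (by ring)
  have hXt := X_mul_mem i htm
  have hqn : norm1 (q₀ - MvPolynomial.X i * t) ≤ N + K * (L * N) := by
    refine (norm1_sub_le _ _).trans (add_le_add hq₀N ?_)
    rw [norm1_X_mul]
    refine htn'.trans (mul_le_of_le_one_right (by positivity) hη1)
  refine ⟨q₀ - MvPolynomial.X i * t, Submodule.sub_mem _ hq₀m hXt, ?_, hqn, fun y hy => ?_⟩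
  · rw [mul_sub, map_sub, map_sub, ht, sub_self]
  · have h1 : MvPolynomial.X i * q₀ - tr (m + 3) ((MvPolynomial.X i + r) * (q₀ - MvPolynomial.X i * t)) =
        MvPolynomial.X i * (MvPolynomial.X i * t) - tr (m + 3) (r * (q₀ - MvPolynomial.X i * t)) := by
      rw [add_mul, map_add, mul_sub, map_sub, htrQ, tr_eq_self (X_mul_mem i hXt)]
      abel
    have h2 := htay _ (3 / 4) 2 hh (by norm_num) hh2 y hy
    rw [hQ, evp_sub] at h2
    have hy1 : ‖y‖ ≤ 1 := by
      have h4 : (1 : ℝ) ≤ 2 ^ (m + 3) := one_le_pow₀ (by norm_num)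
      have : (3 / 4 : ℝ) / 2 ^ (m + 3) ≤ 3 / 4 := div_le_self (by norm_num) h4
      linarith
    have h3 := abs_evp_le_norm1 (p := MvPolynomial.X i * q₀ -
      tr (m + 3) ((MvPolynomial.X i + r) * (q₀ - MvPolynomial.X i * t))) hy1
    have h4 : norm1 (MvPolynomial.X i * q₀ -
        tr (m + 3) ((MvPolynomial.X i + r) * (q₀ - MvPolynomial.X i * t))) ≤
        K * (L * N) * η + η * (N + K * (L * N)) := by
      rw [h1]
      refine (norm1_sub_le _ _).trans (add_le_add ?_ ?_)
      · rw [norm1_X_mul, norm1_X_mul]; exact htn'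
      · refine (norm1_tr_le _ _).trans ((norm1_mul_le _ _).trans ?_)
        have := norm1_nonneg (q₀ - MvPolynomial.X i * t)
        gcongr
    rw [evp_sub] at h3
    have h5 : Ct * 2 * (‖y‖ / (3 / 4)) ^ (m + 3) = Ct * 2 * (4 / 3) ^ (m + 3) * ‖y‖ ^ (m + 3) := by
      rw [div_eq_mul_inv, mul_pow]; norm_num; ring
    rw [h5] at h2
    have h6 := abs_sub_le (evp (MvPolynomial.X i * qh) y) (evp (MvPolynomial.X i * q₀) y)
      (evp (tr (m + 3) ((MvPolynomial.X i + r) * (q₀ - MvPolynomial.X i * t))) y)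
    calc _ ≤ _ := h6
      _ ≤ _ := add_le_add h2 (h3.trans h4)
      _ = _ := by ring

theorem exists_small_radius {ε C b : ℝ} (hε1 : ε < 1) (hb : 0 < b) :
    ∃ ρ : ℝ, 0 < ρ ∧ ρ < b ∧ C * ρ ^ (1 - ε) ≤ 1 / 2 := by
  have h1 : Tendsto (fun ρ : ℝ => C * ρ ^ (1 - ε)) (𝓝[>] 0) (𝓝 0) := by
    have : Tendsto (fun ρ : ℝ => C * ρ ^ (1 - ε)) (𝓝 0) (𝓝 (C * 0 ^ (1 - ε))) :=
      ((Real.continuous_rpow_const (by linarith)).tendsto 0).const_mul C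
    rw [Real.zero_rpow (by linarith), mul_zero] at this
    exact this.mono_left nhdsWithin_le_nhds
  have h2 := h1.eventually (ge_mem_nhds (by norm_num : (0 : ℝ) < 1 / 2))
  have h3 : ∀ᶠ ρ : ℝ in 𝓝[>] 0, ρ < b := nhdsWithin_le_nhds (Iio_mem_nhds hb)
  obtain ⟨ρ, ⟨h4, h5⟩, h6⟩ := ((h2.and h3).and self_mem_nhdsWithin).exists
  exact ⟨ρ, h6, h5, h4⟩

/-- One step of the iteration: the approximation is improved by the factor `ρ ^ (k + ε)` when the
scale shrinks by the factor `ρ`. -/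
theorem approx_step [NeZero n] (i : Fin n) (m : ℕ) {ε : ℝ} (hε : 0 < ε) (hε1 : ε < 1) :
    ∃ ρ N : ℝ, 0 < ρ ∧ ρ < 1 ∧ 0 ≤ N ∧ ∀ B : ℝ, 0 ≤ B → ∃ η : ℝ, 0 < η ∧ η ≤ 1 ∧
      ∀ (r : MvPolynomial (Fin n) ℝ) (F v : Eu n → ℝ), norm1 r ≤ η →
        ContinuousOn F (closedBall 0 1) → (∀ y ∈ closedBall (0 : Eu n) 1, |F y - y i| ≤ B * η) →
        ContinuousOn v (closedBall 0 1) → Harm v {y | y ∈ ball (0 : Eu n) 1 ∧ 0 < F y} →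
        (∀ y ∈ ball (0 : Eu n) 1, 0 < F y → |v y| ≤ 1) →
        (∀ y ∈ ball (0 : Eu n) 1, F y = 0 → |v y| ≤ B * η) →
        ∃ q ∈ MvPolynomial.restrictTotalDegree (Fin n) ℝ (m + 1),
          lapP (tr (m + 3) ((MvPolynomial.X i + r) * q)) = 0 ∧ norm1 q ≤ N ∧
          ∀ y ∈ ball (0 : Eu n) ρ, 0 < F y →
            |v y - evp (tr (m + 3) ((MvPolynomial.X i + r) * q)) y| ≤ ρ ^ (m + 2) * ρ ^ ε := by
  obtain ⟨η₀, N, C₁, C₄, hη₀, hN, hC₁, hC₄, hcp⟩ := exists_corrected_poly (n := n) i m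
  obtain ⟨ρ, hρ, hρb, hρC⟩ := exists_small_radius (C := C₁) (b := 3 / 4 / 2 ^ (m + 3)) hε1 (by positivity)
  have hρ34 : ρ < 3 / 4 := hρb.trans_le (div_le_self (by norm_num) (one_le_pow₀ (by norm_num)))
  refine ⟨ρ, N, hρ, by linarith, hN, fun B hB => ?_⟩
  set σ := ρ ^ (m + 2) * ρ ^ ε with hσ
  have hσ0 : 0 < σ := by positivity
  set C₂ : ℝ := (64 * (n + 1) + 4) * (B + 1) + C₄ with hC₂
  have hC₂0 : 0 < C₂ := by positivity
  have hηpos : 0 < min (min 1 η₀) (min (1 / (B + 1)) (σ / 2 / C₂)) := by positivity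
  set η := min (min 1 η₀) (min (1 / (B + 1)) (σ / 2 / C₂)) with hη
  have hη1 : η ≤ 1 := (min_le_left _ _).trans (min_le_left _ _)
  have hη2 : η ≤ η₀ := (min_le_left _ _).trans (min_le_right _ _)
  have hη3 : (B + 1) * η ≤ 1 := by
    have : η ≤ 1 / (B + 1) := (min_le_right _ _).trans (min_le_left _ _)
    rwa [le_div_iff₀ (by positivity), mul_comm] at this
  have hη4 : C₂ * η ≤ σ / 2 := by
    have : η ≤ σ / 2 / C₂ := (min_le_right _ _).trans (min_le_right _ _)
    rwa [le_div_iff₀ hC₂0, mul_comm] at this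
  refine ⟨η, hηpos, hη1, fun r F v hr hF hFη hvc hv hv1 hv0 => ?_⟩
  have hBη : B * η ≤ (B + 1) * η := by nlinarith
  obtain ⟨h, hh, hX, hh2, hvh⟩ := exists_odd_harmonic_near i (η := (B + 1) * η) (by positivity) hη3 hF
    (fun y hy => (hFη y hy).trans hBη) hvc hv hv1 (fun y hy hy0 => (hv0 y hy hy0).trans hBη)
  obtain ⟨q, hqm, hql, hqN, hqe⟩ := hcp h r η hh hX hh2 hr hη2
  refine ⟨q, hqm, hql, hqN, fun y hy hFy => ?_⟩
  rw [mem_ball, dist_zero_right] at hy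
  have h1 := hvh y (by rw [mem_ball, dist_zero_right]; linarith) hFy
  have h2 := hqe y (hy.trans hρb)
  have h3 := abs_sub_le (v y) (evp h y) (evp (tr (m + 3) ((MvPolynomial.X i + r) * q)) y)
  have h4 : C₁ * ‖y‖ ^ (m + 3) ≤ σ / 2 := by
    have h5 : ρ ^ (m + 3) = ρ ^ (m + 2) * ρ ^ ε * ρ ^ (1 - ε) := by
      rw [mul_assoc, ← Real.rpow_add hρ, add_sub_cancel, Real.rpow_one, pow_succ]
    calc C₁ * ‖y‖ ^ (m + 3) ≤ C₁ * ρ ^ (m + 3) := by gcongr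
      _ = σ * (C₁ * ρ ^ (1 - ε)) := by rw [h5]; ring
      _ ≤ σ * (1 / 2) := by gcongr
      _ = σ / 2 := by ring
  have h6 : (64 * ((n : ℝ) + 1) + 4) * ((B + 1) * η) + C₄ * η = C₂ * η := by rw [hC₂]; ring
  linarith

/-- Harmonic functions vanishing on a nearly flat boundary of class `C^{m+2,ε}` are approximated by
harmonic polynomials to order `m + 2 + ε` at the boundary point. -/
theorem exists_poly_approx [NeZero n] (i : Fin n) (m : ℕ) {ε : ℝ} (hε : 0 < ε) (hε1 : ε < 1) :
    ∃ ρ C η : ℝ, 0 < ρ ∧ ρ < 1 ∧ 0 ≤ C ∧ 0 < η ∧ ∀ (p : MvPolynomial (Fin n) ℝ) (F u : Eu n → ℝ),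
      norm1 p ≤ η → (∀ d : Fin n →₀ ℕ, d.degree < 2 → p.coeff d = 0) →
      ContinuousOn F (closedBall 0 1) →
      (∀ y ∈ closedBall (0 : Eu n) 1, |F y - (y i + evp p y)| ≤ η * ‖y‖ ^ (m + 2) * ‖y‖ ^ ε) →
      ContinuousOn u (closedBall 0 1) → Harm u {y | y ∈ ball (0 : Eu n) 1 ∧ 0 < F y} →
      (∀ y ∈ ball (0 : Eu n) 1, 0 < F y → |u y| ≤ 1) →
      (∀ y ∈ ball (0 : Eu n) 1, F y = 0 → u y = 0) →
      ∀ j : ℕ, ∃ P : MvPolynomial (Fin n) ℝ, lapP P = 0 ∧ norm1 P ≤ C ∧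
        ∀ y ∈ ball (0 : Eu n) (ρ ^ j), 0 < F y → |u y - evp P y| ≤ (ρ ^ j) ^ (m + 2) * (ρ ^ j) ^ ε := by
  obtain ⟨ρ, N, hρ, hρ1, hN, hstep⟩ := approx_step (n := n) i m hε hε1
  set θ := ρ ^ ε with hθ
  have hθ0 : 0 < θ := by positivity
  have hθ1 : θ < 1 := Real.rpow_lt_one hρ.le hρ1 hε
  set B := N / (1 - θ) with hB
  have hB0 : 0 ≤ B := div_nonneg hN (by linarith)
  have hBN : B * (1 - θ) = N := div_mul_cancel₀ _ (by linarith)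
  obtain ⟨η, hη, hη1, hst⟩ := hstep (2 * B + 2) (by positivity)
  refine ⟨ρ, 2 * B, η, hρ, hρ1, by positivity, hη, fun p F u hp hpd hF hFp huc hu hu1 hu0 => ?_⟩
  suffices H : ∀ j : ℕ, ∃ q ∈ MvPolynomial.restrictTotalDegree (Fin n) ℝ (m + 1),
      lapP (tr (m + 3) ((MvPolynomial.X i + p) * q)) = 0 ∧ norm1 q ≤ B * (1 - θ ^ j) ∧
      ∀ y ∈ ball (0 : Eu n) (ρ ^ j), 0 < F y →
        |u y - evp (tr (m + 3) ((MvPolynomial.X i + p) * q)) y| ≤ (ρ ^ j) ^ (m + 2) * θ ^ j by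
    intro j
    obtain ⟨q, hqm, hql, hqN, hqe⟩ := H j
    have hsj : (ρ ^ j) ^ ε = θ ^ j := by
      rw [hθ, ← Real.rpow_natCast, ← Real.rpow_mul hρ.le, ← Real.rpow_natCast, ← Real.rpow_mul hρ.le, mul_comm]
    refine ⟨_, hql, ?_, fun y hy hFy => by rw [hsj]; exact hqe y hy hFy⟩
    refine (norm1_tr_le _ _).trans ((norm1_mul_le _ _).trans ?_)
    have h1 : norm1 (MvPolynomial.X i + p) ≤ 2 := by
      refine (norm1_add_le _ _).trans ?_
      rw [norm1_X]; linarith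
    have h2 : norm1 q ≤ B := hqN.trans (mul_le_of_le_one_right hB0 (by linarith [pow_pos hθ0 j]))
    exact mul_le_mul h1 h2 (norm1_nonneg _) (by norm_num)
  intro j
  induction j with
  | zero =>
    refine ⟨0, Submodule.zero_mem _, by simp, by simp, fun y hy hFy => ?_⟩
    simpa using hu1 y (by simpa using hy) hFy
  | succ j ih =>
    obtain ⟨q, hqm, hql, hqN, hqe⟩ := ih
    set s := ρ ^ j with hs
    have hs0 : 0 < s := by positivity
    have hs1 : s ≤ 1 := pow_le_one₀ hρ.le hρ1.le
    have hsε : s ^ ε = θ ^ j := by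
      rw [hs, hθ, ← Real.rpow_natCast, ← Real.rpow_mul hρ.le, ← Real.rpow_natCast, ← Real.rpow_mul hρ.le, mul_comm]
    have hqB : norm1 q ≤ B := hqN.trans (mul_le_of_le_one_right hB0 (by linarith [pow_pos hθ0 j]))
    set P := tr (m + 3) ((MvPolynomial.X i + p) * q) with hP
    set τ := s ^ (m + 2) * θ ^ j with hτ
    have hτ0 : 0 < τ := by positivity
    set r := s⁻¹ • scl s p with hr
    set v : Eu n → ℝ := fun y => τ⁻¹ * (u (0 + s • y) - evp P (0 + s • y)) with hv
    set F' : Eu n → ℝ := fun y => s⁻¹ * F (s • y) with hF'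
    have hrn : norm1 r ≤ η := by
      rw [hr, norm1_smul, abs_of_pos (inv_pos.2 hs0)]
      have h1 : norm1 (scl s p) ≤ s * norm1 p := norm1_scl_le fun d hd => by
        rw [abs_of_pos hs0]
        refine (pow_le_pow_of_le_one hs0.le hs1 (?_ : 1 ≤ d.degree)).trans_eq (pow_one s)
        by_contra! h
        exact hd (hpd d (by omega))
      calc s⁻¹ * norm1 (scl s p) ≤ s⁻¹ * (s * norm1 p) := by gcongr
        _ = norm1 p := by field_simp
        _ ≤ η := hp
    have hmaps : ∀ y ∈ closedBall (0 : Eu n) 1, s • y ∈ closedBall (0 : Eu n) 1 := fun y hy => by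
      rw [mem_closedBall, dist_zero_right] at *
      rw [norm_smul, norm_eq_abs, abs_of_pos hs0]
      exact mul_le_one₀ hs1 (norm_nonneg _) hy
    have hmapb : ∀ y ∈ ball (0 : Eu n) 1, s • y ∈ ball (0 : Eu n) s := fun y hy => by
      rw [mem_ball, dist_zero_right] at *
      rw [norm_smul, norm_eq_abs, abs_of_pos hs0]
      exact mul_lt_of_lt_one_right hs0 hy
    have hbs : ball (0 : Eu n) s ⊆ ball 0 1 := ball_subset_ball hs1
    have hF'0 : ∀ y, 0 < F' y ↔ 0 < F (s • y) := fun y => by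
      rw [hF', mul_pos_iff_of_pos_left (inv_pos.2 hs0)]
    have hF'c : ContinuousOn F' (closedBall 0 1) :=
      continuousOn_const.mul (hF.comp (by fun_prop) hmaps)
    have hF'y : ∀ y ∈ closedBall (0 : Eu n) 1, |F' y - y i| ≤ (2 * B + 2) * η := by
      intro y hy
      have hyn : ‖y‖ ≤ 1 := by simpa using hy
      have hsn : ‖s • y‖ = s * ‖y‖ := by rw [norm_smul, norm_eq_abs, abs_of_pos hs0]
      have hsns : ‖s • y‖ ≤ s := by rw [hsn]; exact mul_le_of_le_one_right hs0.le hyn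
      have h1 := hFp _ (hmaps y hy)
      have h2 : |evp p (s • y)| ≤ η * s := by
        refine (abs_evp_le (hsns.trans hs1) hpd).trans ?_
        have : ‖s • y‖ ^ 2 ≤ s := by
          calc ‖s • y‖ ^ 2 ≤ s ^ 2 := by gcongr
            _ ≤ s := by nlinarith
        have := norm1_nonneg p
        gcongr
      have h3 : η * ‖s • y‖ ^ (m + 2) * ‖s • y‖ ^ ε ≤ η * s := by
        have h4 : ‖s • y‖ ^ ε ≤ 1 := Real.rpow_le_one (norm_nonneg _) (hsns.trans hs1) hε.le
        have h5 : ‖s • y‖ ^ (m + 2) ≤ s := by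
          calc ‖s • y‖ ^ (m + 2) ≤ s ^ (m + 2) := by gcongr
            _ ≤ s ^ 1 := pow_le_pow_of_le_one hs0.le hs1 (by omega)
            _ = s := pow_one s
        calc η * ‖s • y‖ ^ (m + 2) * ‖s • y‖ ^ ε ≤ η * s * 1 := by gcongr
          _ = η * s := mul_one _
      have h6 : F' y - y i = s⁻¹ * (F (s • y) - ((s • y) i + evp p (s • y)) + evp p (s • y)) := by
        simp only [hF', PiLp.smul_apply, smul_eq_mul]; field_simp; ring
      rw [h6, abs_mul, abs_of_pos (inv_pos.2 hs0)]
      have h7 := abs_add_le (F (s • y) - ((s • y) i + evp p (s • y))) (evp p (s • y))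
      calc s⁻¹ * |F (s • y) - ((s • y) i + evp p (s • y)) + evp p (s • y)| ≤ s⁻¹ * (2 * η * s) := by
            gcongr; linarith
        _ = 2 * η := by field_simp
        _ ≤ (2 * B + 2) * η := by nlinarith
    have hvc : ContinuousOn v (closedBall 0 1) := by
      refine continuousOn_const.mul (ContinuousOn.sub ?_ ?_)
      · exact huc.comp (by fun_prop) fun y hy => by rw [zero_add]; exact hmaps y hy
      · exact ((continuous_evp P).comp (by fun_prop)).continuousOn
    have hvH : Harm v {y | y ∈ ball (0 : Eu n) 1 ∧ 0 < F' y} := by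
      have h1 : Harm (fun y => u y - evp P y) {y | y ∈ ball (0 : Eu n) 1 ∧ 0 < F y} := hu.sub (harm_evp hql _)
      refine ((h1.comp_affine 0 hs0).const_mul τ⁻¹).mono fun y hy => ?_
      rw [mem_ofPred_eq, zero_add]
      exact ⟨hbs (hmapb y hy.1), (hF'0 y).1 hy.2⟩
    have hv1 : ∀ y ∈ ball (0 : Eu n) 1, 0 < F' y → |v y| ≤ 1 := by
      intro y hy hFy
      simp only [hv, zero_add]
      rw [abs_mul, abs_of_pos (inv_pos.2 hτ0), inv_mul_le_iff₀ hτ0, mul_one]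
      exact hqe _ (hmapb y hy) ((hF'0 y).1 hFy)
    have hv0 : ∀ y ∈ ball (0 : Eu n) 1, F' y = 0 → |v y| ≤ (2 * B + 2) * η := by
      intro y hy hFy
      have hFy' : F (s • y) = 0 := by
        simp only [hF'] at hFy
        exact (mul_eq_zero.1 hFy).resolve_left (inv_ne_zero hs0.ne')
      have hsb := hmapb y hy
      have hsn : ‖s • y‖ ≤ s := by rw [mem_ball, dist_zero_right] at hsb; exact hsb.le
      have h1 : |(s • y) i + evp p (s • y)| ≤ η * τ := by
        have := hFp _ (ball_subset_closedBall (hbs hsb))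
        rw [hFy', zero_sub, abs_neg] at this
        refine this.trans ?_
        rw [hτ, ← hsε, ← mul_assoc]
        gcongr
      have h2 : (MvPolynomial.X i + p) * q - P = p * q - tr (m + 3) (p * q) := by
        rw [hP, add_mul, map_add, tr_eq_self (X_mul_mem i hqm)]; abel
      have h3 : |evp (p * q - tr (m + 3) (p * q)) (s • y)| ≤ η * B * τ := by
        refine (abs_evp_le (m := m + 3) (hsn.trans hs1) fun d hd => coeff_sub_tr _ hd).trans ?_
        have h4 : norm1 (p * q - tr (m + 3) (p * q)) ≤ η * B :=
          (norm1_sub_tr_le _ _).trans ((norm1_mul_le _ _).trans (mul_le_mul hp hqB (norm1_nonneg _) hη.le))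
        have h5 : ‖s • y‖ ^ (m + 3) ≤ τ := by
          have h6 : s ≤ s ^ ε := by
            simpa using Real.rpow_le_rpow_of_exponent_ge hs0 hs1 hε1.le
          calc ‖s • y‖ ^ (m + 3) ≤ s ^ (m + 3) := by gcongr
            _ = s ^ (m + 2) * s := pow_succ _ _
            _ ≤ s ^ (m + 2) * s ^ ε := by gcongr
            _ = τ := by rw [hsε]
        gcongr
      have h4 : |evp ((MvPolynomial.X i + p) * q) (s • y)| ≤ η * τ * B := by
        rw [evp_mul, evp_add, evp_X, abs_mul]
        exact mul_le_mul h1 ((abs_evp_le_norm1 (hsn.trans hs1)).trans hqB) (abs_nonneg _) (by positivity)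
      have h5 : evp P (s • y) = evp ((MvPolynomial.X i + p) * q) (s • y) -
          evp (p * q - tr (m + 3) (p * q)) (s • y) := by
        rw [← h2, evp_sub]; ring
      simp only [hv, zero_add]
      rw [hu0 _ (hbs hsb) hFy', zero_sub, abs_mul, abs_of_pos (inv_pos.2 hτ0), inv_mul_le_iff₀ hτ0, abs_neg, h5]
      refine (abs_sub _ _).trans ?_
      nlinarith [mul_nonneg hη.le hτ0.le]
    obtain ⟨q', hq'm, hq'l, hq'N, hq'e⟩ := hst r F' v hrn hF'c hF'y hvc hvH hv1 hv0
    set a := τ * s⁻¹ with ha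
    have ha0 : 0 < a := by positivity
    have hsq : scl s⁻¹ q' ∈ MvPolynomial.restrictTotalDegree (Fin n) ℝ (m + 1) := by
      rw [mem_restrictTotalDegree_iff] at *
      intro d hd
      rw [coeff_scl, hq'm d hd, mul_zero]
    have hXp : scl s⁻¹ (MvPolynomial.X i + r) = s⁻¹ • (MvPolynomial.X i + p) := by
      have h1 : scl s⁻¹ (scl s p) = p := by
        ext d
        rw [coeff_scl, coeff_scl, ← mul_assoc, ← mul_pow, inv_mul_cancel₀ hs0.ne', one_pow, one_mul]
      rw [map_add, hr, map_smul, h1, smul_add]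
      simp [scl]
    have hPnew : tr (m + 3) ((MvPolynomial.X i + p) * (q + a • scl s⁻¹ q')) =
        P + τ • scl s⁻¹ (tr (m + 3) ((MvPolynomial.X i + r) * q')) := by
      rw [← tr_scl, map_mul (scl s⁻¹), hXp, mul_add, map_add, smul_mul_assoc, mul_smul_comm, map_smul, map_smul,
        smul_smul, hP]
    refine ⟨q + a • scl s⁻¹ q', Submodule.add_mem _ hqm (Submodule.smul_mem _ _ hsq), ?_, ?_, ?_⟩
    · rw [hPnew, map_add, hql, map_smul, lapP_scl, hq'l]; simp
    · refine (norm1_add_le _ _).trans ?_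
      have h1 : norm1 (scl s⁻¹ q') ≤ (s⁻¹) ^ (m + 1) * norm1 q' := norm1_scl_le fun d hd => by
        rw [abs_of_pos (inv_pos.2 hs0)]
        refine pow_le_pow_right₀ ((one_le_inv₀ hs0).2 hs1) ?_
        by_contra! hlt
        exact hd (mem_restrictTotalDegree_iff.1 hq'm d hlt)
      have h2 : norm1 (a • scl s⁻¹ q') ≤ θ ^ j * N := by
        rw [norm1_smul, abs_of_pos ha0]
        calc a * norm1 (scl s⁻¹ q') ≤ a * ((s⁻¹) ^ (m + 1) * N) := by gcongr; exact h1.trans (by gcongr)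
          _ = θ ^ j * N := by
              rw [ha, hτ, inv_pow]; field_simp; ring
      calc norm1 q + norm1 (a • scl s⁻¹ q') ≤ B * (1 - θ ^ j) + θ ^ j * N := add_le_add hqN h2
        _ = B * (1 - θ ^ (j + 1)) := by rw [← hBN]; ring
    · intro y hy hFy
      rw [hPnew, evp_add, evp_smul, evp_scl]
      have hsy : s • (s⁻¹ • y) = y := by rw [smul_smul, mul_inv_cancel₀ hs0.ne', one_smul]
      have h1 := hq'e (s⁻¹ • y) (by
        rw [mem_ball, dist_zero_right] at *
        rw [norm_smul, norm_eq_abs, abs_of_pos (inv_pos.2 hs0), inv_mul_lt_iff₀ hs0, hs, ← pow_succ]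
        exact hy) ((hF'0 _).2 (by rwa [hsy]))
      simp only [hv, zero_add, hsy] at h1
      have h2 : u y - (evp P y + τ * evp (tr (m + 3) ((MvPolynomial.X i + r) * q')) (s⁻¹ • y)) =
          τ * (τ⁻¹ * (u y - evp P y) - evp (tr (m + 3) ((MvPolynomial.X i + r) * q')) (s⁻¹ • y)) := by
        rw [mul_sub, ← mul_assoc, mul_inv_cancel₀ hτ0.ne']; ring
      rw [h2, abs_mul, abs_of_pos hτ0]
      calc τ * _ ≤ τ * (ρ ^ (m + 2) * θ) := by gcongr
        _ = _ := by rw [hτ, hs, hθ]; ring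

/-- Harmonic approximation to optimal order near a boundary point, in normalized coordinates. -/
theorem exists_harmonic_approx [NeZero n] (i : Fin n) (m : ℕ) {ε : ℝ} (hε : 0 < ε) (hε1 : ε < 1) :
    ∃ C η : ℝ, 0 ≤ C ∧ 0 < η ∧ ∀ (p : MvPolynomial (Fin n) ℝ) (F u : Eu n → ℝ),
      norm1 p ≤ η → (∀ d : Fin n →₀ ℕ, d.degree < 2 → p.coeff d = 0) →
      ContinuousOn F (closedBall 0 1) →
      (∀ y ∈ closedBall (0 : Eu n) 1, |F y - (y i + evp p y)| ≤ η * ‖y‖ ^ (m + 2) * ‖y‖ ^ ε) →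
      ContinuousOn u (closedBall 0 1) → Harm u {y | y ∈ ball (0 : Eu n) 1 ∧ 0 < F y} →
      (∀ y ∈ ball (0 : Eu n) 1, 0 < F y → |u y| ≤ 1) →
      (∀ y ∈ ball (0 : Eu n) 1, F y = 0 → u y = 0) →
      ∀ z : Eu n, z ≠ 0 → ‖z‖ < 1 / 2 → (∀ y ∈ ball z ‖z‖, 0 < F y) →
        ∃ P : MvPolynomial (Fin n) ℝ, lapP P = 0 ∧ (∀ y ∈ ball (0 : Eu n) 1, |evp P y| ≤ C) ∧
          ∀ y ∈ ball z ‖z‖, |u y - evp P y| ≤ C * ‖z‖ ^ (m + 2) := by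
  obtain ⟨ρ, C, η, hρ, hρ1, hC, hη, h⟩ := exists_poly_approx i m hε hε1
  refine ⟨C + (2 / ρ) ^ (m + 2), η, by positivity, hη, ?_⟩
  intro p F u h1 h2 h3 h4 h5 h6 h7 h8 z hz hz1 hzF
  have hz0 : 0 < ‖z‖ := norm_pos_iff.2 hz
  obtain ⟨j, hj, hj'⟩ := exists_nat_pow_near_of_lt_one (x := 2 * ‖z‖) (by positivity) (by linarith) hρ hρ1
  obtain ⟨P, hP, hPC, hPu⟩ := h p F u h1 h2 h3 h4 h5 h6 h7 h8 j
  have hK : 0 ≤ (2 / ρ) ^ (m + 2) := by positivity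
  refine ⟨P, hP, fun y hy => ?_, fun y hy => ?_⟩
  · rw [mem_ball, dist_zero_right] at hy
    have := abs_evp_le_norm1 (p := P) hy.le
    linarith
  · have hy2 : ‖y‖ < ρ ^ j := by
      rw [mem_ball, dist_eq_norm] at hy
      have := norm_le_norm_add_norm_sub' y z
      linarith
    refine (hPu y (by rwa [mem_ball, dist_zero_right]) (hzF y hy)).trans ?_
    have hj1 : (ρ ^ j) ^ ε ≤ 1 := rpow_le_one (by positivity) (pow_le_one₀ hρ.le hρ1.le) hε.le
    have hj2 : ρ ^ j ≤ 2 / ρ * ‖z‖ := by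
      rw [pow_succ] at hj
      rw [div_mul_eq_mul_div, le_div_iff₀ hρ]; exact hj.le
    calc (ρ ^ j) ^ (m + 2) * (ρ ^ j) ^ ε ≤ (2 / ρ * ‖z‖) ^ (m + 2) * 1 := by gcongr
      _ = (2 / ρ) ^ (m + 2) * ‖z‖ ^ (m + 2) := by rw [mul_one, mul_pow]
      _ ≤ _ := by gcongr; linarith

theorem lapl_eq_laplacian {u : Eu n → ℝ} {x : Eu n} (hu : ContDiffAt ℝ 2 u x) :
    lapl u x = Laplacian.laplacian u x := by
  rw [InnerProductSpace.laplacian_eq_iteratedFDeriv_orthonormalBasis u (EuclideanSpace.basisFun (Fin n) ℝ)]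
  refine Finset.sum_congr rfl fun i _ => ?_
  rw [iteratedFDeriv_two_apply]
  have h1 : DifferentiableAt ℝ (fderiv ℝ u) x :=
    (hu.fderiv_right (m := 1) (by norm_num)).differentiableAt (by norm_num)
  simp only [pd2, pd, Matrix.cons_val_zero, Matrix.cons_val_one, EuclideanSpace.basisFun_apply]
  have h2 : HasFDerivAt (fun z => fderiv ℝ u z (EuclideanSpace.single i 1))
      ((ContinuousLinearMap.apply ℝ ℝ (EuclideanSpace.single i 1 : Eu n)).comp (fderiv ℝ (fderiv ℝ u) x)) x :=
    (ContinuousLinearMap.apply ℝ ℝ (EuclideanSpace.single i 1 : Eu n)).hasFDerivAt.comp x h1.hasFDerivAt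
  rw [h2.fderiv]; rfl

theorem laplacian_comp_isometry (u : Eu n → ℝ) (R : Eu n ≃ₗᵢ[ℝ] Eu n) (x : Eu n) :
    Laplacian.laplacian (fun y => u (R y)) x = Laplacian.laplacian u (R x) := by
  rw [InnerProductSpace.laplacian_eq_iteratedFDeriv_orthonormalBasis _ (EuclideanSpace.basisFun (Fin n) ℝ),
    InnerProductSpace.laplacian_eq_iteratedFDeriv_orthonormalBasis u
      ((EuclideanSpace.basisFun (Fin n) ℝ).map R)]
  refine Finset.sum_congr rfl fun i _ => ?_
  have := R.toContinuousLinearEquiv.iteratedFDerivWithin_comp_right u uniqueDiffOn_univ (mem_univ (R x)) 2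
  rw [preimage_univ, iteratedFDerivWithin_univ, iteratedFDerivWithin_univ] at this
  have h2 : (fun y => u (R y)) = u ∘ R.toContinuousLinearEquiv := rfl
  rw [h2, this]
  simp only [ContinuousMultilinearMap.compContinuousLinearMap_apply]
  congr 1
  ext j; fin_cases j <;> simp

/-- Harmonicity is invariant under linear isometries. -/
theorem Harm.comp_isometry [NeZero n] {u : Eu n → ℝ} {O : Set (Eu n)} (hO : IsOpen O) (hu : Harm u O)
    (R : Eu n ≃ₗᵢ[ℝ] Eu n) : Harm (fun y => u (R y)) {y | R y ∈ O} := by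
  have hO' : IsOpen {y | R y ∈ O} := hO.preimage R.continuous
  have h1 := hu.isHarmonicOn hO
  have h2 : ContDiffOn ℝ 2 (fun y => u (R y)) {y | R y ∈ O} :=
    h1.1.comp R.contDiff.contDiffOn fun y hy => hy
  refine IsHarmonicOn.harm hO' ⟨h2, fun x hx => ?_⟩
  rw [lapl_eq_laplacian (h2.contDiffAt (hO'.mem_nhds hx)), laplacian_comp_isometry,
    ← lapl_eq_laplacian (h1.1.contDiffAt (hO.mem_nhds hx))]
  exact h1.2 _ hx

theorem exists_isometry_apply_eq (i : Fin n) {e : Eu n} (he : ‖e‖ = 1) :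
    ∃ R : Eu n ≃ₗᵢ[ℝ] Eu n, R (eb i) = e :=
  ⟨Submodule.reflection (ℝ ∙ (eb i - e))ᗮ, Submodule.reflection_sub (by rw [he]; simp)⟩

theorem pd_norm_sq_rpow (s : ℝ) (i : Fin n) {x : Eu n} (hx : x ≠ 0) :
    pd i (fun y : Eu n => (‖y‖ ^ 2) ^ s) x = 2 * s * ((‖x‖ ^ 2) ^ (s - 1) * x i) := by
  have h0 : ‖x‖ ^ 2 ≠ 0 := pow_ne_zero 2 (norm_ne_zero_iff.2 hx)
  have h1 : HasFDerivAt (fun y : Eu n => ‖y‖ ^ 2) (2 • innerSL ℝ x) x := (hasStrictFDerivAt_norm_sq x).hasFDerivAt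
  have h2 := h1.rpow_const (p := s) (Or.inl h0)
  rw [pd, h2.fderiv]
  simp [PiLp.inner_apply]
  ring

theorem contDiffAt_norm_sq_rpow (s : ℝ) {x : Eu n} (hx : x ≠ 0) (m : WithTop ℕ∞) :
    ContDiffAt ℝ m (fun y : Eu n => (‖y‖ ^ 2) ^ s) x :=
  ContDiffAt.rpow_const_of_ne (contDiff_norm_sq ℝ).contDiffAt (pow_ne_zero 2 (norm_ne_zero_iff.2 hx))

theorem pd2_norm_sq_rpow (s : ℝ) (i : Fin n) {x : Eu n} (hx : x ≠ 0) :
    pd2 i i (fun y : Eu n => (‖y‖ ^ 2) ^ s) x =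
      2 * s * (2 * (s - 1) * (‖x‖ ^ 2) ^ (s - 2) * x i ^ 2 + (‖x‖ ^ 2) ^ (s - 1)) := by
  have h1 : (fun z => pd i (fun y : Eu n => (‖y‖ ^ 2) ^ s) z) =ᶠ[𝓝 x]
      fun z => (2 * s) * ((‖z‖ ^ 2) ^ (s - 1) * z i) := by
    filter_upwards [isOpen_ne.mem_nhds hx] with z hz using pd_norm_sq_rpow s i hz
  have h2 : DifferentiableAt ℝ (fun y : Eu n => (‖y‖ ^ 2) ^ (s - 1)) x :=
    (contDiffAt_norm_sq_rpow (s - 1) hx 1).differentiableAt (by norm_num)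
  have h3 : HasFDerivAt (fun y : Eu n => y i) (EuclideanSpace.proj i : Eu n →L[ℝ] ℝ) x :=
    (EuclideanSpace.proj i : Eu n →L[ℝ] ℝ).hasFDerivAt
  have h4 : HasFDerivAt (fun z : Eu n => 2 * s * ((‖z‖ ^ 2) ^ (s - 1) * z i)) _ x :=
    (h2.hasFDerivAt.mul h3).const_mul (2 * s)
  rw [pd2, pd, h1.fderiv_eq, h4.fderiv]
  have h5 := pd_norm_sq_rpow (s - 1) i hx
  rw [pd] at h5
  simp only [add_apply, smul_apply, smul_eq_mul, h5]
  have h6 : (EuclideanSpace.proj i : Eu n →L[ℝ] ℝ) (EuclideanSpace.single i 1) = 1 := by simp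
  rw [show s - 1 - 1 = s - 2 by ring, h6]
  ring

theorem lapl_norm_sq_rpow {x : Eu n} (hx : x ≠ 0) :
    lapl (fun y : Eu n => (‖y‖ ^ 2) ^ ((2 - (n : ℝ)) / 2)) x = 0 := by
  rw [lapl, Finset.sum_congr rfl fun i _ => pd2_norm_sq_rpow _ i hx, ← Finset.mul_sum,
    Finset.sum_add_distrib, ← Finset.mul_sum]
  have h0 : 0 < ‖x‖ ^ 2 := pow_pos (norm_pos_iff.2 hx) 2
  have h1 : ∑ i, x i ^ 2 = ‖x‖ ^ 2 := by rw [EuclideanSpace.norm_sq_eq]; simp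
  set s := (2 - (n : ℝ)) / 2 with hs
  have h2 : (‖x‖ ^ 2) ^ (s - 2) * ‖x‖ ^ 2 = (‖x‖ ^ 2) ^ (s - 1) := by
    nth_rewrite 2 [← rpow_one (‖x‖ ^ 2)]
    rw [← rpow_add h0]; congr 1; ring
  rw [h1, mul_assoc (2 * (s - 1)), h2]
  simp only [Finset.sum_const, Finset.card_univ, Fintype.card_fin, nsmul_eq_mul]
  have : (n : ℝ) = 2 - 2 * s := by rw [hs]; ring
  rw [this]; ring

/-- The constant of the fundamental solution. -/
def fundConst (n : ℕ) : ℝ := ((n : ℝ) - 2)⁻¹ * (sphereArea n)⁻¹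

theorem fundConst_pos (hn : 2 < n) : 0 < fundConst n := by
  have h0 : (2 : ℝ) < n := by exact_mod_cast hn
  have h1 : 0 < (volume (Metric.ball (0 : Eu n) 1)).toReal :=
    ENNReal.toReal_pos (Metric.measure_ball_pos volume 0 one_pos).ne' measure_ball_lt_top.ne
  have h2 : 0 < sphereArea n := mul_pos (by linarith) h1
  exact mul_pos (inv_pos.2 (by linarith)) (inv_pos.2 h2)

theorem fundSol_eq (hn : 2 < n) (x : Eu n) : fundSol n x = -(fundConst n / ‖x‖ ^ (n - 2)) := by
  rw [fundSol, fundConst, div_eq_mul_inv, ← rpow_natCast, ← rpow_neg (norm_nonneg _), Nat.cast_sub hn.le]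
  congr 3; push_cast; ring

theorem fundSol_neg (x : Eu n) : fundSol n (-x) = fundSol n x := by
  rw [fundSol, fundSol, norm_neg]

theorem fundSol_nonpos (hn : 2 < n) (x : Eu n) : fundSol n x ≤ 0 := by
  have := (fundConst_pos hn).le
  rw [fundSol_eq hn, neg_nonpos]; positivity

theorem fundSol_le (hn : 2 < n) {x : Eu n} {r : ℝ} (hx : 0 < ‖x‖) (hr : ‖x‖ ≤ r) :
    fundSol n x ≤ -(fundConst n / r ^ (n - 2)) := by
  have := (fundConst_pos hn).le
  rw [fundSol_eq hn]; gcongr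

theorem neg_le_fundSol (hn : 2 < n) {x : Eu n} {r : ℝ} (hr0 : 0 < r) (hr : r ≤ ‖x‖) :
    -(fundConst n / r ^ (n - 2)) ≤ fundSol n x := by
  have := (fundConst_pos hn).le
  rw [fundSol_eq hn]; gcongr

theorem harm_fundSol : Harm (fundSol n) {0}ᶜ := by
  have h1 : Harm (fun y : Eu n => (‖y‖ ^ 2) ^ ((2 - (n : ℝ)) / 2)) {0}ᶜ :=
    IsHarmonicOn.harm isOpen_compl_singleton
      ⟨fun x hx => (contDiffAt_norm_sq_rpow _ hx 2).contDiffWithinAt, fun x hx => lapl_norm_sq_rpow hx⟩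
  refine (h1.const_mul (-(((n : ℝ) - 2)⁻¹ * (sphereArea n)⁻¹))).congr isOpen_compl_singleton
    fun x _ => ?_
  rw [fundSol, ← rpow_natCast ‖x‖ 2, ← rpow_mul (norm_nonneg _)]
  rw [show ((2 : ℕ) : ℝ) * ((2 - (n : ℝ)) / 2) = 2 - n by push_cast; ring]
  ring

theorem continuousAt_fundSol {x : Eu n} (hx : x ≠ 0) : ContinuousAt (fundSol n) x :=
  harm_fundSol.1.continuousAt (isOpen_compl_singleton.mem_nhds hx)

theorem Harm.comp_sub {u : Eu n → ℝ} {O : Set (Eu n)} (hu : Harm u O) (z : Eu n) :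
    Harm (fun x => u (x - z)) {x | x - z ∈ O} := by
  have := hu.comp_affine (-z) one_pos
  simpa only [one_smul, neg_add_eq_sub] using this

theorem harm_fundSol_sub (z : Eu n) : Harm (fun x => fundSol n (x - z)) {z}ᶜ :=
  (harm_fundSol.comp_sub z).mono fun x hx => by
    simpa [sub_eq_zero] using hx

theorem fundSol_sub_comm (x z : Eu n) : fundSol n (x - z) = fundSol n (z - x) := by
  rw [← fundSol_neg, neg_sub]

theorem harm_fundSol_sub' (x : Eu n) : Harm (fun z => fundSol n (x - z)) {x}ᶜ := by
  simpa only [fundSol_sub_comm x] using harm_fundSol_sub x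

theorem pdMulti_congr {O : Set (Eu n)} (hO : IsOpen O) {u v : Eu n → ℝ} (h : ∀ y ∈ O, u y = v y)
    (L : List (Fin n)) : ∀ y ∈ O, pdMulti L u y = pdMulti L v y := by
  induction L with
  | nil => exact h
  | cons i L ih =>
    intro y hy
    have h1 : pdMulti L u =ᶠ[𝓝 y] pdMulti L v := by
      filter_upwards [hO.mem_nhds hy] with z hz using ih z hz
    change pd i (pdMulti L u) y = pd i (pdMulti L v) y
    rw [pd, pd, h1.fderiv_eq]

theorem pdMulti_sub [NeZero n] {O : Set (Eu n)} (hO : IsOpen O) {u v : Eu n → ℝ} (hu : Harm u O)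
    (hv : Harm v O) (L : List (Fin n)) :
    ∀ y ∈ O, pdMulti L (fun y => u y - v y) y = pdMulti L u y - pdMulti L v y := by
  induction L with
  | nil => exact fun y _ => rfl
  | cons i L ih =>
    intro y hy
    have h1 : pdMulti L (fun y => u y - v y) =ᶠ[𝓝 y] pdMulti L u - pdMulti L v := by
      filter_upwards [hO.mem_nhds hy] with z hz using ih z hz
    change pd i (pdMulti L _) y = pd i (pdMulti L u) y - pd i (pdMulti L v) y
    rw [pd, pd, pd, h1.fderiv_eq, fderiv_sub ((hu.pdMulti hO L).differentiableAt hO hy)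
      ((hv.pdMulti hO L).differentiableAt hO hy)]
    rfl

theorem hasDerivAt_line {u : Eu n → ℝ} {c : Eu n} {i : Fin n} {t : ℝ}
    (h : DifferentiableAt ℝ u (c + t • eb i)) :
    HasDerivAt (fun t : ℝ => u (c + t • eb i)) (pd i u (c + t • eb i)) t := by
  have h1 : HasDerivAt (fun t : ℝ => c + t • (eb i : Eu n)) (eb i) t := by
    simpa using ((hasDerivAt_id t).smul_const (eb i : Eu n)).const_add c
  exact h.hasFDerivAt.comp_hasDerivAt t h1

theorem hasDerivAt_line_neg {u : Eu n → ℝ} {c : Eu n} {i : Fin n} {t : ℝ}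
    (h : DifferentiableAt ℝ u (c - t • eb i)) :
    HasDerivAt (fun t : ℝ => u (c - t • eb i)) (-pd i u (c - t • eb i)) t := by
  have h1 : HasDerivAt (fun t : ℝ => c - t • (eb i : Eu n)) (-eb i) t := by
    simpa using ((hasDerivAt_id t).smul_const (eb i : Eu n)).const_sub c
  refine (h.hasFDerivAt.comp_hasDerivAt t h1).congr_deriv ?_
  rw [map_neg, pd]

theorem abs_le_mul_of_hasDerivAt {f f' : ℝ → ℝ} {A h : ℝ} (hh : 0 ≤ h) (h0 : f 0 = 0)
    (hf : ∀ t ∈ Icc 0 h, HasDerivAt f (f' t) t) (hA : ∀ t ∈ Icc 0 h, |f' t| ≤ A) :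
    ∀ t ∈ Icc 0 h, |f t| ≤ A * h := by
  intro t ht
  have h1 := norm_image_sub_le_of_norm_deriv_le_segment' (f := f) (f' := f') (C := A) (a := 0) (b := h)
    (fun x hx => (hf x hx).hasDerivWithinAt) (fun x hx => hA x ⟨hx.1, hx.2.le⟩) t ht
  rw [h0, sub_zero, sub_zero, norm_eq_abs] at h1
  have hA0 : 0 ≤ A := (abs_nonneg _).trans (hA 0 ⟨le_rfl, hh⟩)
  exact h1.trans (mul_le_mul_of_nonneg_left ht.2 hA0)

theorem add_smul_eb_mem {c : Eu n} {i : Fin n} {t r : ℝ} (ht : |t| < r) : c + t • eb i ∈ ball c r := by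
  rw [mem_ball, dist_eq_norm]; simpa [norm_smul] using ht

theorem sub_smul_eb_mem {c : Eu n} {i : Fin n} {t r : ℝ} (ht : |t| < r) : c - t • eb i ∈ ball c r := by
  rw [mem_ball, dist_eq_norm]; simpa [norm_smul] using ht

/-- Interior derivative bounds on the concentric ball of half the radius. -/
theorem exists_pdMulti_bound_half [NeZero n] (L : List (Fin n)) : ∃ C : ℝ, 0 ≤ C ∧
    ∀ (u : Eu n → ℝ) (c : Eu n) (r M : ℝ), 0 < r → Harm u (ball c r) → (∀ y ∈ ball c r, |u y| ≤ M) →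
      ∀ y ∈ ball c (r / 2), |pdMulti L u y| ≤ C * M / r ^ L.length := by
  obtain ⟨C, hC, h⟩ := exists_pdMulti_bound (n := n) L
  refine ⟨C * 2 ^ L.length, by positivity, fun u c r M hr hu hM y hy => ?_⟩
  have hs : ball y (r / 2) ⊆ ball c r := by
    refine ball_subset_ball' ?_
    rw [mem_ball] at hy; linarith
  have := h u y (r / 2) M (by positivity) (hu.mono hs) fun z hz => hM z (hs hz)
  refine this.trans (le_of_eq ?_)
  rw [div_pow]; field_simp

/-- First-order Taylor estimate for harmonic functions along a coordinate direction. -/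
theorem exists_first_order_bound [NeZero n] (i : Fin n) : ∃ C : ℝ, 0 ≤ C ∧
    ∀ (u : Eu n → ℝ) (c : Eu n) (r M t : ℝ), 0 < r → Harm u (ball c r) →
      (∀ y ∈ ball c r, |u y| ≤ M) → 0 ≤ t → t < r / 2 →
      |u (c + t • eb i) - u c - t * pd i u c| ≤ C * M / r ^ 2 * t ^ 2 := by
  obtain ⟨C, hC, hCb⟩ := exists_pdMulti_bound_half (n := n) [i, i]
  refine ⟨C, hC, fun u c r M t hr hu hM ht htr => ?_⟩
  have hmem : ∀ s ∈ Icc 0 t, c + s • eb i ∈ ball c (r / 2) := fun s hs =>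
    add_smul_eb_mem (by rw [abs_of_nonneg hs.1]; exact hs.2.trans_lt htr)
  have hmem' : ∀ s ∈ Icc 0 t, c + s • eb i ∈ ball c r := fun s hs =>
    ball_subset_ball (by linarith) (hmem s hs)
  have hpd := hu.pd isOpen_ball i
  have h1 := abs_le_mul_of_hasDerivAt (f := fun s => pd i u (c + s • eb i) - pd i u c)
    (f' := fun s => pd i (pd i u) (c + s • eb i)) (A := C * M / r ^ 2) ht (by simp)
    (fun s hs => (hasDerivAt_line (hpd.differentiableAt isOpen_ball (hmem' s hs))).sub_const _)
    (fun s hs => hCb u c r M hr hu hM _ (hmem s hs))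
  have h2 := abs_le_mul_of_hasDerivAt (f := fun s => u (c + s • eb i) - u c - s * pd i u c)
    (f' := fun s => pd i u (c + s • eb i) - 1 * pd i u c) (A := C * M / r ^ 2 * t) ht (by simp)
    (fun s hs => ((hasDerivAt_line (hu.differentiableAt isOpen_ball (hmem' s hs))).sub_const _).sub
      ((hasDerivAt_id s).mul_const _))
    (fun s hs => by rw [one_mul]; exact h1 s hs)
  have h3 := h2 t ⟨ht, le_rfl⟩
  rw [mul_assoc, ← sq] at h3
  exact h3

/-- Second-order Taylor estimate for second differences of harmonic functions. -/
theorem exists_second_difference_bound [NeZero n] (i : Fin n) : ∃ C : ℝ, 0 ≤ C ∧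
    ∀ (u : Eu n → ℝ) (c : Eu n) (r M t : ℝ), 0 < r → Harm u (ball c r) →
      (∀ y ∈ ball c r, |u y| ≤ M) → 0 ≤ t → t < r / 2 →
      |u (c + t • eb i) + u (c - t • eb i) - 2 * u c - t ^ 2 * pd2 i i u c| ≤ C * M / r ^ 3 * t ^ 3 := by
  obtain ⟨C, hC, hCb⟩ := exists_pdMulti_bound_half (n := n) [i, i, i]
  refine ⟨2 * C, by positivity, fun u c r M t hr hu hM ht htr => ?_⟩
  have hmem : ∀ s ∈ Icc 0 t, c + s • eb i ∈ ball c (r / 2) := fun s hs =>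
    add_smul_eb_mem (by rw [abs_of_nonneg hs.1]; exact hs.2.trans_lt htr)
  have hmemn : ∀ s ∈ Icc 0 t, c - s • eb i ∈ ball c (r / 2) := fun s hs =>
    sub_smul_eb_mem (by rw [abs_of_nonneg hs.1]; exact hs.2.trans_lt htr)
  have hmem' : ∀ s ∈ Icc 0 t, c + s • eb i ∈ ball c r := fun s hs =>
    ball_subset_ball (by linarith) (hmem s hs)
  have hmemn' : ∀ s ∈ Icc 0 t, c - s • eb i ∈ ball c r := fun s hs =>
    ball_subset_ball (by linarith) (hmemn s hs)
  have hpd := hu.pd isOpen_ball i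
  have hpd2 := hpd.pd isOpen_ball i
  have h0' := abs_le_mul_of_hasDerivAt
    (f := fun s => pd i (pd i u) (c + s • eb i) - pd i (pd i u) c)
    (f' := fun s => pd i (pd i (pd i u)) (c + s • eb i)) (A := C * M / r ^ 3) ht (by simp)
    (fun s hs => (hasDerivAt_line (hpd2.differentiableAt isOpen_ball (hmem' s hs))).sub_const _)
    (fun s hs => hCb u c r M hr hu hM _ (hmem s hs))
  have h0n := abs_le_mul_of_hasDerivAt
    (f := fun s => pd i (pd i u) (c - s • eb i) - pd i (pd i u) c)
    (f' := fun s => -pd i (pd i (pd i u)) (c - s • eb i)) (A := C * M / r ^ 3) ht (by simp)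
    (fun s hs => (hasDerivAt_line_neg (hpd2.differentiableAt isOpen_ball (hmemn' s hs))).sub_const _)
    (fun s hs => by rw [abs_neg]; exact hCb u c r M hr hu hM _ (hmemn s hs))
  have h1 := abs_le_mul_of_hasDerivAt
    (f := fun s => pd i u (c + s • eb i) - pd i u (c - s • eb i) - 2 * s * pd i (pd i u) c)
    (f' := fun s => pd i (pd i u) (c + s • eb i) - -pd i (pd i u) (c - s • eb i) -
      2 * 1 * pd i (pd i u) c) (A := 2 * C * M / r ^ 3 * t) ht (by simp)
    (fun s hs => ((hasDerivAt_line (hpd.differentiableAt isOpen_ball (hmem' s hs))).sub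
      (hasDerivAt_line_neg (hpd.differentiableAt isOpen_ball (hmemn' s hs)))).sub
      (((hasDerivAt_id s).const_mul 2).mul_const _))
    (fun s hs => by
      have e3 : pd i (pd i u) (c + s • eb i) - -pd i (pd i u) (c - s • eb i) -
          2 * 1 * pd i (pd i u) c = (pd i (pd i u) (c + s • eb i) - pd i (pd i u) c) +
          (pd i (pd i u) (c - s • eb i) - pd i (pd i u) c) := by ring
      rw [e3]
      exact (abs_add_le _ _).trans ((add_le_add (h0' s hs) (h0n s hs)).trans (le_of_eq (by ring))))
  have h2 := abs_le_mul_of_hasDerivAt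
    (f := fun s => u (c + s • eb i) + u (c - s • eb i) - 2 * u c - s ^ 2 * pd2 i i u c)
    (f' := fun s => pd i u (c + s • eb i) + -pd i u (c - s • eb i) - (2 : ℕ) * s ^ (2 - 1) * pd2 i i u c)
    (A := 2 * C * M / r ^ 3 * t * t) ht (by simp; ring)
    (fun s hs => (((hasDerivAt_line (hu.differentiableAt isOpen_ball (hmem' s hs))).add
      (hasDerivAt_line_neg (hu.differentiableAt isOpen_ball (hmemn' s hs)))).sub_const _).sub
      ((hasDerivAt_pow 2 s).mul_const _))
    (fun s hs => by
      have e4 := h1 s hs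
      simp only [← sub_eq_add_neg]
      simpa [pd2] using e4)
  refine (h2 t ⟨ht, le_rfl⟩).trans (le_of_eq ?_)
  ring

theorem exists_discLap_bound [NeZero n] : ∃ C : ℝ, 0 ≤ C ∧
    ∀ (u : Eu n → ℝ) (c : Eu n) (r M t : ℝ), 0 < r → Harm u (ball c r) →
      (∀ y ∈ ball c r, |u y| ≤ M) → 0 ≤ t → t < r / 2 → |discLap u c t| ≤ C * M / r ^ 3 * t ^ 3 := by
  choose C hC h using fun i : Fin n => exists_second_difference_bound (n := n) i
  refine ⟨∑ i, C i, Finset.sum_nonneg fun i _ => hC i, fun u c r M t hr hu hM ht htr => ?_⟩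
  have h1 : lapl u c = 0 := (hu.isHarmonicOn isOpen_ball).2 c (mem_ball_self hr)
  have h2 : discLap u c t =
      ∑ i, (u (c + t • eb i) + u (c - t • eb i) - 2 * u c - t ^ 2 * pd2 i i u c) := by
    rw [Finset.sum_sub_distrib, ← Finset.mul_sum, ← lapl, h1, mul_zero, sub_zero, discLap]
  rw [h2]
  refine (Finset.abs_sum_le_sum_abs _ _).trans ?_
  refine (Finset.sum_le_sum fun i _ => h i u c r M t hr hu hM ht htr).trans (le_of_eq ?_)
  rw [Finset.sum_mul, Finset.sum_div, Finset.sum_mul]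

/-- Functions of two variables, harmonic in each of them and bounded uniformly in the first. -/
structure BiHarm (Φ : Eu n → Eu n → ℝ) (O W : Set (Eu n)) : Prop where
  left : ∀ z ∈ W, Harm (fun x => Φ x z) O
  right : ∀ x ∈ O, Harm (Φ x) W
  bound : ∀ z ∈ W, ∃ r > 0, ball z r ⊆ W ∧ ∃ M, ∀ x ∈ O, ∀ y ∈ ball z r, |Φ x y| ≤ M

theorem BiHarm.pd [NeZero n] {Φ : Eu n → Eu n → ℝ} {O W : Set (Eu n)} (hO : IsOpen O)
    (hW : IsOpen W) (h : BiHarm Φ O W) (i : Fin n) : BiHarm (fun x => pd i (Φ x)) O W where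
  right x hx := (h.right x hx).pd hW i
  bound z hz := by
    obtain ⟨r, hr, hrW, M, hM⟩ := h.bound z hz
    refine ⟨r / 2, by positivity, (ball_subset_ball (by linarith)).trans hrW, 2 * (n + 1) * M / (r / 2),
      fun x hx y hy => ?_⟩
    have hs : ball y (r / 2) ⊆ ball z r := by
      refine ball_subset_ball' ?_
      rw [mem_ball] at hy; linarith
    exact Harm.abs_pd_le' (by positivity) ((h.right x hx).mono (hs.trans hrW))
      (fun w hw => hM x hx w (hs hw)) i
  left z hz := by
    obtain ⟨r, hr, hrW, M, hM⟩ := h.bound z hz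
    obtain ⟨C, hC, hCb⟩ := exists_first_order_bound (n := n) i
    have hM' : ∀ x ∈ O, ∀ y ∈ ball z r, |Φ x y| ≤ max M 0 := fun x hx y hy =>
      (hM x hx y hy).trans (le_max_left _ _)
    have hM0 : 0 ≤ max M 0 := le_max_right _ _
    set K := C * max M 0 / r ^ 2 with hK
    have hK0 : 0 ≤ K := by positivity
    refine harm_of_approx hO fun ε hε => ?_
    obtain ⟨t, ht, ht1, ht2⟩ : ∃ t, 0 < t ∧ t < r / 2 ∧ K * t ≤ ε := by
      refine ⟨min (r / 4) (ε / (K + 1)), by positivity, ?_, ?_⟩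
      · exact (min_le_left _ _).trans_lt (by linarith)
      · calc K * min (r / 4) (ε / (K + 1)) ≤ (K + 1) * (ε / (K + 1)) := by
              gcongr
              · linarith
              · exact min_le_right _ _
          _ = ε := by field_simp
    have hm : z + t • eb i ∈ W := hrW (add_smul_eb_mem (by rw [abs_of_pos ht]; linarith))
    refine ⟨fun x => t⁻¹ * Φ x (z + t • eb i) + (-t⁻¹) * Φ x z, (h.left _ hm).linear _ _ (h.left z hz),
      fun x hx => ?_⟩
    have h1 := hCb (Φ x) z r (max M 0) t hr ((h.right x hx).mono hrW) (hM' x hx) ht.le ht1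
    have h2 : t⁻¹ * Φ x (z + t • eb i) + -t⁻¹ * Φ x z - _root_.pd i (Φ x) z =
        t⁻¹ * (Φ x (z + t • eb i) - Φ x z - t * _root_.pd i (Φ x) z) := by
      field_simp; ring
    rw [h2, abs_mul, abs_of_pos (inv_pos.2 ht), inv_mul_le_iff₀ ht]
    calc _ ≤ K * t ^ 2 := h1
      _ = t * (K * t) := by ring
      _ ≤ t * ε := by gcongr

theorem BiHarm.pdMulti [NeZero n] {Φ : Eu n → Eu n → ℝ} {O W : Set (Eu n)} (hO : IsOpen O)
    (hW : IsOpen W) (h : BiHarm Φ O W) (L : List (Fin n)) :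
    BiHarm (fun x => pdMulti L (Φ x)) O W := by
  induction L with
  | nil => exact h
  | cons i L ih => exact ih.pd hO hW i

/-- Bound for mixed derivatives of functions harmonic in each of two variables. -/
theorem exists_mixed_bound [NeZero n] (G B : List (Fin n)) : ∃ C : ℝ, 0 ≤ C ∧
    ∀ (Φ : Eu n → Eu n → ℝ) (x z : Eu n) (s M : ℝ), 0 < s →
      (∀ y ∈ ball z s, Harm (fun x => Φ x y) (ball x s)) → (∀ w ∈ ball x s, Harm (Φ w) (ball z s)) →
      (∀ w ∈ ball x s, ∀ y ∈ ball z s, |Φ w y| ≤ M) →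
      Harm (fun w => pdMulti G (Φ w) z) (ball x s) ∧
      |pdMulti B (fun w => pdMulti G (Φ w) z) x| ≤ C * M / s ^ (G.length + B.length) := by
  obtain ⟨C1, hC1, h1⟩ := exists_pdMulti_bound (n := n) G
  obtain ⟨C2, hC2, h2⟩ := exists_pdMulti_bound (n := n) B
  refine ⟨C2 * C1, by positivity, fun Φ x z s M hs hl hr hM => ?_⟩
  have hbi : BiHarm Φ (ball x s) (ball z s) := by
    refine ⟨hl, hr, fun y hy => ?_⟩
    obtain ⟨t, ht, htb⟩ := Metric.isOpen_iff.1 isOpen_ball y hy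
    exact ⟨t, ht, htb, M, fun w hw y' hy' => hM w hw y' (htb hy')⟩
  have hH := (hbi.pdMulti isOpen_ball isOpen_ball G).left z (mem_ball_self hs)
  refine ⟨hH, ?_⟩
  refine (h2 _ x s (C1 * M / s ^ G.length) hs hH fun w hw => h1 _ z s M hs (hr w hw) (hM w hw)).trans
    (le_of_eq ?_)
  rw [pow_add]; field_simp

theorem exists_fundSol_bound (hn : 2 < n) (G B : List (Fin n)) : ∃ C : ℝ, 0 ≤ C ∧
    ∀ x z : Eu n, x ≠ z →
      Harm (fun w => pdMulti G (fun y => fundSol n (w - y)) z) (ball x (‖x - z‖ / 4)) ∧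
      |pdMulti B (fun w => pdMulti G (fun y => fundSol n (w - y)) z) x| ≤
        C / ‖x - z‖ ^ (n + G.length + B.length - 2) := by
  have : NeZero n := ⟨by omega⟩
  obtain ⟨C, hC, h⟩ := exists_mixed_bound (n := n) G B
  have hκ := (fundConst_pos hn).le
  refine ⟨C * fundConst n * 2 ^ (n - 2) * 4 ^ (G.length + B.length), by positivity, fun x z hxz => ?_⟩
  have hd : 0 < ‖x - z‖ := norm_pos_iff.2 (sub_ne_zero.2 hxz)
  have hfar : ∀ w ∈ ball x (‖x - z‖ / 4), ∀ y ∈ ball z (‖x - z‖ / 4), ‖x - z‖ / 2 ≤ ‖w - y‖ := by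
    intro w hw y hy
    rw [mem_ball, dist_eq_norm] at hw hy
    have h1 : x - z = (w - y) - (w - x) + (y - z) := by abel
    have h2 : ‖x - z‖ ≤ ‖w - y‖ + ‖w - x‖ + ‖y - z‖ := by
      conv_lhs => rw [h1]
      exact (norm_add_le _ _).trans (add_le_add_left (norm_sub_le _ _) _)
    linarith
  have hne : ∀ w ∈ ball x (‖x - z‖ / 4), ∀ y ∈ ball z (‖x - z‖ / 4), w ≠ y := by
    rintro w hw y hy rfl
    have := hfar w hw w hy
    rw [sub_self, norm_zero] at this; linarith
  obtain ⟨h1, h2⟩ := h (fun w y => fundSol n (w - y)) x z (‖x - z‖ / 4)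
    (fundConst n / (‖x - z‖ / 2) ^ (n - 2)) (by positivity)
    (fun y hy => (harm_fundSol_sub y).mono fun w hw => hne w hw y hy)
    (fun w hw => (harm_fundSol_sub' w).mono fun y hy => (hne w hw y hy).symm)
    (fun w hw y hy => by
      rw [abs_of_nonpos (fundSol_nonpos hn _)]
      linarith [neg_le_fundSol hn (half_pos hd) (hfar w hw y hy)])
  refine ⟨h1, h2.trans (le_of_eq ?_)⟩
  rw [show n + G.length + B.length - 2 = (n - 2) + (G.length + B.length) by omega, pow_add ‖x - z‖,
    div_pow, div_pow]
  field_simp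

theorem exists_lipschitz_bound [NeZero n] : ∃ C : ℝ, 0 ≤ C ∧
    ∀ (u : Eu n → ℝ) (c : Eu n) (r M : ℝ), 0 < r → Harm u (ball c r) → (∀ y ∈ ball c r, |u y| ≤ M) →
      ∀ y ∈ ball c (r / 2), |u y - u c| ≤ C * M / r * ‖y - c‖ := by
  choose C hC h using fun i : Fin n => exists_pdMulti_bound_half (n := n) [i]
  refine ⟨∑ i, C i, Finset.sum_nonneg fun i _ => hC i, fun u c r M hr hu hM y hy => ?_⟩
  have hb : ball c (r / 2) ⊆ ball c r := ball_subset_ball (by linarith)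
  refine Convex.norm_image_sub_le_of_norm_fderiv_le (𝕜 := ℝ)
    (fun z hz => hu.differentiableAt isOpen_ball (hb hz)) (fun z hz => ?_) (convex_ball c (r / 2))
    (mem_ball_self (by positivity)) hy
  refine (norm_fderiv_le_sum u z).trans ((Finset.sum_le_sum fun i _ => h i u c r M hr hu hM z hz).trans
    (le_of_eq ?_))
  simp only [List.length_singleton, pow_one]
  rw [Finset.sum_mul, Finset.sum_div]

section Domain

variable {D : Set (Eu n)}

theorem IsBddDomain.compl_nonempty [NeZero n] (hD : IsBddDomain D) : Dᶜ.Nonempty := by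
  rw [nonempty_compl]
  rintro rfl
  have : Nontrivial (Eu n) := ⟨0, eb 0, fun h => by simpa using congrArg norm h⟩
  exact NormedSpace.unbounded_univ ℝ (Eu n) hD.2.2

theorem ball_bdist_subset (x : Eu n) : ball x (bdist D x) ⊆ D := by
  have := Metric.ball_infDist_subset_compl (s := Dᶜ) (x := x)
  rwa [compl_compl] at this

theorem bdist_pos [NeZero n] (hD : IsBddDomain D) {x : Eu n} (hx : x ∈ D) : 0 < bdist D x :=
  (hD.1.isClosed_compl.notMem_iff_infDist_pos hD.compl_nonempty).1 (not_not.2 hx)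

theorem bdist_le_of_notMem {x y : Eu n} (hy : y ∉ D) : bdist D x ≤ ‖x - y‖ := by
  rw [← dist_eq_norm]; exact Metric.infDist_le_dist_of_mem hy

theorem bdist_le_add (x y : Eu n) : bdist D x ≤ bdist D y + ‖x - y‖ := by
  rw [← dist_eq_norm]; exact Metric.infDist_le_infDist_add_dist

theorem notMem_of_frontier (hD : IsOpen D) {y : Eu n} (hy : y ∈ frontier D) : y ∉ D :=
  fun h => (hD.frontier_eq ▸ hy).2 h

theorem exists_bdist_le [NeZero n] (hD : IsBddDomain D) : ∃ R : ℝ, 0 < R ∧ ∀ x ∈ D, bdist D x ≤ R := by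
  obtain ⟨y, hy⟩ := hD.compl_nonempty
  obtain ⟨R, hR⟩ := hD.2.2.subset_ball y
  refine ⟨max R 1, by positivity, fun x hx => (bdist_le_of_notMem hy).trans ?_⟩
  have := hR hx
  rw [mem_ball, dist_eq_norm] at this
  exact this.le.trans (le_max_left _ _)

end Domain

theorem harm_sum {ι : Type*} (s : Finset ι) {f : ι → Eu n → ℝ} {O : Set (Eu n)}
    (h : ∀ i ∈ s, Harm (f i) O) : Harm (fun x => ∑ i ∈ s, f i x) O := by
  classical
  induction s using Finset.induction_on with
  | empty => simpa using harm_const (n := n) 0 O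
  | insert a s ha ih =>
    simp only [Finset.sum_insert ha]
    exact (h a (Finset.mem_insert_self a s)).add (ih fun i hi => h i (Finset.mem_insert_of_mem hi))

section Green

variable {D : Set (Eu n)} {U : Eu n → Eu n → ℝ}

theorem IsGreenCorrection.harm_left (hD : IsBddDomain D) (hU : IsGreenCorrection D U) {z : Eu n}
    (hz : z ∈ D) : Harm (fun x => U x z) D :=
  (hU z hz).1.harm hD.1

theorem IsGreenCorrection.nonpos (hn : 2 < n) (hD : IsBddDomain D) (hU : IsGreenCorrection D U)
    {x z : Eu n} (hx : x ∈ closure D) (hz : z ∈ D) : U x z ≤ 0 := by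
  have : NeZero n := ⟨by omega⟩
  refine (hU.harm_left hD hz).le_of_frontier hD.1 hD.2.2 (hU z hz).2.1 (fun ξ hξ => ?_) x hx
  rw [(hU z hz).2.2 ξ hξ]
  exact fundSol_nonpos hn _

theorem IsGreenCorrection.abs_le (hn : 2 < n) (hD : IsBddDomain D) (hU : IsGreenCorrection D U)
    {x z : Eu n} (hx : x ∈ closure D) (hz : z ∈ D) :
    |U x z| ≤ fundConst n / bdist D z ^ (n - 2) := by
  have : NeZero n := ⟨by omega⟩
  refine (hU.harm_left hD hz).abs_le_of_frontier hD.1 hD.2.2 (hU z hz).2.1 (fun ξ hξ => ?_) x hx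
  rw [(hU z hz).2.2 ξ hξ, abs_of_nonpos (fundSol_nonpos hn _)]
  have := neg_le_fundSol hn (bdist_pos hD hz) (bdist_le_of_notMem (notMem_of_frontier hD.1 hξ))
    (x := z - ξ)
  linarith

theorem IsGreenCorrection.fundSol_le (hn : 2 < n) (hD : IsBddDomain D)
    (hU : IsGreenCorrection D U) {x z : Eu n} (hx : x ∈ D) (hz : z ∈ D) (hxz : x ≠ z) :
    fundSol n (x - z) ≤ U x z := by
  have : NeZero n := ⟨by omega⟩
  have hd : 0 < ‖x - z‖ := norm_pos_iff.2 (sub_ne_zero.2 hxz)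
  obtain ⟨s, hs0, hs1, hs2⟩ : ∃ s, 0 < s ∧ s < ‖x - z‖ ∧ s ≤ bdist D z :=
    ⟨min (‖x - z‖ / 2) (bdist D z), lt_min (by positivity) (bdist_pos hD hz),
      (min_le_left _ _).trans_lt (by linarith), min_le_right _ _⟩
  have hO : IsOpen (D ∩ (closedBall z s)ᶜ) := hD.1.inter isClosed_closedBall.isOpen_compl
  have hcl : closure (D ∩ (closedBall z s)ᶜ) ⊆ closure D ∩ (ball z s)ᶜ :=
    (closure_inter_subset_inter_closure _ _).trans (inter_subset_inter_right _
      (closure_minimal (compl_subset_compl.2 ball_subset_closedBall) isOpen_ball.isClosed_compl))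
  have hne : ∀ y ∈ (ball z s)ᶜ, s ≤ ‖y - z‖ := fun y hy => by
    rw [mem_compl_iff, mem_ball, dist_eq_norm, not_lt] at hy; exact hy
  have hsub : (ball z s)ᶜ ⊆ {z}ᶜ := compl_subset_compl.2 (singleton_subset_iff.2 (mem_ball_self hs0))
  have hΓ := (harm_fundSol_sub (n := n) z).mono hsub
  refine Harm.le_of_frontier_le hO (hD.2.2.subset inter_subset_left)
    (hΓ.mono (subset_closure.trans (hcl.trans inter_subset_right)))
    (hΓ.1.mono (hcl.trans inter_subset_right))
    ((hU.harm_left hD hz).mono inter_subset_left)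
    ((hU z hz).2.1.mono (hcl.trans inter_subset_left)) (fun ξ hξ => ?_) x
    (subset_closure ⟨hx, ?_⟩)
  · rcases frontier_inter_subset _ _ hξ with h | h
    · rw [(hU z hz).2.2 ξ h.1, fundSol_sub_comm]
    · have h1 : ‖ξ - z‖ = s := by
        have := h.2
        rw [frontier_compl] at this
        simpa [dist_eq_norm] using frontier_closedBall_subset_sphere this
      have h2 := hU.abs_le hn hD h.1 hz
      have h3 := _root_.fundSol_le hn (h1 ▸ hs0) h1.le (x := ξ - z)
      have h4 : fundConst n / bdist D z ^ (n - 2) ≤ fundConst n / s ^ (n - 2) :=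
        div_le_div_of_nonneg_left (fundConst_pos hn).le (by positivity)
          (pow_le_pow_left₀ hs0.le hs2 _)
      have h5 := neg_abs_le (U ξ z)
      linarith
  · rw [mem_compl_iff, mem_closedBall, dist_eq_norm, not_le]; exact hs1

theorem IsGreenCorrection.abs_le' (hn : 2 < n) (hD : IsBddDomain D) (hU : IsGreenCorrection D U)
    {x z : Eu n} (hx : x ∈ D) (hz : z ∈ D) :
    |U x z| ≤ fundConst n * 2 ^ (n - 2) / bdist D x ^ (n - 2) := by
  have : NeZero n := ⟨by omega⟩
  have hκ := (fundConst_pos hn).le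
  have hx0 := bdist_pos hD hx
  have key : fundConst n * 2 ^ (n - 2) / bdist D x ^ (n - 2) =
      fundConst n / (bdist D x / 2) ^ (n - 2) := by
    rw [div_pow]; field_simp
  rw [key]
  rcases le_or_gt (bdist D x / 2) (bdist D z) with h | h
  · exact (hU.abs_le hn hD (subset_closure hx) hz).trans
      (div_le_div_of_nonneg_left hκ (by positivity) (pow_le_pow_left₀ (by positivity) h _))
  · have h1 := bdist_le_add (D := D) x z
    have h2 : bdist D x / 2 ≤ ‖x - z‖ := by linarith
    have hne : x ≠ z := by
      rintro rfl
      rw [sub_self, norm_zero] at h2; linarith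
    have h3 := hU.fundSol_le hn hD hx hz hne
    have h4 := neg_le_fundSol hn (half_pos hx0) h2
    rw [abs_of_nonpos (hU.nonpos hn hD (subset_closure hx) hz)]
    linarith

theorem harm_fundSol_frontier (hn : 2 < n) (hD : IsBddDomain D) {z ξ : Eu n} (hz : z ∈ D)
    (hξ : ξ ∈ frontier D) : Harm (fun y => fundSol n (y - ξ)) (ball z (bdist D z / 2)) ∧
      ∀ y ∈ ball z (bdist D z / 2),
        |fundSol n (y - ξ)| ≤ fundConst n / (bdist D z / 2) ^ (n - 2) := by
  have : NeZero n := ⟨by omega⟩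
  have hz0 := bdist_pos hD hz
  have hξD := notMem_of_frontier hD.1 hξ
  have hb : ball z (bdist D z / 2) ⊆ D :=
    (ball_subset_ball (by linarith)).trans (ball_bdist_subset z)
  refine ⟨(harm_fundSol_sub ξ).mono fun y hy h => hξD (h ▸ hb hy), fun y hy => ?_⟩
  rw [abs_of_nonpos (fundSol_nonpos hn _)]
  have h1 := bdist_le_add (D := D) z y
  have h2 := bdist_le_of_notMem (x := y) hξD
  rw [mem_ball, dist_eq_norm] at hy
  have h3 := neg_le_fundSol hn (half_pos hz0) (x := y - ξ) (by rw [norm_sub_rev] at hy; linarith)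
  linarith

theorem IsGreenCorrection.harm_right (hn : 2 < n) (hD : IsBddDomain D)
    (hU : IsGreenCorrection D U) {x : Eu n} (hx : x ∈ D) : Harm (U x) D := by
  have : NeZero n := ⟨by omega⟩
  have hκ := (fundConst_pos hn).le
  obtain ⟨C₁, hC₁, h₁⟩ := exists_lipschitz_bound (n := n)
  obtain ⟨C₂, hC₂, h₂⟩ := exists_discLap_bound (n := n)
  have hb : ∀ z ∈ D, ball z (bdist D z / 2 / 2) ⊆ D := fun z hz =>
    (ball_subset_ball (by linarith [bdist_pos hD hz])).trans (ball_bdist_subset z)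
  refine ⟨fun z hz => ContinuousAt.continuousWithinAt ?_, fun z hz => ?_⟩
  · have hz0 := bdist_pos hD hz
    set r := bdist D z / 2 with hr
    have hr0 : 0 < r := by positivity
    have key : ∀ y ∈ ball z (r / 2), |U x y - U x z| ≤
        C₁ * (fundConst n / r ^ (n - 2)) / r * ‖y - z‖ := by
      intro y hy
      have hyD := hb z hz hy
      refine ((hU.harm_left hD hyD).sub (hU.harm_left hD hz)).abs_le_of_frontier hD.1 hD.2.2
        ((hU y hyD).2.1.sub (hU z hz).2.1) (fun ξ hξ => ?_) x (subset_closure hx)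
      rw [(hU y hyD).2.2 ξ hξ, (hU z hz).2.2 ξ hξ]
      obtain ⟨h3, h4⟩ := harm_fundSol_frontier hn hD hz hξ
      exact h₁ _ z r _ hr0 h3 h4 y hy
    rw [ContinuousAt, tendsto_iff_norm_sub_tendsto_zero]
    refine squeeze_zero' (.of_forall fun _ => norm_nonneg _)
      (Filter.eventually_of_mem (ball_mem_nhds z (half_pos hr0)) key) ?_
    have : Continuous fun y => C₁ * (fundConst n / r ^ (n - 2)) / r * ‖y - z‖ := by fun_prop
    simpa using this.tendsto z
  · have hz0 := bdist_pos hD hz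
    set r := bdist D z / 2 with hr
    have hr0 : 0 < r := by positivity
    set K := C₂ * (fundConst n / r ^ (n - 2)) / r ^ 3 with hK
    have key : ∀ h, 0 < h → h < r / 2 → |discLap (U x) z h| ≤ K * h ^ 3 := by
      intro h h0 h1
      have hp : ∀ i : Fin n, z + h • eb i ∈ D := fun i =>
        hb z hz (add_smul_eb_mem (by rwa [abs_of_pos h0]))
      have hm : ∀ i : Fin n, z - h • eb i ∈ D := fun i =>
        hb z hz (sub_smul_eb_mem (by rwa [abs_of_pos h0]))
      refine Harm.abs_le_of_frontier hD.1 hD.2.2 (u := fun x => discLap (U x) z h) (harm_sum _ fun i _ =>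
        ((hU.harm_left hD (hp i)).add (hU.harm_left hD (hm i))).sub
          ((hU.harm_left hD hz).const_mul 2)) ?_ (fun ξ hξ => ?_) x (subset_closure hx)
      · exact continuousOn_finsetSum _ fun i _ => (((hU _ (hp i)).2.1.add (hU _ (hm i)).2.1).sub
          ((hU z hz).2.1.const_smul (2 : ℝ)))
      · obtain ⟨h3, h4⟩ := harm_fundSol_frontier hn hD hz hξ
        have : discLap (U ξ) z h = discLap (fun y => fundSol n (y - ξ)) z h := by
          refine Finset.sum_congr rfl fun i _ => ?_
          rw [(hU _ (hp i)).2.2 ξ hξ, (hU _ (hm i)).2.2 ξ hξ, (hU z hz).2.2 ξ hξ]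
        rw [this]
        exact h₂ _ z r _ h hr0 h3 h4 h0.le h1
    rw [tendsto_zero_iff_norm_tendsto_zero]
    refine squeeze_zero' (g := fun h : ℝ => K * h) (.of_forall fun _ => norm_nonneg _)
      (Filter.eventually_of_mem (Ioo_mem_nhdsGT (half_pos hr0)) fun h hh => ?_) ?_
    · have := key h hh.1 hh.2
      have h0 : 0 < h := hh.1
      rw [norm_eq_abs, abs_div, abs_of_pos (pow_pos h0 2), div_le_iff₀ (pow_pos h0 2)]
      calc _ ≤ _ := this
        _ = _ := by ring
    · have : Continuous fun h : ℝ => K * h := by fun_prop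
      simpa using (this.tendsto 0).mono_left nhdsWithin_le_nhds

theorem IsGreenCorrection.biHarm (hn : 2 < n) (hD : IsBddDomain D) (hU : IsGreenCorrection D U) :
    BiHarm U D D where
  left z hz := hU.harm_left hD hz
  right x hx := hU.harm_right hn hD hx
  bound z hz := by
    have : NeZero n := ⟨by omega⟩
    have hz0 := bdist_pos hD hz
    have hb : ball z (bdist D z / 2) ⊆ D :=
      (ball_subset_ball (by linarith)).trans (ball_bdist_subset z)
    refine ⟨bdist D z / 2, by positivity, hb, fundConst n / (bdist D z / 2) ^ (n - 2),
      fun x hx y hy => (hU.abs_le hn hD (subset_closure hx) (hb hy)).trans ?_⟩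
    have h1 := bdist_le_add (D := D) z y
    rw [mem_ball, dist_comm, dist_eq_norm] at hy
    exact div_le_div_of_nonneg_left (fundConst_pos hn).le (by positivity)
      (pow_le_pow_left₀ (by positivity) (by linarith) _)

end Green

/-- The inversion of `z` in the sphere of center `c` and radius `R`. -/
def sphInv (c : Eu n) (R : ℝ) (z : Eu n) : Eu n := c + (R ^ 2 / ‖z - c‖ ^ 2) • (z - c)

theorem norm_sphInv_sub {c z : Eu n} {R : ℝ} (hz : 0 < ‖z - c‖) :
    ‖sphInv c R z - c‖ = R ^ 2 / ‖z - c‖ := by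
  rw [sphInv, add_sub_cancel_left, norm_smul, norm_of_nonneg (by positivity)]
  field_simp

theorem norm_sub_le_sphInv {c z ξ : Eu n} {R : ℝ} (hR : 0 < R) (hz : R ≤ ‖z - c‖)
    (hξ : R ≤ ‖ξ - c‖) : R / ‖z - c‖ * ‖ξ - z‖ ≤ ‖ξ - sphInv c R z‖ := by
  have hρ : 0 < ‖z - c‖ := hR.trans_le hz
  refine le_of_sq_le_sq ?_ (norm_nonneg _)
  have e1 : ξ - z = (ξ - c) - (z - c) := by abel
  have e2 : ξ - sphInv c R z = (ξ - c) - (R ^ 2 / ‖z - c‖ ^ 2) • (z - c) := by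
    rw [sphInv]; abel
  rw [e1, e2, mul_pow, norm_sub_sq_real (ξ - c) (z - c), norm_sub_sq_real (ξ - c) (_ • _),
    inner_smul_right, norm_smul,
    norm_of_nonneg (by positivity : (0:ℝ) ≤ R ^ 2 / ‖z - c‖ ^ 2)]
  set a := ‖ξ - c‖
  set b := ‖z - c‖
  have key : 0 ≤ (b ^ 2 - R ^ 2) * (a ^ 2 - R ^ 2) / b ^ 2 := by
    have h1 : R ^ 2 ≤ b ^ 2 := pow_le_pow_left₀ hR.le hz _
    have h2 : R ^ 2 ≤ a ^ 2 := pow_le_pow_left₀ hR.le hξ _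
    exact div_nonneg (mul_nonneg (by linarith) (by linarith)) (by positivity)
  have : (b ^ 2 - R ^ 2) * (a ^ 2 - R ^ 2) / b ^ 2 =
      (a ^ 2 - 2 * (R ^ 2 / b ^ 2 * ⟪ξ - c, z - c⟫) + (R ^ 2 / b ^ 2 * b) ^ 2) -
      (R / b) ^ 2 * (a ^ 2 - 2 * ⟪ξ - c, z - c⟫ + b ^ 2) := by
    field_simp; ring
  linarith

section Green

variable {D : Set (Eu n)} {U : Eu n → Eu n → ℝ}

/-- The exterior sphere condition. -/
def HasExteriorBalls (D : Set (Eu n)) : Prop :=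
  ∀ z ∈ frontier D, ∃ c R, 0 < R ∧ ‖z - c‖ = R ∧ ∀ y ∈ D, R ≤ ‖y - c‖

theorem IsGreenCorrection.le_kelvin (hn : 2 < n) (hD : IsBddDomain D) (hU : IsGreenCorrection D U)
    {c : Eu n} {R : ℝ} (hR : 0 < R) (hc : ∀ y ∈ D, R ≤ ‖y - c‖) {x z : Eu n} (hx : x ∈ D)
    (hz : z ∈ D) : U x z ≤ (R / ‖z - c‖) ^ (n - 2) * fundSol n (x - sphInv c R z) := by
  have : NeZero n := ⟨by omega⟩
  have hcl : closure D ⊆ (ball c R)ᶜ := closure_minimal (fun y hy => by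
    rw [mem_compl_iff, mem_ball, dist_eq_norm, not_lt]; exact hc y hy) isOpen_ball.isClosed_compl
  have hcl' : ∀ y ∈ closure D, R ≤ ‖y - c‖ := fun y hy => by
    simpa [dist_eq_norm] using hcl hy
  have hzc : R < ‖z - c‖ := by
    have h1 : D ⊆ interior (ball c R)ᶜ := interior_maximal (subset_closure.trans hcl) hD.1
    have h2 := h1 hz
    rw [interior_compl, closure_ball c hR.ne'] at h2
    simpa [dist_eq_norm] using h2
  have hρ : 0 < ‖z - c‖ := hR.trans hzc
  have hs : ‖sphInv c R z - c‖ < R := by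
    rw [norm_sphInv_sub hρ, div_lt_iff₀ hρ]; nlinarith
  have hne : closure D ⊆ {sphInv c R z}ᶜ := fun y hy h => by
    have := hcl' y hy
    rw [mem_singleton_iff.1 h] at this
    linarith
  have hΓ := ((harm_fundSol_sub (n := n) (sphInv c R z)).mono hne).const_mul
    ((R / ‖z - c‖) ^ (n - 2))
  refine Harm.le_of_frontier_le hD.1 hD.2.2 (hU.harm_left hD hz) (hU z hz).2.1
    (hΓ.mono subset_closure) hΓ.1 (fun ξ hξ => ?_) x (subset_closure hx)
  have hξc : ξ ∈ closure D := frontier_subset_closure hξ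
  have hξz : 0 < ‖ξ - z‖ := norm_pos_iff.2 (sub_ne_zero.2 fun h =>
    notMem_of_frontier hD.1 hξ (h ▸ hz))
  have hq : 0 < R / ‖z - c‖ := by positivity
  rw [(hU z hz).2.2 ξ hξ, fundSol_sub_comm, fundSol_eq hn, fundSol_eq hn, mul_neg, neg_le_neg_iff]
  have h1 := norm_sub_le_sphInv hR hzc.le (hcl' ξ hξc)
  have h2 : (R / ‖z - c‖) ^ (n - 2) * ‖ξ - z‖ ^ (n - 2) ≤ ‖ξ - sphInv c R z‖ ^ (n - 2) := by
    rw [← mul_pow]; exact pow_le_pow_left₀ (by positivity) h1 _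
  have h3 : 0 < ‖ξ - sphInv c R z‖ := lt_of_lt_of_le (by positivity) h1
  rw [← mul_div_assoc, div_le_div_iff₀ (by positivity) (by positivity)]
  calc _ = fundConst n * ((R / ‖z - c‖) ^ (n - 2) * ‖ξ - z‖ ^ (n - 2)) := by ring
    _ ≤ _ := mul_le_mul_of_nonneg_left h2 (fundConst_pos hn).le

theorem IsGreenCorrection.tendsto_greenFn (hn : 2 < n) (hD : IsBddDomain D)
    (hU : IsGreenCorrection D U) (hE : HasExteriorBalls D) {x z : Eu n} (hx : x ∈ D)
    (hz : z ∈ frontier D) : Tendsto (greenFn U x) (𝓝[D] z) (𝓝 0) := by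
  obtain ⟨c, R, hR, hzR, hc⟩ := hE z hz
  have hxz : x ≠ z := fun h => notMem_of_frontier hD.1 hz (h ▸ hx)
  set ψ : Eu n → ℝ := fun y => fundSol n (x - y) -
    (R / ‖y - c‖) ^ (n - 2) * fundSol n (x - sphInv c R y) with hψ
  have hinv : sphInv c R z = z := by
    rw [sphInv, hzR, div_self (by positivity), one_smul, add_sub_cancel]
  have hψz : ψ z = 0 := by
    simp only [hψ, hinv, hzR, div_self hR.ne', one_pow, one_mul, sub_self]
  have hzc : ‖z - c‖ ≠ 0 := by rw [hzR]; exact hR.ne'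
  have hnc : ContinuousAt (fun y : Eu n => ‖y - c‖) z := by fun_prop
  have hic : ContinuousAt (sphInv c R) z := by
    unfold sphInv
    exact continuousAt_const.add ((continuousAt_const.div (hnc.pow 2) (pow_ne_zero 2 hzc)).smul
      (continuousAt_id.sub continuousAt_const))
  have hψc : ContinuousAt ψ z := by
    have h1 : ContinuousAt (fun y => fundSol n (x - y)) z :=
      ContinuousAt.comp (g := fundSol n) (f := fun y => x - y)
        (continuousAt_fundSol (sub_ne_zero.2 hxz)) (by fun_prop)
    have h2 : ContinuousAt (fun y => fundSol n (x - sphInv c R y)) z :=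
      ContinuousAt.comp (g := fundSol n) (f := fun y => x - sphInv c R y)
        (continuousAt_fundSol (by rw [hinv]; exact sub_ne_zero.2 hxz)) (continuousAt_const.sub hic)
    exact h1.sub (((continuousAt_const.div hnc hzc).pow _).mul h2)
  have hψt : Tendsto ψ (𝓝[D] z) (𝓝 0) := by
    rw [← hψz]; exact hψc.tendsto.mono_left nhdsWithin_le_nhds
  refine tendsto_of_tendsto_of_tendsto_of_le_of_le' hψt tendsto_const_nhds ?_ ?_
  · filter_upwards [self_mem_nhdsWithin] with y hy
    have := hU.le_kelvin hn hD hR hc hx hy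
    simp only [hψ, greenFn]; linarith
  · filter_upwards [self_mem_nhdsWithin,
      nhdsWithin_le_nhds (isOpen_compl_singleton.mem_nhds (show z ∈ ({x} : Set (Eu n))ᶜ from hxz.symm))] with y hy hyx
    have := hU.fundSol_le hn hD hx hy (Ne.symm hyx)
    simp only [greenFn]; linarith

open Classical in
/-- The extension by zero of the Green's function. -/
def greenExt (U : Eu n → Eu n → ℝ) (D : Set (Eu n)) (x z : Eu n) : ℝ :=
  if z ∈ D then greenFn U x z else 0

theorem greenExt_of_mem {x z : Eu n} (hz : z ∈ D) :
    greenExt U D x z = fundSol n (x - z) - U x z := if_pos hz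

theorem greenExt_of_notMem {x z : Eu n} (hz : z ∉ D) : greenExt U D x z = 0 := if_neg hz

theorem IsGreenCorrection.harm_greenExt (hn : 2 < n) (hD : IsBddDomain D)
    (hU : IsGreenCorrection D U) {x : Eu n} (hx : x ∈ D) : Harm (greenExt U D x) (D ∩ {x}ᶜ) :=
  (((harm_fundSol_sub' x).mono inter_subset_right).sub
    ((hU.harm_right hn hD hx).mono inter_subset_left)).congr
    (hD.1.inter isOpen_compl_singleton) fun _ hy => greenExt_of_mem hy.1

theorem IsGreenCorrection.continuousOn_greenExt (hn : 2 < n) (hD : IsBddDomain D)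
    (hU : IsGreenCorrection D U) (hE : HasExteriorBalls D) {x : Eu n} (hx : x ∈ D) :
    ContinuousOn (greenExt U D x) {x}ᶜ := by
  intro z hz
  refine ContinuousAt.continuousWithinAt ?_
  by_cases hzD : z ∈ D
  · exact (hU.harm_greenExt hn hD hx).1.continuousAt
      ((hD.1.inter isOpen_compl_singleton).mem_nhds ⟨hzD, hz⟩)
  · rw [ContinuousAt, greenExt_of_notMem hzD, ← nhdsWithin_univ, ← union_compl_self D,
      nhdsWithin_union, tendsto_sup]
    constructor
    · by_cases hzc : z ∈ closure D
      · refine (hU.tendsto_greenFn hn hD hE hx (hD.1.frontier_eq ▸ ⟨hzc, hzD⟩)).congr' ?_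
        filter_upwards [self_mem_nhdsWithin] with y hy
        exact (greenExt_of_mem hy).symm
      · rw [notMem_closure_iff_nhdsWithin_eq_bot.1 hzc]
        exact tendsto_bot
    · refine tendsto_const_nhds.congr' ?_
      filter_upwards [self_mem_nhdsWithin] with y hy
      exact (greenExt_of_notMem hy).symm

theorem IsGreenCorrection.abs_greenExt_le (hn : 2 < n) (hD : IsBddDomain D)
    (hU : IsGreenCorrection D U) {x z : Eu n} (hx : x ∈ D) (hz : bdist D x / 2 ≤ ‖x - z‖) :
    |greenExt U D x z| ≤ fundConst n * 2 ^ (n - 2) / bdist D x ^ (n - 2) := by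
  have : NeZero n := ⟨by omega⟩
  have hx0 := bdist_pos hD hx
  have hκ := (fundConst_pos hn).le
  by_cases hzD : z ∈ D
  · have hne : x ≠ z := by
      rintro rfl
      rw [sub_self, norm_zero] at hz; linarith
    have h1 := hU.fundSol_le hn hD hx hzD hne
    have h2 := neg_le_fundSol hn (half_pos hx0) hz
    have h3 := hU.nonpos hn hD (subset_closure hx) hzD
    have key : fundConst n * 2 ^ (n - 2) / bdist D x ^ (n - 2) =
        fundConst n / (bdist D x / 2) ^ (n - 2) := by
      rw [div_pow]; field_simp
    rw [key, greenExt_of_mem hzD, abs_of_nonpos (by linarith)]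
    linarith
  · rw [greenExt_of_notMem hzD, abs_zero]; positivity

end Green

theorem iteratedDeriv_line {g : Eu n → ℝ} {k : ℕ} (hg : ContDiff ℝ k g) (c w : Eu n) {j : ℕ}
    (hj : j ≤ k) (t : ℝ) : iteratedDeriv j (fun t : ℝ => g (c + t • w)) t =
      iteratedFDeriv ℝ j g (c + t • w) fun _ => w := by
  have h1 : (fun t : ℝ => g (c + t • w)) =
      (fun y => g (c + y)) ∘ (ContinuousLinearMap.toSpanSingleton ℝ w) := by
    ext t; simp
  have h2 : ContDiff ℝ k (fun y => g (c + y)) := hg.comp (contDiff_const.add contDiff_id)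
  rw [iteratedDeriv_eq_iteratedFDeriv, h1,
    ContinuousLinearMap.iteratedFDeriv_comp_right _ h2 t (i := j) (by exact_mod_cast hj),
    iteratedFDeriv_comp_add_left']
  simp

/-- Taylor expansion with a Hölder remainder. -/
theorem taylor_holder {g : Eu n → ℝ} {m : ℕ} (hg : ContDiff ℝ (m + 1 : ℕ) g) {C ε : ℝ≥0}
    (hC : HolderWith C ε (iteratedFDeriv ℝ (m + 1) g)) (c w : Eu n) :
    |g (c + w) - ∑ j ∈ Finset.range (m + 2), (j.factorial : ℝ)⁻¹ * iteratedFDeriv ℝ j g c fun _ => w| ≤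
      C * ‖w‖ ^ (ε : ℝ) * ‖w‖ ^ (m + 1) := by
  set f : ℝ → ℝ := fun t => g (c + t • w) with hf
  have hfc : ContDiff ℝ (m + 1 : ℕ) f :=
    hg.comp (contDiff_const.add (contDiff_id.smul contDiff_const))
  obtain ⟨ξ, hξ, h⟩ := taylor_mean_remainder_lagrange_iteratedDeriv (zero_ne_one (α := ℝ))
    (n := m) (f := f) (by exact_mod_cast hfc.contDiffOn)
  rw [uIoo_of_le zero_le_one] at hξ
  have h1 : taylorWithinEval f m (uIcc 0 1) 0 1 =
      ∑ j ∈ Finset.range (m + 1), (j.factorial : ℝ)⁻¹ * iteratedFDeriv ℝ j g c fun _ => w := by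
    rw [taylor_within_apply]
    refine Finset.sum_congr rfl fun j hj => ?_
    rw [Finset.mem_range] at hj
    rw [iteratedDerivWithin_eq_iteratedDeriv (uniqueDiffOn_uIcc zero_ne_one)
      (hfc.contDiffAt.of_le (by exact_mod_cast hj.le)) left_mem_uIcc, hf,
      iteratedDeriv_line hg c w hj.le]
    simp
  rw [h1, iteratedDeriv_line hg c w le_rfl] at h
  have h2 : f 1 = g (c + w) := by simp [hf]
  rw [h2, sub_zero, one_pow, mul_one] at h
  rw [Finset.sum_range_succ, ← sub_sub, h, div_eq_inv_mul, ← mul_sub, abs_mul,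
    ← sub_apply]
  have h3 := hC.dist_le (c + ξ • w) c
  rw [dist_eq_norm, dist_eq_norm, add_sub_cancel_left, norm_smul, norm_of_nonneg hξ.1.le] at h3
  have h4 : (ξ * ‖w‖) ^ (ε : ℝ) ≤ ‖w‖ ^ (ε : ℝ) :=
    rpow_le_rpow (mul_nonneg hξ.1.le (norm_nonneg _))
      (mul_le_of_le_one_left (norm_nonneg _) hξ.2.le) ε.2
  have h5 := (iteratedFDeriv ℝ (m + 1) g (c + ξ • w) - iteratedFDeriv ℝ (m + 1) g c).le_opNorm
    fun _ => w
  rw [Finset.prod_const, Finset.card_univ, Fintype.card_fin, norm_eq_abs] at h5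
  have h6 : |((m + 1).factorial : ℝ)⁻¹| ≤ 1 := by
    rw [abs_of_nonneg (by positivity)]
    exact inv_le_one_of_one_le₀ (by exact_mod_cast Nat.one_le_iff_ne_zero.2 (Nat.factorial_ne_zero _))
  refine (mul_le_mul_of_nonneg_right h6 (abs_nonneg _)).trans ?_
  rw [one_mul]
  exact h5.trans (mul_le_mul_of_nonneg_right
    (h3.trans (mul_le_mul_of_nonneg_left h4 C.coe_nonneg)) (by positivity))

theorem norm1_prod_X_le {j : ℕ} (s : Fin j → Fin n) :
    norm1 (∏ l, (MvPolynomial.X (s l) : MvPolynomial (Fin n) ℝ)) ≤ 1 := by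
  have : ∀ t : Finset (Fin j), norm1 (∏ l ∈ t, (MvPolynomial.X (s l) : MvPolynomial (Fin n) ℝ)) ≤ 1 := by
    intro t
    induction t using Finset.induction_on with
    | empty =>
      have := norm1_eq_sum (p := (1 : MvPolynomial (Fin n) ℝ)) (s := {0}) (by
        rw [← MvPolynomial.C_1]; exact MvPolynomial.support_monomial_subset)
      simp [this]
    | insert a t ha ih => rw [Finset.prod_insert ha, norm1_X_mul]; exact ih
  exact this _

theorem exists_poly_of_multilinear {j : ℕ} (T : Eu n [×j]→L[ℝ] ℝ) (R : Eu n ≃ₗᵢ[ℝ] Eu n) :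
    ∃ p : MvPolynomial (Fin n) ℝ, (∀ y, evp p y = T fun _ => R y) ∧ norm1 p ≤ (n : ℝ) ^ j * ‖T‖ ∧
      ∀ d : Fin n →₀ ℕ, d.degree ≠ j → p.coeff d = 0 := by
  refine ⟨∑ s : Fin j → Fin n, (T fun l => R (eb (s l))) • ∏ l, MvPolynomial.X (s l), fun y => ?_, ?_,
    fun d hd => ?_⟩
  · have h1 : ∀ y : Eu n, y = ∑ i, y i • eb i := fun y => by
      ext j; simp [eb, Pi.single_apply]
    have h2 : (fun _ : Fin j => R y) = fun _ => ∑ i, y i • R (eb i) := by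
      ext1; conv_lhs => rw [h1 y]
      simp
    rw [h2, T.map_sum, evp_sum]
    refine Finset.sum_congr rfl fun s _ => ?_
    rw [T.map_smul_univ]
    simp [evp, mul_comm]
  · refine (norm1_sum_le _ _).trans ?_
    have : ∀ s ∈ (Finset.univ : Finset (Fin j → Fin n)),
        norm1 ((T fun l => R (eb (s l))) • ∏ l, (MvPolynomial.X (s l) : MvPolynomial (Fin n) ℝ)) ≤ ‖T‖ := by
      intro s _
      rw [norm1_smul]
      have h1 := T.le_opNorm fun l => R (eb (s l))
      have h2 : ∀ i : Fin n, ‖(eb i : Eu n)‖ = 1 := fun i => by simp [eb]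
      simp only [LinearIsometryEquiv.norm_map, h2, Finset.prod_const_one, mul_one, norm_eq_abs] at h1
      calc _ ≤ |T fun l => R (eb (s l))| * 1 :=
            mul_le_mul_of_nonneg_left (norm1_prod_X_le s) (abs_nonneg _)
        _ ≤ _ := by rwa [mul_one]
    refine (Finset.sum_le_sum this).trans (le_of_eq ?_)
    simp
  · rw [MvPolynomial.coeff_sum]
    refine Finset.sum_eq_zero fun s _ => ?_
    rw [MvPolynomial.coeff_smul, MvPolynomial.IsHomogeneous.coeff_eq_zero (n := j), smul_zero]
    · have := MvPolynomial.IsHomogeneous.prod (R := ℝ) Finset.univ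
        (fun l : Fin j => MvPolynomial.X (s l)) (fun _ => 1) fun l _ => MvPolynomial.isHomogeneous_X ℝ (s l)
      simpa using this
    · exact hd

/-- Near `z₀` the domain is `{F > 0}`, where `F` has a controlled Taylor expansion at `z₀` with
unit normal `e`. -/
def HasChart (D : Set (Eu n)) (k : ℕ) (ε ρ M : ℝ) (z₀ : Eu n) : Prop :=
  ∃ (F : Eu n → ℝ) (e : Eu n) (lam : ℝ) (T : (j : ℕ) → Eu n [×j]→L[ℝ] ℝ),
    Continuous F ∧ ‖e‖ = 1 ∧ 1 ≤ lam ∧ (∀ y ∈ ball z₀ ρ, y ∈ D ↔ 0 < F y) ∧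
    (∀ j ≤ k, ‖T j‖ ≤ M) ∧ ∀ w, ‖w‖ < ρ →
      |F (z₀ + w) - (lam * ⟪w, e⟫ + ∑ j ∈ Finset.Ico 2 (k + 1), (j.factorial : ℝ)⁻¹ * T j fun _ => w)| ≤
        M * ‖w‖ ^ k * ‖w‖ ^ ε

theorem HasChart.mono {D : Set (Eu n)} {k : ℕ} {ε ρ M ρ' M' : ℝ} {z₀ : Eu n}
    (h : HasChart D k ε ρ M z₀) (hρ : ρ' ≤ ρ) (hM : M ≤ M') : HasChart D k ε ρ' M' z₀ := by
  obtain ⟨F, e, lam, T, hF, he, hl, hD, hT, hw⟩ := h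
  exact ⟨F, e, lam, T, hF, he, hl, fun y hy => hD y (ball_subset_ball hρ hy),
    fun j hj => (hT j hj).trans hM, fun w hw' => (hw w (hw'.trans_le hρ)).trans (by gcongr)⟩

theorem fderiv_eq_zero_of_invariant {g : Eu n → ℝ} {v : Eu n} (hv : ‖v‖ = 1)
    (hg : ∀ x, g x = g (x - ⟪x, v⟫ • v)) {z : Eu n} (hd : DifferentiableAt ℝ g z) :
    fderiv ℝ g z v = 0 := by
  have h1 : ∀ t : ℝ, g (z + t • v) = g z := fun t => by
    rw [hg (z + t • v), hg z, inner_add_left, inner_smul_left, real_inner_self_eq_norm_sq, hv]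
    congr 1
    simp only [conj_trivial, one_pow, mul_one, add_smul]
    abel
  have h2 : HasDerivAt (fun t : ℝ => z + t • v) v 0 := by
    simpa using ((hasDerivAt_id (0 : ℝ)).smul_const v).const_add z
  have h3 : HasFDerivAt g (fderiv ℝ g z) (z + (0 : ℝ) • v) := by
    rw [zero_smul, add_zero]; exact hd.hasFDerivAt
  have h4 := h3.comp_hasDerivAt (0 : ℝ) h2
  have h5 : (g ∘ fun t : ℝ => z + t • v) = fun _ => g z := funext h1
  rw [h5] at h4
  exact h4.unique (hasDerivAt_const _ _)

theorem hasChart_of_graph {D V : Set (Eu n)} {m : ℕ} {ε ε' ρ M : ℝ} {C : ℝ≥0} {g : Eu n → ℝ} {v z₀ : Eu n}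
    (hm : 1 ≤ m) (hε' : ε' ≤ ε) (hε0 : 0 < ε) (hv : ‖v‖ = 1) (hg : ContDiff ℝ (m + 1 : ℕ) g)
    (hC : HolderWith C ε.toNNReal (iteratedFDeriv ℝ (m + 1) g))
    (hinv : ∀ x, g x = g (x - ⟪x, v⟫ • v)) (hDV : D ∩ V = {x ∈ V | ⟪x, v⟫ < g x})
    (hz : ⟪z₀, v⟫ = g z₀) (hb : ball z₀ ρ ⊆ V) (hρ : ρ ≤ 1) (hCM : C ≤ M)
    (hM : ∀ j ≤ m + 1, ‖iteratedFDeriv ℝ j g z₀‖ ≤ M) : HasChart D (m + 1) ε' ρ M z₀ := by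
  have hd : DifferentiableAt ℝ g z₀ := hg.differentiable (by simp) z₀
  obtain ⟨a, ha⟩ : ∃ a : Eu n, ∀ w, ⟪a, w⟫ = fderiv ℝ g z₀ w - ⟪w, v⟫ := by
    refine ⟨(InnerProductSpace.toDual ℝ (Eu n)).symm (fderiv ℝ g z₀) - v, fun w => ?_⟩
    rw [inner_sub_left, InnerProductSpace.toDual_symm_apply, real_inner_comm w v]
  have hav : ⟪a, v⟫ = -1 := by
    rw [ha, fderiv_eq_zero_of_invariant hv hinv hd, real_inner_self_eq_norm_sq, hv]; norm_num
  have hl : 1 ≤ ‖a‖ := by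
    have := abs_real_inner_le_norm a v
    rw [hav, hv, mul_one] at this
    simpa using this
  have hl0 : ‖a‖ ≠ 0 := by linarith
  refine ⟨fun x => g x - ⟪x, v⟫, ‖a‖⁻¹ • a, ‖a‖, fun j => iteratedFDeriv ℝ j g z₀,
    hg.continuous.sub (by fun_prop), ?_, hl, fun y hy => ?_, hM, fun w hw => ?_⟩
  · rw [norm_smul, norm_inv, norm_norm, inv_mul_cancel₀ hl0]
  · have hyV := hb hy
    have : y ∈ D ∩ V ↔ y ∈ {x ∈ V | ⟪x, v⟫ < g x} := by rw [hDV]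
    simp only [mem_inter_iff, hyV, and_true, mem_ofPred_eq, true_and] at this
    rw [this, sub_pos]
  · have h1 := taylor_holder hg hC z₀ w
    have h2 : ∑ j ∈ Finset.range (m + 2), (j.factorial : ℝ)⁻¹ * (iteratedFDeriv ℝ j g z₀ fun _ => w) =
        g z₀ + fderiv ℝ g z₀ w +
          ∑ j ∈ Finset.Ico 2 (m + 1 + 1), (j.factorial : ℝ)⁻¹ * (iteratedFDeriv ℝ j g z₀ fun _ => w) := by
      rw [Finset.range_eq_Ico, Finset.sum_eq_sum_Ico_succ_bot (by omega),
        Finset.sum_eq_sum_Ico_succ_bot (by omega)]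
      simp [add_assoc]
    have h3 : ‖a‖ * ⟪w, ‖a‖⁻¹ • a⟫ = fderiv ℝ g z₀ w - ⟪w, v⟫ := by
      rw [inner_smul_right, ← mul_assoc, mul_inv_cancel₀ hl0, one_mul, real_inner_comm, ha]
    rw [h2] at h1
    rw [h3]
    beta_reduce
    rw [inner_add_left, hz]
    have h4 : ‖w‖ ^ (ε.toNNReal : ℝ) ≤ ‖w‖ ^ ε' := by
      rw [Real.coe_toNNReal _ hε0.le]
      rcases (norm_nonneg w).eq_or_lt with h0 | h0
      · by_cases he : ε' = 0
        · rw [he, rpow_zero, ← h0, zero_rpow hε0.ne']; norm_num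
        · rw [← h0, zero_rpow hε0.ne', zero_rpow he]
      · exact rpow_le_rpow_of_exponent_ge h0 (hw.le.trans hρ) hε'
    have h5 : (C : ℝ) * ‖w‖ ^ (ε.toNNReal : ℝ) * ‖w‖ ^ (m + 1) ≤ M * ‖w‖ ^ (m + 1) * ‖w‖ ^ ε' := by
      calc _ ≤ M * ‖w‖ ^ ε' * ‖w‖ ^ (m + 1) := by gcongr; exact C.coe_nonneg.trans hCM
        _ = _ := by ring
    refine le_trans (le_of_eq ?_) (h1.trans h5)
    congr 1
    ring

theorem exists_uniform_chart [NeZero n] {D : Set (Eu n)} {m : ℕ} {ε ε' : ℝ} (hm : 1 ≤ m)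
    (hε : 0 < ε) (hε' : ε' ≤ ε) (hD : IsBddDomain D) (hbd : HasGraphBoundary D (CkHolder (m + 1) ε)) :
    ∃ ρ M : ℝ, 0 < ρ ∧ ρ ≤ 1 ∧ 0 ≤ M ∧ ∀ z₀ ∈ frontier D, HasChart D (m + 1) ε' ρ M z₀ := by
  have hK : IsCompact (frontier D) :=
    Metric.isCompact_of_isClosed_isBounded isClosed_frontier
      (hD.2.2.closure.subset frontier_subset_closure)
  have key : ∃ ρ M : ℝ, 0 < ρ ∧ ρ ≤ 1 ∧ 0 ≤ M ∧
      ∀ z₀ ∈ frontier D, z₀ ∈ frontier D → HasChart D (m + 1) ε' ρ M z₀ := by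
    refine hK.induction_on
      (p := fun s => ∃ ρ M : ℝ, 0 < ρ ∧ ρ ≤ 1 ∧ 0 ≤ M ∧
        ∀ z₀ ∈ s, z₀ ∈ frontier D → HasChart D (m + 1) ε' ρ M z₀)
      ⟨1, 0, one_pos, le_rfl, le_rfl, fun _ h => h.elim⟩
      (fun s t hst ⟨ρ, M, h0, h1, h2, h⟩ => ⟨ρ, M, h0, h1, h2, fun z hz => h z (hst hz)⟩)
      (fun s t ⟨ρ, M, h0, h1, h2, h⟩ ⟨ρ', M', h0', h1', h2', h'⟩ =>
        ⟨min ρ ρ', max M M', lt_min h0 h0', (min_le_left _ _).trans h1, h2.trans (le_max_left _ _),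
          fun z hz hzf => hz.elim
            (fun hz => (h z hz hzf).mono (min_le_left _ _) (le_max_left _ _))
            fun hz => (h' z hz hzf).mono (min_le_right _ _) (le_max_right _ _)⟩)
      fun y hy => ?_
    obtain ⟨v, hv, V, hVo, hyV, g, ⟨hg, C, hC⟩, hinv, hDV, hfV⟩ := hbd y hy
    obtain ⟨r, hr, hrV⟩ := Metric.isOpen_iff.1 hVo y hyV
    have hbound : ∀ j ≤ m + 1, ∃ B, ∀ z ∈ closedBall y (r / 2), ‖iteratedFDeriv ℝ j g z‖ ≤ B :=
      fun j hj => (isCompact_closedBall y (r / 2)).exists_bound_of_continuousOn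
        (hg.continuous_iteratedFDeriv (by exact_mod_cast hj)).continuousOn
    choose! B hB using hbound
    refine ⟨ball y (r / 2), mem_nhdsWithin_of_mem_nhds (ball_mem_nhds y (half_pos hr)),
      min (r / 2) 1, C + ∑ j ∈ Finset.range (m + 2), |B j|, by positivity, min_le_right _ _,
      by positivity, fun z hz hzf => ?_⟩
    have hzr : ball z (min (r / 2) 1) ⊆ V := by
      refine (ball_subset_ball' ?_).trans hrV
      rw [mem_ball] at hz
      linarith [min_le_left (r / 2) 1]
    have hzV : z ∈ V := hrV (ball_subset_ball (by linarith) hz)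
    have hz0 : ⟪z, v⟫ = g z := by
      have : z ∈ frontier D ∩ V := ⟨hzf, hzV⟩
      rw [hfV] at this
      exact this.2
    refine hasChart_of_graph hm hε' hε hv hg hC hinv hDV hz0 hzr (min_le_right _ _)
      (le_add_of_nonneg_right (Finset.sum_nonneg fun _ _ => abs_nonneg _)) fun j hj => ?_
    refine (hB j hj z (ball_subset_closedBall hz)).trans ((le_abs_self _).trans
      (le_add_of_nonneg_of_le C.coe_nonneg ?_))
    exact Finset.single_le_sum (f := fun j => |B j|) (fun _ _ => abs_nonneg _)
      (Finset.mem_range.2 (by omega))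
  obtain ⟨ρ, M, h0, h1, h2, h⟩ := key
  exact ⟨ρ, M, h0, h1, h2, fun z hz => h z hz hz⟩

theorem HasChart.exists_exterior_ball {D : Set (Eu n)} {k : ℕ} {ε ρ M : ℝ} {z₀ : Eu n} (hk : 2 ≤ k)
    (hε : 0 < ε) (hρ : 0 < ρ) (hρ1 : ρ ≤ 1) (hM : 0 ≤ M) (h : HasChart D k ε ρ M z₀) :
    ∃ c R, 0 < R ∧ ‖z₀ - c‖ = R ∧ ∀ y ∈ D, R ≤ ‖y - c‖ := by
  obtain ⟨F, e, lam, T, hF, he, hl, hD, hT, hw⟩ := h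
  set K : ℝ := M * (k + 2) with hK
  have hK0 : 0 ≤ K := by positivity
  obtain ⟨R, hR0, hR1, hR2⟩ : ∃ R : ℝ, 0 < R ∧ 2 * R ≤ ρ ∧ K * (2 * R) ≤ 1 := by
    refine ⟨min (ρ / 2) (1 / (2 * (K + 1))), lt_min (by positivity) (by positivity),
      by linarith [min_le_left (ρ / 2) (1 / (2 * (K + 1)))], ?_⟩
    have h1 := min_le_right (ρ / 2) (1 / (2 * (K + 1)))
    calc _ ≤ K * (2 * (1 / (2 * (K + 1)))) := by gcongr
      _ ≤ 1 := by
        rw [mul_one_div, ← mul_div_assoc, div_le_one (by positivity)]; linarith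
  refine ⟨z₀ - R • e, R, hR0, by rw [sub_sub_cancel, norm_smul, he, mul_one, norm_of_nonneg hR0.le],
    fun y hy => ?_⟩
  by_contra! hlt
  set w := y - z₀ with hwdef
  have hyw : y = z₀ + w := by rw [hwdef]; abel
  have e1 : y - (z₀ - R • e) = w + R • e := by rw [hwdef]; abel
  rw [e1] at hlt
  have hwR : ‖w‖ < 2 * R := by
    have : ‖w‖ ≤ ‖w + R • e‖ + ‖R • e‖ := by
      simpa using norm_sub_le (w + R • e) (R • e)
    rw [norm_smul, he, mul_one, norm_of_nonneg hR0.le] at this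
    linarith
  have hwρ : ‖w‖ < ρ := by linarith
  have hw1 : ‖w‖ ≤ 1 := by linarith
  have hin : ‖w‖ ^ 2 + 2 * R * ⟪w, e⟫ < 0 := by
    have h1 : ‖w + R • e‖ ^ 2 < R ^ 2 := by gcongr
    rw [norm_add_sq_real, inner_smul_right, norm_smul, he, norm_of_nonneg hR0.le] at h1
    linarith
  have hFy : 0 < F (z₀ + w) := by
    rw [← hyw]
    exact (hD y (by rw [mem_ball, dist_eq_norm]; exact hwρ)).1 hy
  have hterm : ∀ j ∈ Finset.Ico 2 (k + 1), (j.factorial : ℝ)⁻¹ * (T j fun _ => w) ≤ M * ‖w‖ ^ 2 := by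
    intro j hj
    rw [Finset.mem_Ico] at hj
    have h1 := (T j).le_opNorm fun _ => w
    rw [Finset.prod_const, Finset.card_univ, Fintype.card_fin, norm_eq_abs] at h1
    have h2 : (j.factorial : ℝ)⁻¹ ≤ 1 :=
      inv_le_one_of_one_le₀ (by exact_mod_cast Nat.one_le_iff_ne_zero.2 (Nat.factorial_ne_zero _))
    calc (j.factorial : ℝ)⁻¹ * (T j fun _ => w) ≤ (j.factorial : ℝ)⁻¹ * |T j fun _ => w| := by
          gcongr; exact le_abs_self _
      _ ≤ 1 * (‖T j‖ * ‖w‖ ^ j) := by gcongr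
      _ ≤ 1 * (M * ‖w‖ ^ 2) := by
        gcongr 1 * (?_ * ?_)
        · exact hT j (by omega)
        · exact pow_le_pow_of_le_one (norm_nonneg _) hw1 hj.1
      _ = _ := one_mul _
  have hsum := Finset.sum_le_sum hterm
  rw [Finset.sum_const, Nat.card_Ico, nsmul_eq_mul] at hsum
  have hrem : M * ‖w‖ ^ k * ‖w‖ ^ ε ≤ M * ‖w‖ ^ 2 := by
    calc M * ‖w‖ ^ k * ‖w‖ ^ ε ≤ M * ‖w‖ ^ 2 * 1 := by
          gcongr M * ?_ * ?_
          · exact pow_le_pow_of_le_one (norm_nonneg _) hw1 hk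
          · exact rpow_le_one (norm_nonneg _) hw1 hε.le
      _ = _ := mul_one _
  have hcard : ((k + 1 - 2 : ℕ) : ℝ) ≤ k + 1 := by
    exact_mod_cast Nat.sub_le _ _
  have h1 := (abs_le.1 (hw w hwρ)).2
  have h2 : ((k + 1 - 2 : ℕ) : ℝ) * (M * ‖w‖ ^ 2) ≤ (k + 1) * (M * ‖w‖ ^ 2) := by gcongr
  have h3 : F (z₀ + w) ≤ lam * ⟪w, e⟫ + K * ‖w‖ ^ 2 := by
    rw [hK]; linarith
  have hneg : ⟪w, e⟫ ≤ 0 := by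
    by_contra! hpos
    have : 0 ≤ 2 * R * ⟪w, e⟫ := by positivity
    nlinarith [sq_nonneg ‖w‖]
  have h4 : lam * ⟪w, e⟫ ≤ ⟪w, e⟫ := by nlinarith
  have h5 : 2 * R * (K * ‖w‖ ^ 2) ≤ ‖w‖ ^ 2 := by nlinarith [sq_nonneg ‖w‖]
  nlinarith

/-- Boundary regularity: a function harmonic in `D` near `z₀` and vanishing outside of `D` is
approximated by a harmonic function in a full ball, to the order of smoothness of the boundary. -/
theorem exists_boundary_approx [NeZero n] (m : ℕ) {ε ρ M : ℝ} (hε : 0 < ε) (hε1 : ε < 1)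
    (hρ : 0 < ρ) (hρ1 : ρ ≤ 1) (hM : 0 ≤ M) : ∃ C r₀ : ℝ, 0 ≤ C ∧ 0 < r₀ ∧
      ∀ (D : Set (Eu n)) (z₀ z : Eu n) (r A : ℝ) (u : Eu n → ℝ), IsOpen D →
        HasChart D (m + 2) ε ρ M z₀ → 0 < r → r ≤ r₀ → 0 < A → ContinuousOn u (closedBall z₀ r) →
        Harm u (D ∩ ball z₀ r) → (∀ y ∈ ball z₀ r, |u y| ≤ A) → (∀ y ∉ D, u y = 0) →
        ball z ‖z - z₀‖ ⊆ D → 0 < ‖z - z₀‖ → ‖z - z₀‖ < r / 2 →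
        ∃ h : Eu n → ℝ, Harm h (ball z₀ r) ∧ (∀ y ∈ ball z₀ r, |h y| ≤ C * A) ∧
          ∀ y ∈ ball z ‖z - z₀‖, |u y - h y| ≤ C * A * (‖z - z₀‖ / r) ^ (m + 2) := by
  set i : Fin n := ⟨0, Nat.pos_of_ne_zero (NeZero.ne n)⟩
  obtain ⟨C, η, hC, hη, happ⟩ := exists_harmonic_approx i m hε hε1
  set S : ℝ := M * ∑ j ∈ Finset.Ico 2 (m + 2 + 1), (n : ℝ) ^ j with hS
  have hS0 : 0 ≤ S := by positivity
  obtain ⟨r₀, hr₀, hr₀ρ, hr₀η⟩ : ∃ r₀ : ℝ, 0 < r₀ ∧ r₀ < ρ ∧ r₀ * (S + M) ≤ η := by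
    refine ⟨min (ρ / 2) (η / (S + M + 1)), lt_min (by positivity) (by positivity),
      (min_le_left _ _).trans_lt (by linarith), ?_⟩
    calc _ ≤ η / (S + M + 1) * (S + M) := by gcongr; exact min_le_right _ _
      _ ≤ η := by
        rw [div_mul_eq_mul_div, div_le_iff₀ (by positivity)]
        exact mul_le_mul_of_nonneg_left (by linarith) hη.le
  refine ⟨C, r₀, hC, hr₀, fun D z₀ z r A u hDo hch hr hrr₀ hA huc hu huA hu0 hzD hz0 hzr => ?_⟩
  obtain ⟨F, e, lam, T, hF, he, hl, hDF, hT, hw⟩ := hch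
  have hl0 : 0 < lam := by linarith
  have hr1 : r ≤ 1 := by linarith
  obtain ⟨R, hR⟩ := exists_isometry_apply_eq i he
  choose q hq hqn hqc using fun j : ℕ => exists_poly_of_multilinear (T j) R
  set φ : Eu n → Eu n := fun y => z₀ + r • R y with hφ
  have hφn : ∀ y, ‖φ y - z₀‖ = r * ‖y‖ := fun y => by
    rw [hφ]; simp [norm_smul, abs_of_pos hr]
  have hφc : Continuous φ := continuous_const.add (R.continuous.const_smul r)
  set a : ℕ → ℝ := fun j => (r * lam)⁻¹ * r ^ j * (j.factorial : ℝ)⁻¹ with ha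
  set p : MvPolynomial (Fin n) ℝ := ∑ j ∈ Finset.Ico 2 (m + 2 + 1), a j • q j with hp
  have ha_le : ∀ j ∈ Finset.Ico 2 (m + 2 + 1), |a j| ≤ r := by
    intro j hj
    rw [Finset.mem_Ico] at hj
    have h2 : (j.factorial : ℝ)⁻¹ ≤ 1 :=
      inv_le_one_of_one_le₀ (by exact_mod_cast Nat.one_le_iff_ne_zero.2 (Nat.factorial_ne_zero _))
    rw [ha, abs_of_nonneg (by positivity)]
    calc (r * lam)⁻¹ * r ^ j * (j.factorial : ℝ)⁻¹ ≤ (r * 1)⁻¹ * r ^ 2 * 1 := by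
          gcongr ?_ * ?_ * ?_
          · gcongr
          · exact pow_le_pow_of_le_one hr.le hr1 hj.1
      _ = r := by field_simp
  have hpn : norm1 p ≤ η := by
    calc norm1 p ≤ ∑ j ∈ Finset.Ico 2 (m + 2 + 1), r * ((n : ℝ) ^ j * M) := by
          refine (norm1_sum_le _ _).trans (Finset.sum_le_sum fun j hj => ?_)
          rw [norm1_smul]
          refine mul_le_mul (ha_le j hj) ((hqn j).trans ?_) (norm1_nonneg _) hr.le
          exact mul_le_mul_of_nonneg_left (hT j (by rw [Finset.mem_Ico] at hj; omega)) (by positivity)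
      _ = r * S := by rw [hS, ← Finset.mul_sum, ← Finset.sum_mul]; ring
      _ ≤ r₀ * (S + M) := by gcongr; linarith
      _ ≤ η := hr₀η
  have hpc : ∀ d : Fin n →₀ ℕ, d.degree < 2 → p.coeff d = 0 := by
    intro d hd
    rw [hp, MvPolynomial.coeff_sum]
    refine Finset.sum_eq_zero fun j hj => ?_
    rw [Finset.mem_Ico] at hj
    rw [MvPolynomial.coeff_smul, hqc j d (by omega), smul_zero]
  set F' : Eu n → ℝ := fun y => (r * lam)⁻¹ * F (φ y) with hF'
  have hF'pos : ∀ y, 0 < F' y ↔ 0 < F (φ y) := fun y => by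
    rw [hF']; exact mul_pos_iff_of_pos_left (by positivity)
  have hφball : ∀ y ∈ ball (0 : Eu n) 1, φ y ∈ ball z₀ r := fun y hy => by
    rw [mem_ball, dist_zero_right] at hy
    rw [mem_ball, dist_eq_norm, hφn]
    nlinarith
  have hφρ : ∀ y ∈ closedBall (0 : Eu n) 1, φ y ∈ closedBall z₀ r ∧ φ y ∈ ball z₀ ρ := fun y hy => by
    rw [mem_closedBall, dist_zero_right] at hy
    have : r * ‖y‖ ≤ r := by nlinarith
    rw [mem_ball, mem_closedBall, dist_eq_norm, hφn]
    exact ⟨this, by linarith⟩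
  have hFD : ∀ y ∈ closedBall (0 : Eu n) 1, 0 < F' y ↔ φ y ∈ D := fun y hy => by
    rw [hF'pos, hDF _ (hφρ y hy).2]
  have hrem : ∀ y ∈ closedBall (0 : Eu n) 1,
      |F' y - (y i + evp p y)| ≤ η * ‖y‖ ^ (m + 2) * ‖y‖ ^ ε := by
    intro y hy
    have h1 := hw (r • R y) (by
      have := (hφρ y hy).2
      rwa [mem_ball, dist_eq_norm, hφ, add_sub_cancel_left] at this)
    rw [norm_smul, norm_of_nonneg hr.le, LinearIsometryEquiv.norm_map] at h1
    have h2 : F' y - (y i + evp p y) = (r * lam)⁻¹ * (F (z₀ + r • R y) -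
        (lam * ⟪r • R y, e⟫ + ∑ j ∈ Finset.Ico 2 (m + 2 + 1),
          (j.factorial : ℝ)⁻¹ * T j fun _ => r • R y)) := by
      have e1 : ⟪r • R y, e⟫ = r * y i := by
        rw [← hR, inner_smul_left, R.inner_map_map]
        simp [eb, EuclideanSpace.inner_single_right]
      have e2 : evp p y = (r * lam)⁻¹ * ∑ j ∈ Finset.Ico 2 (m + 2 + 1),
          (j.factorial : ℝ)⁻¹ * T j fun _ => r • R y := by
        rw [hp, evp_sum, Finset.mul_sum]
        refine Finset.sum_congr rfl fun j _ => ?_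
        have := (T j).map_smul_univ (fun _ => r) fun _ => R y
        rw [evp_smul, hq, this, Finset.prod_const, Finset.card_univ, Fintype.card_fin, ha, smul_eq_mul]
        ring
      rw [e1, e2, hF']
      field_simp
      ring
    rw [h2, abs_mul, abs_of_pos (by positivity : 0 < (r * lam)⁻¹)]
    rw [mul_pow, mul_rpow hr.le (norm_nonneg _)] at h1
    calc (r * lam)⁻¹ * _ ≤ (r * 1)⁻¹ * (M * (r ^ (m + 2) * ‖y‖ ^ (m + 2)) * (r ^ ε * ‖y‖ ^ ε)) := by
          gcongr
      _ ≤ (r * 1)⁻¹ * (M * (r ^ 2 * ‖y‖ ^ (m + 2)) * (1 * ‖y‖ ^ ε)) := by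
          gcongr (r * 1)⁻¹ * (M * (?_ * _) * (?_ * _))
          · exact pow_le_pow_of_le_one hr.le hr1 (by omega)
          · exact rpow_le_one hr.le hr1 hε.le
      _ = r * M * ‖y‖ ^ (m + 2) * ‖y‖ ^ ε := by field_simp
      _ ≤ η * ‖y‖ ^ (m + 2) * ‖y‖ ^ ε := by
          gcongr
          refine le_trans ?_ hr₀η
          gcongr; linarith
  have hu' : Harm (fun y => A⁻¹ * u (φ y)) {y | y ∈ ball (0 : Eu n) 1 ∧ 0 < F' y} := by
    have hO : IsOpen {y : Eu n | z₀ + r • y ∈ D ∩ ball z₀ r} :=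
      (hDo.inter isOpen_ball).preimage (by fun_prop)
    refine (((hu.comp_affine z₀ hr).comp_isometry hO R).const_mul A⁻¹).mono fun y hy => ?_
    exact ⟨(hFD y (ball_subset_closedBall hy.1)).1 hy.2, hφball y hy.1⟩
  set z' : Eu n := R.symm (r⁻¹ • (z - z₀)) with hz'
  have hz'n : ‖z'‖ = ‖z - z₀‖ / r := by
    rw [hz', LinearIsometryEquiv.norm_map, norm_smul, norm_of_nonneg (by positivity), div_eq_inv_mul]
  have hφz : φ z' = z := by
    rw [hφ, hz']; simp [smul_smul, hr.ne']
  have hφsub : ∀ y, ‖φ y - z‖ = r * ‖y - z'‖ := fun y => by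
    rw [← hφz, hφ]
    simp only [add_sub_add_left_eq_sub, ← smul_sub, ← map_sub, norm_smul, norm_of_nonneg hr.le,
      LinearIsometryEquiv.norm_map]
  have hz'1 : ‖z'‖ < 1 / 2 := by rw [hz'n, div_lt_iff₀ hr]; linarith
  obtain ⟨P, hP, hPC, hPu⟩ := happ p F' (fun y => A⁻¹ * u (φ y)) hpn hpc
    (continuous_const.mul (hF.comp hφc)).continuousOn hrem
    (continuousOn_const.mul (huc.comp hφc.continuousOn fun y hy => (hφρ y hy).1)) hu'
    (fun y hy _ => by
      rw [abs_mul, abs_of_pos (by positivity), inv_mul_le_iff₀ hA, mul_one]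
      exact huA _ (hφball y hy))
    (fun y hy h0 => by
      have : φ y ∉ D := fun h => by
        have := (hFD y (ball_subset_closedBall hy)).2 h
        rw [h0] at this; exact lt_irrefl _ this
      rw [hu0 _ this, mul_zero])
    z' (by rw [← norm_pos_iff, hz'n]; positivity) hz'1 (fun y hy => by
      rw [mem_ball, dist_eq_norm] at hy
      refine (hFD y ?_).2 (hzD ?_)
      · have := norm_le_norm_add_norm_sub' y z'
        rw [mem_closedBall, dist_zero_right]
        linarith
      · rw [mem_ball, dist_eq_norm, hφsub]
        rw [hz'n, lt_div_iff₀ hr] at hy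
        linarith)
  set ψ : Eu n → Eu n := fun y => R.symm (-(r⁻¹ • z₀) + r⁻¹ • y) with hψ
  have hψφ : ∀ y, φ (ψ y) = y := fun y => by
    rw [hφ, hψ]; simp [smul_smul, hr.ne']
  refine ⟨fun y => A * evp P (ψ y), ?_, fun y hy => ?_, fun y hy => ?_⟩
  · have h1 := (((harm_evp hP univ).comp_isometry isOpen_univ R.symm).comp_affine (-(r⁻¹ • z₀))
      (inv_pos.2 hr)).const_mul A
    exact h1.mono fun _ _ => trivial
  · rw [abs_mul, abs_of_pos hA, mul_comm]
    refine mul_le_mul_of_nonneg_right (hPC _ ?_) hA.le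
    rw [mem_ball, dist_eq_norm, ← hψφ y, hφn] at hy
    rw [mem_ball, dist_zero_right]
    exact (mul_lt_iff_lt_one_right hr).1 hy
  · have h1 := hPu (ψ y) (by
      rw [mem_ball, dist_eq_norm, hz'n, lt_div_iff₀ hr, mul_comm, ← hφsub, hψφ]
      rwa [mem_ball, dist_eq_norm] at hy)
    beta_reduce at h1
    rw [hψφ, hz'n] at h1
    have h2 : u y - A * evp P (ψ y) = A * (A⁻¹ * u y - evp P (ψ y)) := by field_simp
    rw [h2, abs_mul, abs_of_pos hA]
    calc _ ≤ A * _ := mul_le_mul_of_nonneg_left h1 hA.le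
      _ = _ := by ring

theorem exists_boundary_pdMulti_bound [NeZero n] (m : ℕ) {ε ρ M : ℝ} (hε : 0 < ε) (hε1 : ε < 1)
    (hρ : 0 < ρ) (hρ1 : ρ ≤ 1) (hM : 0 ≤ M) (G : List (Fin n)) (hG : G.length ≤ m + 2) :
    ∃ C r₀ : ℝ, 0 ≤ C ∧ 0 < r₀ ∧
      ∀ (D : Set (Eu n)) (z₀ z : Eu n) (r A : ℝ) (u : Eu n → ℝ), IsOpen D →
        HasChart D (m + 2) ε ρ M z₀ → 0 < r → r ≤ r₀ → 0 < A → ContinuousOn u (closedBall z₀ r) →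
        Harm u (D ∩ ball z₀ r) → (∀ y ∈ ball z₀ r, |u y| ≤ A) → (∀ y ∉ D, u y = 0) →
        ball z ‖z - z₀‖ ⊆ D → 0 < ‖z - z₀‖ → ‖z - z₀‖ < r / 2 →
        |pdMulti G u z| ≤ C * A / r ^ G.length := by
  obtain ⟨C, r₀, hC, hr₀, H⟩ := exists_boundary_approx (n := n) m hε hε1 hρ hρ1 hM
  obtain ⟨K, hK, HK⟩ := exists_pdMulti_bound (n := n) G
  refine ⟨K * C + K * C * 2 ^ G.length, r₀, by positivity, hr₀, ?_⟩
  intro D z₀ z r A u hDo hch hr hrr hA huc huh hub hu0 hbD hd hdr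
  obtain ⟨h, hh, hhb, hd1⟩ := H D z₀ z r A u hDo hch hr hrr hA huc huh hub hu0 hbD hd hdr
  set d := ‖z - z₀‖ with hd_def
  have hsub : ball z d ⊆ ball z₀ r := by
    refine ball_subset_ball' ?_
    rw [dist_eq_norm]
    linarith
  have hsub2 : ball z (r / 2) ⊆ ball z₀ r := by
    refine ball_subset_ball' ?_
    rw [dist_eq_norm]
    linarith
  have hu1 : Harm u (ball z d) := huh.mono (subset_inter hbD hsub)
  have hh1 : Harm h (ball z d) := hh.mono hsub
  have e1 : pdMulti G u z = pdMulti G (fun y => u y - h y) z + pdMulti G h z := by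
    rw [pdMulti_sub isOpen_ball hu1 hh1 G z (mem_ball_self hd)]
    ring
  have b1 := HK (fun y => u y - h y) z d _ hd (hu1.sub hh1) hd1
  have b2 := HK h z (r / 2) _ (by positivity) (hh.mono hsub2) fun y hy => hhb y (hsub2 hy)
  have hq : (d / r) ^ (m + 2) ≤ (d / r) ^ G.length :=
    pow_le_pow_of_le_one (by positivity) (by rw [div_le_one hr]; linarith) hG
  have b3 : K * (C * A * (d / r) ^ (m + 2)) / d ^ G.length ≤ K * C * A / r ^ G.length := by
    calc K * (C * A * (d / r) ^ (m + 2)) / d ^ G.length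
        ≤ K * (C * A * (d / r) ^ G.length) / d ^ G.length := by gcongr
      _ = K * C * A / r ^ G.length := by
          rw [div_pow]
          field_simp
  have b4 : K * (C * A) / (r / 2) ^ G.length = K * C * 2 ^ G.length * A / r ^ G.length := by
    rw [div_pow]
    field_simp
  rw [e1]
  refine (abs_add_le _ _).trans ((add_le_add (b1.trans b3) (b2.trans b4.le)).trans_eq ?_)
  ring

theorem exists_frontier_dist_eq [NeZero n] {D : Set (Eu n)} (hD : IsBddDomain D) {z : Eu n}
    (hz : z ∈ D) : ∃ z₀ ∈ frontier D, ‖z - z₀‖ = bdist D z := by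
  obtain ⟨z₀, hz₀, h⟩ := hD.1.isClosed_compl.exists_infDist_eq_dist hD.compl_nonempty z
  have h' : ‖z - z₀‖ = bdist D z := by rw [bdist, h, dist_eq_norm]
  have hpos := bdist_pos hD hz
  refine ⟨z₀, ⟨?_, by rwa [hD.1.interior_eq]⟩, h'⟩
  refine closure_mono (ball_bdist_subset z) ?_
  rw [closure_ball z hpos.ne', mem_closedBall, dist_comm, dist_eq_norm, h']

theorem IsGreenCorrection.exists_pdMulti_bound (hn : 2 < n) {k₀ : ℕ} (hk₀ : 2 ≤ k₀) {ε : ℝ}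
    (hε : 0 < ε) {D : Set (Eu n)} (hD : IsBddDomain D) (hbd : HasGraphBoundary D (CkHolder k₀ ε))
    {U : Eu n → Eu n → ℝ} (hU : IsGreenCorrection D U) (G : List (Fin n)) (hG : G.length ≤ k₀) :
    ∃ C : ℝ, 0 ≤ C ∧ ∀ x ∈ D, ∀ z ∈ D,
      |_root_.pdMulti G (U x) z| ≤ C / bdist D x ^ (n + G.length - 2) := by
  have : NeZero n := ⟨by omega⟩
  obtain ⟨m, rfl⟩ : ∃ m, k₀ = m + 2 := ⟨k₀ - 2, by omega⟩
  have hε' : 0 < min ε (1 / 2) := by positivity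
  obtain ⟨ρ, M, hρ, hρ1, hM, hch⟩ :=
    exists_uniform_chart (m := m + 1) (by omega) hε (min_le_left ε (1 / 2)) hD hbd
  have hE : HasExteriorBalls D := fun z hz =>
    (hch z hz).exists_exterior_ball (by omega) hε' hρ hρ1 hM
  obtain ⟨C₁, r₀, hC₁, hr₀, H₁⟩ := exists_boundary_pdMulti_bound (n := n) m hε'
    ((min_le_right _ _).trans_lt (by norm_num)) hρ hρ1 hM G hG
  obtain ⟨C₂, hC₂, H₂⟩ := _root_.exists_pdMulti_bound (n := n) G
  obtain ⟨C₃, hC₃, H₃⟩ := exists_fundSol_bound hn G []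
  obtain ⟨R, hR, HR⟩ := exists_bdist_le hD
  set κ := min (1 / 8) (r₀ / R) with hκ
  have hκ0 : 0 < κ := by positivity
  have hκ1 : κ ≤ 1 / 8 := min_le_left _ _
  set A₀ := fundConst n * 2 ^ (n - 2) with hA₀
  have hA₀pos : 0 < A₀ := by have := fundConst_pos hn; positivity
  have hN : n + G.length - 2 = (n - 2) + G.length := by omega
  refine ⟨C₂ * A₀ / (κ / 2) ^ G.length + (C₁ * A₀ / κ ^ G.length
    + C₃ * 2 ^ (n + G.length - 2)), by positivity, fun x hx z hz => ?_⟩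
  set δ := bdist D x with hδ
  have hδpos : 0 < δ := bdist_pos hD hx
  set r := κ * δ with hr
  have hrpos : 0 < r := by positivity
  have hrδ : r ≤ δ / 8 := by
    rw [hr]
    nlinarith
  have hrr : r ≤ r₀ := by
    calc κ * δ ≤ r₀ / R * R := by
          gcongr
          · exact min_le_right _ _
          · exact HR x hx
      _ = r₀ := by field_simp
  have hApos : 0 < A₀ / δ ^ (n - 2) := by positivity
  rcases le_or_gt (r / 2) (bdist D z) with hcase | hcase
  · have hs : ball z (r / 2) ⊆ D := (ball_subset_ball hcase).trans (ball_bdist_subset z)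
    have b := H₂ (U x) z (r / 2) _ (by positivity) ((hU.harm_right hn hD hx).mono hs)
      fun y hy => hU.abs_le' hn hD hx (hs hy)
    refine b.trans ?_
    calc C₂ * (A₀ / δ ^ (n - 2)) / (r / 2) ^ G.length
        = C₂ * A₀ / (κ / 2) ^ G.length / δ ^ (n + G.length - 2) := by
          rw [hr, hN, pow_add, show κ * δ / 2 = κ / 2 * δ by ring, mul_pow]
          field_simp
      _ ≤ _ := by
          gcongr
          exact le_add_of_nonneg_right (by positivity)
  · obtain ⟨z₀, hz₀, hzz⟩ := exists_frontier_dist_eq hD hz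
    have hz₀D := notMem_of_frontier hD.1 hz₀
    have hxz₀ : δ ≤ ‖x - z₀‖ := bdist_le_of_notMem hz₀D
    have hfar : ∀ y ∈ closedBall z₀ r, δ / 2 ≤ ‖x - y‖ := fun y hy => by
      rw [mem_closedBall, dist_eq_norm] at hy
      have : ‖x - z₀‖ ≤ ‖x - y‖ + ‖y - z₀‖ := by
        simpa using norm_add_le (x - y) (y - z₀)
      linarith
    have hne : ∀ y ∈ closedBall z₀ r, y ∈ ({x}ᶜ : Set (Eu n)) := fun y hy h => by
      have := hfar y hy
      rw [mem_singleton_iff.1 h] at this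
      simp at this
      linarith
    have hzd := bdist_pos hD hz
    have b1 := H₁ D z₀ z r (A₀ / δ ^ (n - 2)) (greenExt U D x) hD.1 (hch z₀ hz₀) hrpos hrr hApos
      ((hU.continuousOn_greenExt hn hD hE hx).mono hne)
      ((hU.harm_greenExt hn hD hx).mono
        (inter_subset_inter_right _ fun y hy => hne y (ball_subset_closedBall hy)))
      (fun y hy => hU.abs_greenExt_le hn hD hx (hfar y (ball_subset_closedBall hy)))
      (fun y hy => greenExt_of_notMem hy) (hzz ▸ ball_bdist_subset z) (hzz ▸ hzd)
      (hzz ▸ hcase)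
    have hzc : z ∈ closedBall z₀ r := by
      rw [mem_closedBall, dist_eq_norm, hzz]
      linarith
    have hxz : x ≠ z := fun h => hne z hzc (by simp [h])
    have hO : IsOpen (D ∩ {x}ᶜ) := hD.1.inter isOpen_compl_singleton
    have e : _root_.pdMulti G (U x) z = _root_.pdMulti G (fun y => fundSol n (x - y)) z
        - _root_.pdMulti G (greenExt U D x) z := by
      rw [← pdMulti_sub hO ((harm_fundSol_sub' x).mono inter_subset_right)
        (hU.harm_greenExt hn hD hx) G z ⟨hz, hne z hzc⟩]
      refine pdMulti_congr hO (fun y hy => ?_) G z ⟨hz, hne z hzc⟩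
      rw [greenExt_of_mem hy.1]
      ring
    have b2 := (H₃ x z hxz).2
    simp only [List.length_nil, add_zero] at b2
    change |_root_.pdMulti G (fun y => fundSol n (x - y)) z| ≤ _ at b2
    have b3 : C₃ / ‖x - z‖ ^ (n + G.length - 2) ≤
        C₃ * 2 ^ (n + G.length - 2) / δ ^ (n + G.length - 2) := by
      calc C₃ / ‖x - z‖ ^ (n + G.length - 2) ≤ C₃ / (δ / 2) ^ (n + G.length - 2) := by
            gcongr
            exact hfar z hzc
        _ = _ := by
            rw [div_pow]
            field_simp
    have b4 : C₁ * (A₀ / δ ^ (n - 2)) / r ^ G.length =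
        C₁ * A₀ / κ ^ G.length / δ ^ (n + G.length - 2) := by
      rw [hr, hN, pow_add, mul_pow]
      field_simp
    rw [e]
    refine (abs_sub _ _).trans ((add_le_add (b2.trans b3) (b1.trans b4.le)).trans ?_)
    rw [← add_div]
    refine div_le_div_of_nonneg_right ?_ (by positivity)
    have : 0 ≤ C₂ * A₀ / (κ / 2) ^ G.length := by positivity
    linarith

/-- estimates (2.11) and its companion: on a bounded domain with
C^{k₀,ε} boundary, (i) |∂_z^γ U(x,z)| ≤ C δ(x)^{2−n−|γ|} for |γ| ≤ k₀, and
(ii) |∂_x^β∂_z^γ G(x,z)| ≤ C (|x−z|^{2−n−|γ|−|β|} + δ(x)^{2−n−|γ|−|β|}). -/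
theorem stmt19 {n : ℕ} (hn : 2 < n) (k₀ : ℕ) (hk₀ : 2 ≤ k₀) (ε : ℝ) (hε : 0 < ε)
    (D : Set (Eu n)) (hD : IsBddDomain D) (hbd : HasGraphBoundary D (CkHolder k₀ ε))
    (U : Eu n → Eu n → ℝ) (hU : IsGreenCorrection D U) :
    ∀ G B : List (Fin n), G.length ≤ k₀ →
      ∃ C : ℝ, 0 < C ∧
        (∀ x ∈ D, ∀ z ∈ D,
          |pdMulti G (fun z' => U x z') z| ≤
            C / bdist D x ^ (n + G.length - 2)) ∧
        (∀ x ∈ D, ∀ z ∈ D, x ≠ z →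
          |pdMulti B (fun x' => pdMulti G (fun z' => greenFn U x' z') z) x| ≤
            C * (1 / ‖x - z‖ ^ (n + G.length + B.length - 2) +
                 1 / bdist D x ^ (n + G.length + B.length - 2))) := by
  intro G B hG
  have : NeZero n := ⟨by omega⟩
  obtain ⟨C₁, hC₁, H₁⟩ := hU.exists_pdMulti_bound hn hk₀ hε hD hbd G hG
  obtain ⟨C₂, hC₂, H₂⟩ := exists_fundSol_bound hn G B
  obtain ⟨C₃, hC₃, H₃⟩ := exists_pdMulti_bound (n := n) B
  have hN : n + G.length + B.length - 2 = (n + G.length - 2) + B.length := by omega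
  set N := n + G.length - 2 with hN'
  set C₄ := C₃ * C₁ * 2 ^ (N + B.length) with hC₄
  have hC₄0 : 0 ≤ C₄ := by positivity
  refine ⟨C₁ + C₂ + C₄ + 1, by positivity, fun x hx z hz => ?_, fun x hx z hz hxz => ?_⟩
  · have := bdist_pos hD hx
    refine (H₁ x hx z hz).trans ?_
    gcongr
    linarith
  have hδ := bdist_pos hD hx
  set δ := bdist D x with hδ_def
  have hd : 0 < ‖x - z‖ := norm_pos_iff.2 (sub_ne_zero.2 hxz)
  obtain ⟨hΓ, bΓ⟩ := H₂ x z hxz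
  have hUx : Harm (fun w => pdMulti G (U w) z) D :=
    ((hU.biHarm hn hD).pdMulti hD.1 hD.1 G).left z hz
  set s := min (‖x - z‖ / 4) δ with hs
  have hs0 : 0 < s := by positivity
  have hsD : ball x s ⊆ D := (ball_subset_ball (min_le_right _ _)).trans (ball_bdist_subset x)
  have e1 : ∀ w ∈ ball x s, pdMulti G (fun y => greenFn U w y) z =
      pdMulti G (fun y => fundSol n (w - y)) z - pdMulti G (U w) z := fun w hw => by
    have hwz : z ≠ w := by
      rintro rfl
      have h1 : ‖x - z‖ < ‖x - z‖ / 4 := by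
        have := (mem_ball.1 hw).trans_le (min_le_left _ _)
        rwa [dist_comm, dist_eq_norm] at this
      linarith
    exact pdMulti_sub (hD.1.inter isOpen_compl_singleton)
      ((harm_fundSol_sub' w).mono inter_subset_right)
      ((hU.harm_right hn hD (hsD hw)).mono inter_subset_left) G z ⟨hz, hwz⟩
  rw [pdMulti_congr isOpen_ball e1 B x (mem_ball_self hs0),
    pdMulti_sub isOpen_ball (hΓ.mono (ball_subset_ball (min_le_left _ _))) (hUx.mono hsD) B x
      (mem_ball_self hs0)]
  have hhalf : ball x (δ / 2) ⊆ D :=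
    (ball_subset_ball (by linarith)).trans (ball_bdist_subset x)
  have bU := H₃ (fun w => pdMulti G (U w) z) x (δ / 2) (C₁ / (δ / 2) ^ N) (by positivity)
    (hUx.mono hhalf) fun w hw => by
      refine (H₁ w (hhalf hw) z hz).trans ?_
      have h1 := bdist_le_add (D := D) x w
      rw [mem_ball, dist_comm, dist_eq_norm] at hw
      gcongr
      linarith
  have b3 : C₃ * (C₁ / (δ / 2) ^ N) / (δ / 2) ^ B.length = C₄ * (1 / δ ^ (N + B.length)) := by
    rw [hC₄, div_pow, div_pow, pow_add, pow_add]
    field_simp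
  rw [hN] at bΓ ⊢
  rw [b3] at bU
  have p1 : 0 ≤ 1 / ‖x - z‖ ^ (N + B.length) := by positivity
  have p2 : 0 ≤ 1 / δ ^ (N + B.length) := by positivity
  rw [div_eq_mul_one_div] at bΓ
  refine (abs_sub _ _).trans ((add_le_add bΓ bU).trans ?_)
  rw [mul_add]
  gcongr <;> linarith
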